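/- arXiv:1905.04179 — 2 statements merged into one kernel-verified Lean document; each statement's English description precedes it below -/
import Mathlib

section
/- (Pham–Vinh–De Zeeuw) There exist absolute constants C, c > 0 such that the following holds. Let p be a prime and let A, X ⊆ F_p be finite sets with |X| ≥ C·|A|. Then |X − (A−A)²| ≥ c·min{ p, |X|^{1/2}·|A| }. -/
open Finset Pointwise

namespace FpSumProd

/-- `A² = {a² : a ∈ A}`. -/
def sqSet {p : ℕ} (A : Finset (ZMod p)) : Finset (ZMod p) := A.image fun a => a ^ 2

/-- `A² - A² = {a² - b² : a, b ∈ A}` (here `A - B` denotes the pointwise difference set). -/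
def sqDiff {p : ℕ} (A : Finset (ZMod p)) : Finset (ZMod p) := sqSet A - sqSet A

section Elimination

open Polynomial in
/-- A prime polynomial of positive degree has nonzero resultant with every polynomial that it does
not divide. -/
theorem resultant_ne_zero_of_prime {R : Type*} [CommRing R] [IsDomain R] {f g : R[X]}
    (hf : Prime f) (hg : ¬ f ∣ g) : f.resultant g ≠ 0 := by
  intro h0
  let b₁ := ((degreeLT.basis R f.natDegree).prod (degreeLT.basis R g.natDegree)).reindex
    finSumFinEquiv
  let b₂ := degreeLT.basis R (f.natDegree + g.natDegree)
  obtain ⟨u, hu0, hu⟩ := Matrix.exists_mulVec_eq_zero_iff.mpr h0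
  rw [← toMatrix_sylvesterMap' f g le_rfl le_rfl] at hu
  set x := b₁.equivFun.symm u with hx
  have hxu : ⇑(b₁.repr x) = u := by
    rw [hx, ← Module.Basis.equivFun_apply, LinearEquiv.apply_symm_apply]
  have hx0 : x ≠ 0 := by
    intro h
    apply hu0
    rw [← hxu, h]
    simp
  have hmap : sylvesterMap f g le_rfl le_rfl x = 0 := by
    have h2 := LinearMap.toMatrix_mulVec_repr b₁ b₂ (sylvesterMap f g le_rfl le_rfl) x
    rw [hxu, hu] at h2
    apply b₂.repr.injective
    rw [map_zero]
    ext i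
    simp [← h2]
  have heq : f * (x.2 : R[X]) + g * (x.1 : R[X]) = 0 := by
    have := congrArg Subtype.val hmap
    simpa using this
  have hdvd : f ∣ g * (x.1 : R[X]) := by
    have : g * (x.1 : R[X]) = f * (-(x.2 : R[X])) := by linear_combination heq
    exact ⟨_, this⟩
  have h1 : (x.1 : R[X]) = 0 := by
    have h3 := (hf.dvd_or_dvd hdvd).resolve_left hg
    refine eq_zero_of_dvd_of_degree_lt h3 ?_
    have := x.1.2
    rw [mem_degreeLT] at this
    rwa [degree_eq_natDegree hf.ne_zero]
  have h2 : (x.2 : R[X]) = 0 := by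
    rw [h1, mul_zero, add_zero] at heq
    exact (mul_eq_zero.mp heq).resolve_left hf.ne_zero
  exact hx0 (Prod.ext (Subtype.ext h1) (Subtype.ext h2))

open Polynomial in
theorem degreeOf_resultant_le {K : Type*} [CommRing K] {σ : Type*}
    (j : σ) (f g : (MvPolynomial σ K)[X]) (b c m n : ℕ)
    (hf : ∀ i, (f.coeff i).degreeOf j ≤ b) (hg : ∀ i, (g.coeff i).degreeOf j ≤ c) :
    (f.resultant g m n).degreeOf j ≤ c * m + b * n := by
  rw [resultant, Matrix.det_apply]
  refine (MvPolynomial.degreeOf_sum_le _ _ _).trans (Finset.sup_le fun s _ => ?_)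
  have hsign : ∀ q : MvPolynomial σ K,
      ((Equiv.Perm.sign s) • q).degreeOf j = q.degreeOf j := by
    intro q
    rcases Int.units_eq_one_or (Equiv.Perm.sign s) with h | h <;> rw [h]
    · simp
    · simp [Units.smul_def]
  rw [hsign]
  refine (MvPolynomial.degreeOf_prod_le _ _ _).trans ?_
  rw [Fin.sum_univ_add]
  refine add_le_add ?_ ?_
  · refine (Finset.sum_le_card_nsmul _ _ c fun i _ => ?_).trans ?_
    · simp only [sylvester, Matrix.of_apply, Fin.addCases_left]
      split_ifs
      · exact hg _
      · simp
    · simp [mul_comm]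
  · refine (Finset.sum_le_card_nsmul _ _ b fun i _ => ?_).trans ?_
    · simp only [sylvester, Matrix.of_apply, Fin.addCases_right]
      split_ifs
      · exact hf _
      · simp
    · simp [mul_comm]

/-- Elimination of the first variable from a prime polynomial `G` and a polynomial `T` that is
not a multiple of `G`. -/
theorem exists_eliminant {K : Type*} [Field K] {n : ℕ} {G T : MvPolynomial (Fin (n + 1)) K}
    (hG : Prime G) (h0 : 0 < G.degreeOf 0) (hT : ¬ G ∣ T) :
    ∃ ρ : MvPolynomial (Fin n) K, ρ ≠ 0 ∧
      (∀ j, ρ.degreeOf j ≤ T.degreeOf j.succ * G.degreeOf 0 + G.degreeOf j.succ * T.degreeOf 0) ∧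
      ∃ U V, MvPolynomial.rename Fin.succ ρ = G * U + T * V := by
  let e := MvPolynomial.finSuccEquiv K n
  have hG' : Prime (e G) := (MulEquiv.prime_iff e).mpr hG
  have hT' : ¬ e G ∣ e T := fun h => hT ((map_dvd_iff e).mp h)
  have hdG : (e G).natDegree = G.degreeOf 0 := MvPolynomial.natDegree_finSuccEquiv G
  have hdT : (e T).natDegree = T.degreeOf 0 := MvPolynomial.natDegree_finSuccEquiv T
  refine ⟨(e G).resultant (e T), resultant_ne_zero_of_prime hG' hT', fun j => ?_, ?_⟩
  · rw [hdG, hdT]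
    exact degreeOf_resultant_le j _ _ _ _ _ _
      (fun i => MvPolynomial.degreeOf_coeff_finSuccEquiv G j i)
      (fun i => MvPolynomial.degreeOf_coeff_finSuccEquiv T j i)
  · obtain ⟨p, q, -, -, hpq⟩ := Polynomial.exists_mul_add_mul_eq_C_resultant
      (e G) (e T) le_rfl le_rfl (Or.inl (by omega))
    refine ⟨e.symm p, e.symm q, ?_⟩
    apply e.injective
    rw [map_add, map_mul, map_mul, e.apply_symm_apply, e.apply_symm_apply, hpq]
    induction (e G).resultant (e T) using MvPolynomial.induction_on with
    | C a => simp [e, MvPolynomial.finSuccEquiv_apply]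
    | add p q hp hq => rw [map_add, map_add, hp, hq, map_add]
    | mul_X p i hp =>
      rw [map_mul, map_mul, hp, MvPolynomial.rename_X, MvPolynomial.finSuccEquiv_X_succ, map_mul]

theorem aeval_cons_eq_eval {K B : Type*} [CommRing K] [CommRing B] [Algebra K B] {n : ℕ}
    (b : Fin n → B) (r : B) (q : MvPolynomial (Fin (n + 1)) K) :
    MvPolynomial.aeval (Fin.cons r b : Fin (n + 1) → B) q =
      ((MvPolynomial.finSuccEquiv K n q).map
        (MvPolynomial.aeval b : MvPolynomial (Fin n) K →ₐ[K] B).toRingHom).eval r := by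
  have : ((Polynomial.aeval r).restrictScalars K).comp
      ((Polynomial.mapAlgHom (MvPolynomial.aeval b : MvPolynomial (Fin n) K →ₐ[K] B)).comp
        (MvPolynomial.finSuccEquiv K n).toAlgHom) =
      MvPolynomial.aeval (Fin.cons r b : Fin (n + 1) → B) := by
    apply MvPolynomial.algHom_ext
    intro i
    refine Fin.cases ?_ (fun i => ?_) i
    · simp [MvPolynomial.finSuccEquiv_X_zero]
    · simp [MvPolynomial.finSuccEquiv_X_succ]
  rw [← this]
  simp [Polynomial.coe_aeval_eq_eval]

theorem injective_aeval_cons_X {K B : Type*} [CommRing K] [CommRing B] [Algebra K B] {n : ℕ}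
    (b : Fin n → B)
    (hb : Function.Injective (MvPolynomial.aeval b : MvPolynomial (Fin n) K →ₐ[K] B)) :
    Function.Injective (MvPolynomial.aeval
      (Fin.cons Polynomial.X (fun i => Polynomial.C (b i)) : Fin (n + 1) → Polynomial B) :
      MvPolynomial (Fin (n + 1)) K →ₐ[K] Polynomial B) := by
  have : MvPolynomial.aeval
      (Fin.cons Polynomial.X (fun i => Polynomial.C (b i)) : Fin (n + 1) → Polynomial B) =
      (Polynomial.mapAlgHom (MvPolynomial.aeval b : MvPolynomial (Fin n) K →ₐ[K] B)).comp
        (MvPolynomial.finSuccEquiv K n).toAlgHom := by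
    apply MvPolynomial.algHom_ext
    intro i
    refine Fin.cases ?_ (fun i => ?_) i
    · simp [MvPolynomial.finSuccEquiv_X_zero]
    · simp [MvPolynomial.finSuccEquiv_X_succ]
  rw [this]
  exact (Polynomial.map_injective _ hb).comp (MvPolynomial.finSuccEquiv K n).injective

theorem injective_aeval_singleton {K B : Type*} [CommRing K] [CommRing B] [Algebra K B]
    (φ : Polynomial K →ₐ[K] B) (hφ : Function.Injective φ) :
    Function.Injective (MvPolynomial.aeval ![φ Polynomial.X] :
      MvPolynomial (Fin 1) K →ₐ[K] B) := by
  have : (MvPolynomial.aeval ![φ Polynomial.X] : MvPolynomial (Fin 1) K →ₐ[K] B) =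
      φ.comp (MvPolynomial.uniqueAlgEquiv K (Fin 1)).toAlgHom := by
    apply MvPolynomial.algHom_ext
    intro i
    fin_cases i
    simp
  rw [this]
  exact hφ.comp (MvPolynomial.uniqueAlgEquiv K (Fin 1)).injective

/-- A nonzero polynomial, viewed as a polynomial in its first variable, has at most as many roots
as its degree. -/
theorem card_le_degreeOf_of_root {K B : Type*} [CommRing K] [CommRing B] [IsDomain B]
    [Algebra K B] {n : ℕ} (b : Fin n → B)
    (hb : Function.Injective (MvPolynomial.aeval b : MvPolynomial (Fin n) K →ₐ[K] B))
    {q : MvPolynomial (Fin (n + 1)) K} (hq : q ≠ 0) (s : Finset B)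
    (hs : ∀ r ∈ s, MvPolynomial.aeval (Fin.cons r b : Fin (n + 1) → B) q = 0) :
    s.card ≤ q.degreeOf 0 := by
  classical
  let P := (MvPolynomial.finSuccEquiv K n q).map
    (MvPolynomial.aeval b : MvPolynomial (Fin n) K →ₐ[K] B).toRingHom
  have hP : P ≠ 0 := by
    rw [Ne, Polynomial.map_eq_zero_iff hb]
    simpa using hq
  calc s.card ≤ P.roots.toFinset.card := by
        refine Finset.card_le_card fun r hr => ?_
        rw [Multiset.mem_toFinset, Polynomial.mem_roots hP, Polynomial.IsRoot,
          ← aeval_cons_eq_eval, hs r hr]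
    _ ≤ P.natDegree := (Multiset.toFinset_card_le _).trans (Polynomial.card_roots' P)
    _ ≤ (MvPolynomial.finSuccEquiv K n q).natDegree := Polynomial.natDegree_map_le
    _ = q.degreeOf 0 := MvPolynomial.natDegree_finSuccEquiv q

/-- A nonzero bivariate polynomial has few roots that are polynomials in its second variable. -/
theorem card_le_degreeOf_of_polynomial_root {K ι : Type*} [Field K] {ρ : MvPolynomial (Fin 2) K}
    (hρ : ρ ≠ 0) (J : Finset ι) (W : ι → Polynomial K) (hW : Set.InjOn W J)
    (hroot : ∀ j ∈ J, MvPolynomial.aeval ![W j, Polynomial.X] ρ = 0) :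
    J.card ≤ ρ.degreeOf 0 := by
  classical
  rw [← Finset.card_image_of_injOn hW]
  refine card_le_degreeOf_of_root ![Polynomial.X]
    (injective_aeval_singleton (AlgHom.id K _) Function.injective_id) hρ _ fun w hw => ?_
  obtain ⟨j, hj, rfl⟩ := Finset.mem_image.mp hw
  exact hroot j hj

/-- A Bézout bound: a prime `G` and a polynomial `T` that is not a multiple of `G` have few common
zeros `(y, w)` over `K[v]` with distinct `w`. -/
theorem card_common_zeros_le {K ι : Type*} [Field K] {G T : MvPolynomial (Fin 3) K}
    (hG : Prime G) (h0 : 0 < G.degreeOf 0) (hT : ¬ G ∣ T) (J : Finset ι)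
    (Y W : ι → Polynomial K) (hW : Set.InjOn W J)
    (hGz : ∀ j ∈ J, MvPolynomial.aeval ![Y j, W j, Polynomial.X] G = 0)
    (hTz : ∀ j ∈ J, MvPolynomial.aeval ![Y j, W j, Polynomial.X] T = 0) :
    J.card ≤ T.degreeOf 1 * G.degreeOf 0 + G.degreeOf 1 * T.degreeOf 0 := by
  obtain ⟨ρ, hρ0, hdeg, U, V, hUV⟩ := exists_eliminant hG h0 hT
  refine (card_le_degreeOf_of_polynomial_root hρ0 J W hW fun j hj => ?_).trans (hdeg 0)
  have h1 := congrArg (MvPolynomial.aeval ![Y j, W j, Polynomial.X]) hUV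
  rw [map_add, map_mul, map_mul, hGz j hj, hTz j hj, zero_mul, zero_mul, add_zero,
    MvPolynomial.aeval_rename] at h1
  rw [← h1]
  congr 2

end Elimination

section Flex

open MvPolynomial

theorem degreeOf_pderiv_le {K σ : Type*} [CommSemiring K] (i j : σ) (q : MvPolynomial σ K) :
    (pderiv i q).degreeOf j ≤ q.degreeOf j := by
  rw [degreeOf_le_iff]
  intro m hm
  have h : m + Finsupp.single i 1 ∈ q.support := by
    rw [mem_support_iff, coeff_pderiv] at hm
    exact mem_support_iff.mpr (left_ne_zero_of_mul hm)
  have := degreeOf_le_iff.mp (le_refl (q.degreeOf j)) _ h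
  rw [Finsupp.add_apply] at this
  omega

theorem degreeOf_pderiv_self_lt {K σ : Type*} [CommSemiring K] (i : σ) {q : MvPolynomial σ K}
    (h0 : 0 < q.degreeOf i) : (pderiv i q).degreeOf i < q.degreeOf i := by
  rw [degreeOf_lt_iff h0]
  intro m hm
  have h : m + Finsupp.single i 1 ∈ q.support := by
    rw [mem_support_iff, coeff_pderiv] at hm
    exact mem_support_iff.mpr (left_ne_zero_of_mul hm)
  have := degreeOf_le_iff.mp (le_refl (q.degreeOf i)) _ h
  rw [Finsupp.add_apply, Finsupp.single_eq_same] at this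
  omega

theorem natCast_ne_zero_of_pos_of_lt {K : Type*} [AddMonoidWithOne K] (p : ℕ) [CharP K p] {n : ℕ}
    (h0 : 0 < n) (hn : n < p) : (n : K) ≠ 0 := fun h =>
  absurd (Nat.le_of_dvd h0 ((CharP.cast_eq_zero_iff K p n).mp h)) (by omega)

theorem not_dvd_pderiv {K σ : Type*} [Field K] (p : ℕ) [CharP K p] (i : σ) {q : MvPolynomial σ K}
    (h0 : 0 < q.degreeOf i) (hp : q.degreeOf i < p) : ¬ q ∣ pderiv i q := by
  classical
  have hne : pderiv i q ≠ 0 := by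
    have hq : q.support.Nonempty := by
      rw [Finset.nonempty_iff_ne_empty, Ne, MvPolynomial.support_eq_empty]
      rintro rfl
      simp at h0
    obtain ⟨m, hm, hmi⟩ := Finset.exists_mem_eq_sup q.support hq fun m => m i
    rw [← degreeOf_eq_sup] at hmi
    have hsub : m - Finsupp.single i 1 + Finsupp.single i 1 = m :=
      tsub_add_cancel_of_le (by rw [Finsupp.single_le_iff]; omega)
    have hcast : (((m - Finsupp.single i 1 : σ →₀ ℕ) i : ℕ) : K) + 1 = (q.degreeOf i : K) := by
      have h2 := DFunLike.congr_fun hsub i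
      rw [Finsupp.add_apply, Finsupp.single_eq_same, ← hmi] at h2
      rw [← h2]
      push_cast
      rfl
    refine ne_zero_iff.mpr ⟨m - Finsupp.single i 1, ?_⟩
    rw [coeff_pderiv, hsub, hcast]
    exact mul_ne_zero (mem_support_iff.mp hm) (natCast_ne_zero_of_pos_of_lt p h0 hp)
  rintro ⟨u, hu⟩
  have hq0 : q ≠ 0 := by rintro rfl; simp at h0
  have hu0 : u ≠ 0 := by rintro rfl; simp [hne] at hu
  have h1 := degreeOf_pderiv_self_lt i h0
  rw [hu, degreeOf_mul_eq hq0 hu0] at h1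
  omega

/-- The numerator of the second derivative of `y` as a function of `w` along `G(y, w, v) = 0`;
here the coordinates `0`, `1`, `2` are `y`, `w`, `v`. -/
noncomputable def flex {K : Type*} [Field K] (G : MvPolynomial (Fin 3) K) :
    MvPolynomial (Fin 3) K :=
  pderiv 0 G * pderiv 0 G * pderiv 1 (pderiv 1 G)
    - C 2 * (pderiv 1 G * pderiv 0 G * pderiv 1 (pderiv 0 G))
    + pderiv 1 G * pderiv 1 G * pderiv 0 (pderiv 0 G)

theorem degreeOf_mul₃_le {K σ : Type*} [CommSemiring K] {i : σ} {a b c : MvPolynomial σ K} {n : ℕ}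
    (ha : a.degreeOf i ≤ n) (hb : b.degreeOf i ≤ n) (hc : c.degreeOf i ≤ n) :
    (a * b * c).degreeOf i ≤ 3 * n := by
  have h1 := degreeOf_mul_le i (a * b) c
  have h2 := degreeOf_mul_le i a b
  omega

theorem degreeOf_flex_le {K : Type*} [Field K] (G : MvPolynomial (Fin 3) K) (i : Fin 3) :
    (flex G).degreeOf i ≤ 3 * G.degreeOf i := by
  have h1 := fun j => degreeOf_pderiv_le j i G
  have h2 := fun j k => (degreeOf_pderiv_le j i (pderiv k G)).trans (h1 k)
  refine (degreeOf_add_le _ _ _).trans (max_le ((degreeOf_sub_le _ _ _).trans (max_le ?_ ?_)) ?_)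
  · exact degreeOf_mul₃_le (h1 _) (h1 _) (h2 _ _)
  · exact (degreeOf_C_mul_le _ _ _).trans (degreeOf_mul₃_le (h1 _) (h1 _) (h2 _ _))
  · exact degreeOf_mul₃_le (h1 _) (h1 _) (h2 _ _)

/-- The chain rule for a derivation applied to a polynomial expression. -/
theorem derivation_aeval {K σ B : Type*} [CommRing K] [CommRing B] [Algebra K B]
    [Fintype σ] (𝒟 : Derivation K B B) (a : σ → B) (q : MvPolynomial σ K) :
    𝒟 (aeval a q) = ∑ i, aeval a (pderiv i q) * 𝒟 (a i) := by
  classical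
  induction q using MvPolynomial.induction_on with
  | C r => simp
  | add q r hq hr => simp [hq, hr, add_mul, Finset.sum_add_distrib]
  | mul_X q i hq =>
    simp only [map_mul, aeval_X, Derivation.leibniz, hq, pderiv_X, smul_eq_mul, map_add, add_mul,
      Finset.sum_add_distrib]
    congr 1
    · rw [Finset.sum_eq_single i]
      · simp
      · intro j _ hj
        simp [Pi.single_eq_of_ne' hj]
      · simp
    · rw [Finset.mul_sum]
      exact Finset.sum_congr rfl fun j _ => by ring

/-- A derivation of `S` acting on the coefficients of polynomials over `S`. -/
noncomputable def coeffDerivation {K S : Type*} [CommRing K] [CommRing S] [Algebra K S]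
    (D : Derivation K S S) : Derivation K (Polynomial S) (Polynomial S) :=
  Derivation.mk'
    { toFun := fun q => PolynomialModule.equivPolynomialSelf (D.mapCoeffs q)
      map_add' := fun q r => by simp
      map_smul' := fun c q => by
        ext n
        simp [PolynomialModule.equivPolynomialSelf, D.mapCoeffs_apply] }
    fun q r => by
      have h : ∀ (a : Polynomial S) (m : PolynomialModule S S),
          PolynomialModule.equivPolynomialSelf (a • m) =
            a • PolynomialModule.equivPolynomialSelf m := fun a m => map_smul _ a m
      change PolynomialModule.equivPolynomialSelf (D.mapCoeffs (q * r)) = _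
      rw [D.mapCoeffs.leibniz, map_add, h, h]
      rfl

theorem coeff_coeffDerivation {K S : Type*} [CommRing K] [CommRing S] [Algebra K S]
    (D : Derivation K S S) (q : Polynomial S) (n : ℕ) :
    (coeffDerivation D q).coeff n = D (q.coeff n) := rfl

theorem pderiv_zero_one {K : Type*} [CommSemiring K] (q : MvPolynomial (Fin 3) K) :
    pderiv 0 (pderiv 1 q) = pderiv 1 (pderiv 0 q) := by
  ext m
  simp only [coeff_pderiv, Finsupp.add_apply, add_right_comm m (Finsupp.single 0 1)]
  simp
  ring

/-- The restriction of `q` to the parametrised line through `(y, w)` with direction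
`(-∂G/∂w, ∂G/∂y)`, as a polynomial in the parameter. -/
noncomputable def alongTangent {K : Type*} [Field K] (G : MvPolynomial (Fin 3) K) :
    MvPolynomial (Fin 3) K →ₐ[K] Polynomial (MvPolynomial (Fin 3) K) :=
  aeval ![Polynomial.C (X 0) - Polynomial.X * Polynomial.C (pderiv 1 G),
    Polynomial.C (X 1) + Polynomial.X * Polynomial.C (pderiv 0 G), Polynomial.C (X 2)]

theorem alongTangent_coeff_zero {K : Type*} [Field K] (G q : MvPolynomial (Fin 3) K) :
    (alongTangent G q).coeff 0 = q := by
  have : ((Polynomial.aeval (0 : MvPolynomial (Fin 3) K)).restrictScalars K).comp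
      (alongTangent G) = AlgHom.id K _ := by
    apply MvPolynomial.algHom_ext
    intro i
    fin_cases i <;> simp [alongTangent]
  have h := DFunLike.congr_fun this q
  rw [Polynomial.coeff_zero_eq_eval_zero]
  simpa [Polynomial.coe_aeval_eq_eval] using h

/-- If the flex polynomial of a prime `G` is a multiple of `G`, then all the coefficients of `G`
along its tangent lines, up to the characteristic, are multiples of `G`. -/
theorem dvd_coeff_alongTangent {K : Type*} [Field K] (p : ℕ) [CharP K p]
    {G : MvPolynomial (Fin 3) K} (hG : Prime G) (h0 : ¬ G ∣ pderiv 0 G) (hflex : G ∣ flex G)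
    (n : ℕ) (hn : n < p) : G ∣ (alongTangent G G).coeff n := by
  let D : Derivation K (MvPolynomial (Fin 3) K) (MvPolynomial (Fin 3) K) :=
    pderiv 0 G • pderiv 1 - pderiv 1 G • pderiv 0
  have hD : ∀ q, D q = pderiv 0 G * pderiv 1 q - pderiv 1 G * pderiv 0 q := fun q => by
    simp [D]
  have hDdvd : ∀ q, G ∣ q → G ∣ D q := by
    rintro _ ⟨u, rfl⟩
    refine ⟨D u, ?_⟩
    rw [hD, hD, pderiv_mul, pderiv_mul]
    ring
  have key : Polynomial.C (pderiv 0 G) * coeffDerivation D (alongTangent G G) -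
      (Polynomial.C (pderiv 0 G) + Polynomial.X * Polynomial.C (D (pderiv 0 G))) *
        Polynomial.derivative (alongTangent G G) =
      Polynomial.C (flex G) * (-Polynomial.X * alongTangent G (pderiv 0 G)) := by
    have hC : ∀ q, coeffDerivation D (Polynomial.C q) = Polynomial.C (D q) := by
      intro q
      ext m
      rw [coeff_coeffDerivation, Polynomial.coeff_C, Polynomial.coeff_C]
      split_ifs <;> simp
    have hX : coeffDerivation D Polynomial.X = 0 := by
      ext m
      rw [coeff_coeffDerivation, Polynomial.coeff_X]
      split_ifs <;> simp
    have h1 := derivation_aeval (coeffDerivation D)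
      ![Polynomial.C (X 0) - Polynomial.X * Polynomial.C (pderiv 1 G),
        Polynomial.C (X 1) + Polynomial.X * Polynomial.C (pderiv 0 G), Polynomial.C (X 2)] G
    have h2 := derivation_aeval (Polynomial.derivative'.restrictScalars K :
        Derivation K (Polynomial (MvPolynomial (Fin 3) K)) _)
      ![Polynomial.C (X 0) - Polynomial.X * Polynomial.C (pderiv 1 G),
        Polynomial.C (X 1) + Polynomial.X * Polynomial.C (pderiv 0 G), Polynomial.C (X 2)] G
    rw [← alongTangent] at h1 h2
    change Polynomial.derivative (alongTangent G G) = _ at h2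
    rw [h1, h2]
    simp only [Fin.sum_univ_three, Matrix.cons_val]
    have e2 : ∀ q, (Polynomial.derivative'.restrictScalars K :
      Derivation K (Polynomial (MvPolynomial (Fin 3) K)) _) q = Polynomial.derivative q :=
      fun _ => rfl
    simp only [e2, map_add, map_sub, Derivation.leibniz, hC, hX, Polynomial.derivative_mul,
      Polynomial.derivative_C,
      Polynomial.derivative_X, hD, pderiv_X_self, smul_eq_mul, flex, map_mul, map_ofNat,
      pderiv_X_of_ne (show (1 : Fin 3) ≠ 0 by decide),
      pderiv_X_of_ne (show (0 : Fin 3) ≠ 1 by decide),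
      pderiv_X_of_ne (show (2 : Fin 3) ≠ 1 by decide),
      pderiv_X_of_ne (show (2 : Fin 3) ≠ 0 by decide), pderiv_zero_one]
    simp only [map_zero, map_one]
    ring
  have hrec : ∀ m : ℕ, G ∣ (alongTangent G G).coeff m →
      G ∣ pderiv 0 G * (((m + 1 : ℕ) : MvPolynomial (Fin 3) K) *
        (alongTangent G G).coeff (m + 1)) := by
    intro m hm
    have hXd : ∀ a, (Polynomial.X * Polynomial.C a *
        Polynomial.derivative (alongTangent G G)).coeff m =
        a * ((m : MvPolynomial (Fin 3) K) * (alongTangent G G).coeff m) := by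
      intro a
      rw [mul_comm Polynomial.X, mul_assoc, Polynomial.coeff_C_mul]
      congr 1
      cases m with
      | zero => simp
      | succ m => rw [Polynomial.coeff_X_mul, Polynomial.coeff_derivative]; push_cast; ring
    have h := congrArg (fun q => Polynomial.coeff q m) key
    simp only [Polynomial.coeff_sub, add_mul, Polynomial.coeff_add, Polynomial.coeff_C_mul, hXd,
      coeff_coeffDerivation, Polynomial.coeff_derivative] at h
    obtain ⟨u, hu⟩ := hDdvd _ hm
    obtain ⟨u', hu'⟩ := hm
    obtain ⟨s, hs⟩ := hflex
    rw [hu, hs] at h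
    set z := (-Polynomial.X * alongTangent G (pderiv 0 G)).coeff m
    refine ⟨pderiv 0 G * u - D (pderiv 0 G) * (m * u') - s * z, ?_⟩
    push_cast
    linear_combination (-1) * h - D (pderiv 0 G) * m * hu'
  induction n with
  | zero =>
    rw [alongTangent_coeff_zero]
  | succ m ih =>
    have h1 := (hG.dvd_or_dvd (hrec m (ih (by omega)))).resolve_left h0
    have hu : IsUnit (((m + 1 : ℕ) : MvPolynomial (Fin 3) K)) := by
      rw [← map_natCast (C : K →+* MvPolynomial (Fin 3) K)]
      exact (IsUnit.mk0 _ (natCast_ne_zero_of_pos_of_lt p m.succ_pos hn)).map C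
    exact (hu.dvd_mul_left).mp h1

theorem natDegree_aeval_le_sum_degreeOf {K S σ : Type*} [CommSemiring K] [CommSemiring S]
    [Algebra K S] [Fintype σ] (a : σ → Polynomial S) (d : σ → ℕ) (ha : ∀ i, (a i).natDegree ≤ d i)
    (q : MvPolynomial σ K) : (aeval a q).natDegree ≤ ∑ i, q.degreeOf i * d i := by
  rw [aeval_def, eval₂_eq']
  refine Polynomial.natDegree_sum_le_of_forall_le _ _ fun m hm => ?_
  rw [Polynomial.algebraMap_apply]
  refine (Polynomial.natDegree_C_mul_le _ _).trans ((Polynomial.natDegree_prod_le _ _).trans ?_)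
  refine Finset.sum_le_sum fun i _ => (Polynomial.natDegree_pow_le_of_le _ (ha i)).trans ?_
  exact Nat.mul_le_mul_right _ (degreeOf_le_iff.mp le_rfl m hm)

theorem natDegree_alongTangent_le {K : Type*} [Field K] (G q : MvPolynomial (Fin 3) K) :
    (alongTangent G q).natDegree ≤ q.degreeOf 0 + q.degreeOf 1 := by
  refine (natDegree_aeval_le_sum_degreeOf _ ![1, 1, 0] (fun i => ?_) q).trans
    (by simp [Fin.sum_univ_three])
  fin_cases i
  · change (Polynomial.C (X 0) - Polynomial.X * Polynomial.C (pderiv 1 G)).natDegree ≤ 1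
    compute_degree
  · change (Polynomial.C (X 1) + Polynomial.X * Polynomial.C (pderiv 0 G)).natDegree ≤ 1
    compute_degree
  · exact (Polynomial.natDegree_C _).le

/-- If the flex polynomial of a prime `G` of small degree is a multiple of `G`, then `G` vanishes
on the tangent lines at its zeros. -/
theorem aeval_tangent_eq_zero {K : Type*} [Field K] (p : ℕ) [CharP K p]
    {G : MvPolynomial (Fin 3) K} (hG : Prime G) (h0 : ¬ G ∣ pderiv 0 G) (hflex : G ∣ flex G)
    (hp : G.degreeOf 0 + G.degreeOf 1 < p) {B : Type*} [CommRing B] [Algebra K B]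
    (x : Fin 3 → B) (hx : aeval x G = 0) :
    aeval ![Polynomial.C (x 0) - Polynomial.X * Polynomial.C (aeval x (pderiv 1 G)),
      Polynomial.C (x 1) + Polynomial.X * Polynomial.C (aeval x (pderiv 0 G)),
      Polynomial.C (x 2)] G = (0 : Polynomial B) := by
  have h : (Polynomial.mapAlgHom (aeval x)).comp (alongTangent G) =
      aeval ![Polynomial.C (x 0) - Polynomial.X * Polynomial.C (aeval x (pderiv 1 G)),
      Polynomial.C (x 1) + Polynomial.X * Polynomial.C (aeval x (pderiv 0 G)),
      Polynomial.C (x 2)] := by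
    apply MvPolynomial.algHom_ext
    intro i
    fin_cases i <;> simp [alongTangent] <;> ring
  rw [← h]
  ext n
  rw [AlgHom.comp_apply, Polynomial.coe_mapAlgHom, Polynomial.coeff_map, Polynomial.coeff_zero]
  have hdvd : G ∣ (alongTangent G G).coeff n := by
    by_cases hn : n < p
    · exact dvd_coeff_alongTangent p hG h0 hflex n hn
    · rw [Polynomial.coeff_eq_zero_of_natDegree_lt]
      · exact dvd_zero _
      · have := natDegree_alongTangent_le G G
        omega
  obtain ⟨u, hu⟩ := hdvd
  rw [hu]
  simp [hx]

/-- A triple of points `(Y i, W i)` is collinear. -/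
def Collinear3 {ι R : Type*} [CommRing R] (Y W : ι → R) (i j l : ι) : Prop :=
  (Y l - Y i) * (W j - W i) = (Y j - Y i) * (W l - W i)

/-- A prime polynomial of small degree that divides its flex polynomial has few nonsingular zeros
in a set with few collinear points. -/
theorem card_nonsingular_zeros_le {K ι : Type*} [Field K] (p : ℕ) [CharP K p]
    {G : MvPolynomial (Fin 3) K} (hG : Prime G) (h0 : ¬ G ∣ pderiv 0 G) (hflex : G ∣ flex G)
    (hp : G.degreeOf 0 + G.degreeOf 1 < p) (J : Finset ι) (Y W : ι → Polynomial K) (k : ℕ)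
    (hk : ∀ T ⊆ J, (∀ i ∈ T, ∀ j ∈ T, ∀ l ∈ T, Collinear3 Y W i j l) → T.card ≤ k)
    (hGz : ∀ j ∈ J, aeval ![Y j, W j, Polynomial.X] G = 0)
    (hGy : ∀ j ∈ J, aeval ![Y j, W j, Polynomial.X] (pderiv 0 G) ≠ 0) :
    J.card ≤ k * G.degreeOf 0 := by
  classical
  let κ := FractionRing (Polynomial K)
  let φ : Polynomial K →ₐ[K] κ := Algebra.algHom K (Polynomial K) κ
  have hφ : Function.Injective φ := IsFractionRing.injective (Polynomial K) κ
  let β : ι → κ := fun j => φ (aeval ![Y j, W j, Polynomial.X] (pderiv 1 G)) /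
    φ (aeval ![Y j, W j, Polynomial.X] (pderiv 0 G))
  let ρ : ι → Polynomial κ := fun j =>
    Polynomial.C (φ (Y j)) - Polynomial.C (β j) * (Polynomial.X - Polynomial.C (φ (W j)))
  have hroot : ∀ j ∈ J, aeval ![ρ j, Polynomial.X, Polynomial.C (φ Polynomial.X)] G = 0 := by
    intro j hj
    have h1 := aeval_tangent_eq_zero p hG h0 hflex hp _ (hGz j hj)
    have hne : φ (aeval ![Y j, W j, Polynomial.X] (pderiv 0 G)) ≠ 0 := by
      rw [Ne, map_eq_zero_iff _ hφ]
      exact hGy j hj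
    let s : Polynomial κ := Polynomial.C (φ (aeval ![Y j, W j, Polynomial.X] (pderiv 0 G)))⁻¹ *
      (Polynomial.X - Polynomial.C (φ (W j)))
    let ψ : Polynomial (Polynomial K) →+* Polynomial κ :=
      Polynomial.eval₂RingHom (Polynomial.C.comp φ.toRingHom) s
    have hcommutes : ∀ r : K, ψ (algebraMap K (Polynomial (Polynomial K)) r) =
        algebraMap K (Polynomial κ) r := by
      intro r
      change ψ (Polynomial.C (Polynomial.C r)) = Polynomial.C (algebraMap K κ r)
      have : φ (Polynomial.C r) = algebraMap K κ r := φ.commutes r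
      simp [ψ, this]
    let ψ' : Polynomial (Polynomial K) →ₐ[K] Polynomial κ := { ψ with commutes' := hcommutes }
    have hψC : ∀ f, ψ (Polynomial.C f) = Polynomial.C (φ f) := fun f => by simp [ψ]
    have hψX : ψ Polynomial.X = s := by simp [ψ]
    have h2 := congrArg ψ' h1
    rw [map_zero, ← AlgHom.comp_apply, comp_aeval] at h2
    rw [← h2]
    congr 2
    have hCC : Polynomial.C (φ (aeval ![Y j, W j, Polynomial.X] (pderiv 0 G)))⁻¹ *
        Polynomial.C (φ (aeval ![Y j, W j, Polynomial.X] (pderiv 0 G))) = 1 := by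
      rw [← Polynomial.C_mul, inv_mul_cancel₀ hne, Polynomial.C_1]
    funext i
    fin_cases i
    · symm
      change ψ (Polynomial.C (Y j) - Polynomial.X * Polynomial.C _) = ρ j
      rw [map_sub, map_mul, hψC, hψC, hψX]
      simp only [ρ, β, s, div_eq_mul_inv, Polynomial.C_mul]
      ring
    · symm
      change ψ (Polynomial.C (W j) + Polynomial.X * Polynomial.C _) = Polynomial.X
      rw [map_add, map_mul, hψC, hψC, hψX]
      simp only [s]
      linear_combination (Polynomial.X - Polynomial.C (φ (W j))) * hCC
    · exact (hψC _).symm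
  have hinj : Function.Injective (aeval (R := K)
      ![(Polynomial.X : Polynomial κ), Polynomial.C (φ Polynomial.X)]) := by
    have hv : ![(Polynomial.X : Polynomial κ), Polynomial.C (φ Polynomial.X)] =
        Fin.cons Polynomial.X (fun i => Polynomial.C (![φ Polynomial.X] i)) := by
      funext i
      fin_cases i <;> rfl
    rw [hv]
    exact injective_aeval_cons_X ![φ Polynomial.X] (injective_aeval_singleton φ hφ)
  have hcard : (J.image ρ).card ≤ G.degreeOf 0 := by
    refine card_le_degreeOf_of_root ![Polynomial.X, Polynomial.C (φ Polynomial.X)] hinj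
      hG.ne_zero _ fun r hr => ?_
    obtain ⟨j, hj, rfl⟩ := Finset.mem_image.mp hr
    exact hroot j hj
  refine (Finset.card_le_mul_card_image J k fun r _ => ?_).trans (Nat.mul_le_mul_left k hcard)
  refine hk _ (Finset.filter_subset _ _) fun i hi j hj l hl => ?_
  simp only [Finset.mem_filter] at hi hj hl
  have hcoeff : ∀ j, (ρ j).coeff 1 = -β j ∧ (ρ j).coeff 0 = φ (Y j) + β j * φ (W j) := by
    intro j
    simp [ρ, mul_sub, Polynomial.coeff_X]
  have h1 : ∀ a b, ρ a = r → ρ b = r →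
      β a = β b ∧ φ (Y a) + β a * φ (W a) = φ (Y b) + β b * φ (W b) := by
    intro a b ha hb
    have h := hcoeff a
    rw [ha, ← hb, (hcoeff b).1, (hcoeff b).2] at h
    exact ⟨(neg_injective h.1).symm, h.2.symm⟩
  obtain ⟨hb1, hv1⟩ := h1 j i hj.2 hi.2
  obtain ⟨hb2, hv2⟩ := h1 l i hl.2 hi.2
  rw [hb1] at hv1
  rw [hb2] at hv2
  apply hφ
  simp only [map_mul, map_sub]
  linear_combination (φ (W j) - φ (W i)) * hv2 - (φ (W l) - φ (W i)) * hv1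

/-- A prime polynomial of small degree has few common zeros with its flex polynomial in a set with
few collinear points. -/
theorem card_flex_zeros_le {K ι : Type*} [Field K] (p : ℕ) [CharP K p]
    {G : MvPolynomial (Fin 3) K} (hG : Prime G) (hp : G.degreeOf 0 + G.degreeOf 1 < p)
    (J : Finset ι) (Y W : ι → Polynomial K) (hW : Set.InjOn W J) (k : ℕ)
    (hk : ∀ T ⊆ J, (∀ i ∈ T, ∀ j ∈ T, ∀ l ∈ T, Collinear3 Y W i j l) → T.card ≤ k)
    (hGz : ∀ j ∈ J, aeval ![Y j, W j, Polynomial.X] G = 0)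
    (hflex : ∀ j ∈ J, aeval ![Y j, W j, Polynomial.X] (flex G) = 0) :
    J.card ≤ 6 * G.degreeOf 1 * G.degreeOf 0 + k * G.degreeOf 0 + G.degreeOf 1 := by
  classical
  rcases Nat.eq_zero_or_pos (G.degreeOf 0) with he | he
  · let q := (finSuccEquiv K 2 G).coeff 0
    have hconst : finSuccEquiv K 2 G = Polynomial.C q := by
      apply Polynomial.eq_C_of_natDegree_eq_zero
      rw [natDegree_finSuccEquiv, he]
    have hq : q ≠ 0 := by
      rintro h
      rw [h, Polynomial.C_0] at hconst
      exact hG.ne_zero (by simpa using hconst)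
    have := card_le_degreeOf_of_polynomial_root hq J W hW fun j hj => by
      have h := hGz j hj
      change aeval (Fin.cons (Y j) ![W j, Polynomial.X] : Fin 3 → Polynomial K) G = 0 at h
      rw [aeval_cons_eq_eval, hconst, Polynomial.map_C, Polynomial.eval_C] at h
      exact h
    have h2 := degreeOf_coeff_finSuccEquiv G 0 0
    change q.degreeOf 0 ≤ G.degreeOf 1 at h2
    omega
  · have h0 : ¬ G ∣ pderiv 0 G := not_dvd_pderiv p 0 he (by omega)
    by_cases hdvd : G ∣ flex G
    · let J₁ := J.filter fun j => aeval ![Y j, W j, Polynomial.X] (pderiv 0 G) = 0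
      let J₂ := J.filter fun j => ¬ aeval ![Y j, W j, Polynomial.X] (pderiv 0 G) = 0
      have hsum : J₁.card + J₂.card = J.card := Finset.card_filter_add_card_filter_not _
      have hJ₁ : J₁ ⊆ J := Finset.filter_subset _ _
      have hJ₂ : J₂ ⊆ J := Finset.filter_subset _ _
      have h1 := card_common_zeros_le hG he h0 J₁ Y W (hW.mono hJ₁) (fun j hj => hGz j (hJ₁ hj))
        fun j hj => (Finset.mem_filter.mp hj).2
      have h2 := card_nonsingular_zeros_le p hG h0 hdvd hp J₂ Y W k
        (fun T hT => hk T (hT.trans hJ₂)) (fun j hj => hGz j (hJ₂ hj))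
        fun j hj => (Finset.mem_filter.mp hj).2
      have h3 := Nat.mul_le_mul_right (G.degreeOf 0) (degreeOf_pderiv_le 0 1 G)
      have h4 := Nat.mul_le_mul_left (G.degreeOf 1) (degreeOf_pderiv_le 0 0 G)
      nlinarith
    · have h1 := card_common_zeros_le hG he hdvd J Y W hW hGz hflex
      have h3 := Nat.mul_le_mul_right (G.degreeOf 0) (degreeOf_flex_le G 1)
      have h4 := Nat.mul_le_mul_left (G.degreeOf 1) (degreeOf_flex_le G 0)
      nlinarith

end Flex

section RichPoints

open MvPolynomial

/-- The restriction of a polynomial to the line `y = g + s w`, `v = v₀`, parametrised by `w`. -/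
noncomputable def onLine {K : Type*} [Field K] (v₀ g s : K) :
    MvPolynomial (Fin 3) K →ₐ[K] Polynomial K :=
  aeval ![Polynomial.C g + Polynomial.C s * Polynomial.X, Polynomial.X, Polynomial.C v₀]

theorem eval_aeval_eq_eval_onLine {K : Type*} [Field K] {v₀ g s : K} {y w : Polynomial K}
    (h : y.eval v₀ = g + s * w.eval v₀) (q : MvPolynomial (Fin 3) K) :
    (aeval ![y, w, Polynomial.X] q).eval v₀ = (onLine v₀ g s q).eval (w.eval v₀) := by
  have : (Polynomial.aeval v₀).comp (aeval ![y, w, Polynomial.X]) =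
      (Polynomial.aeval (w.eval v₀)).comp (onLine v₀ g s) := by
    apply MvPolynomial.algHom_ext
    intro i
    fin_cases i <;> simp [onLine, Polynomial.coe_aeval_eq_eval, h]
  have h2 := DFunLike.congr_fun this q
  simpa [Polynomial.coe_aeval_eq_eval] using h2

theorem derivative_onLine {K : Type*} [Field K] (v₀ g s : K) (q : MvPolynomial (Fin 3) K) :
    Polynomial.derivative (onLine v₀ g s q) =
      onLine v₀ g s (pderiv 0 q) * Polynomial.C s + onLine v₀ g s (pderiv 1 q) := by
  have h := derivation_aeval (Polynomial.derivative' : Derivation K (Polynomial K) (Polynomial K))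
    ![Polynomial.C g + Polynomial.C s * Polynomial.X, Polynomial.X, Polynomial.C v₀] q
  have e : ∀ f : Polynomial K, Polynomial.derivative' f = Polynomial.derivative f := fun _ => rfl
  simp only [e, Fin.sum_univ_three, Matrix.cons_val, Polynomial.derivative_add,
    Polynomial.derivative_mul, Polynomial.derivative_C, Polynomial.derivative_X] at h
  rw [← onLine] at h
  rw [h]
  ring

/-- If a polynomial vanishes on a line, so does its flex polynomial. -/
theorem onLine_flex_eq_zero {K : Type*} [Field K] {v₀ g s : K} {q : MvPolynomial (Fin 3) K}
    (h : onLine v₀ g s q = 0) : onLine v₀ g s (flex q) = 0 := by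
  have h1 := derivative_onLine v₀ g s q
  have h2 := derivative_onLine v₀ g s (pderiv 0 q)
  have h3 := derivative_onLine v₀ g s (pderiv 1 q)
  rw [h, Polynomial.derivative_zero] at h1
  have h4 := congrArg Polynomial.derivative h1
  rw [Polynomial.derivative_zero, Polynomial.derivative_add, Polynomial.derivative_mul,
    Polynomial.derivative_C, h2, h3] at h4
  rw [pderiv_zero_one] at h4
  have h5 : onLine v₀ g s (pderiv 1 q) = -onLine v₀ g s (pderiv 0 q) * Polynomial.C s := by
    linear_combination -h1
  simp only [flex, map_add, map_sub, map_mul, map_ofNat, h5]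
  linear_combination (-onLine v₀ g s (pderiv 0 q) ^ 2) * h4

/-- Polynomial interpolation: there is a nonzero polynomial of small degree that vanishes on
a given family of lines. -/
theorem exists_interpolation {K κ : Type*} [Field K] (L : Finset κ) (v g σ : κ → K) (A B : ℕ)
    (hAB : L.card * (2 * B) < A * B * B) :
    ∃ F : MvPolynomial (Fin 3) K, F ≠ 0 ∧ F.degreeOf 0 < B ∧ F.degreeOf 1 < B ∧ F.degreeOf 2 < A ∧
      ∀ i ∈ L, onLine (v i) (g i) (σ i) F = 0 := by
  classical
  have hB : 0 < B := Nat.pos_of_ne_zero (by rintro rfl; simp at hAB)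
  have hA : 0 < A := Nat.pos_of_ne_zero (by rintro rfl; simp at hAB)
  let e : Fin B × Fin B × Fin A → Fin 3 →₀ ℕ := fun x =>
    Finsupp.equivFunOnFinite.symm ![x.1, x.2.1, x.2.2]
  have he : Function.Injective e := by
    intro x x' h
    have h' := Finsupp.equivFunOnFinite.symm.injective h
    refine Prod.ext (Fin.ext ?_) (Prod.ext (Fin.ext ?_) (Fin.ext ?_))
    · exact congrFun h' 0
    · exact congrFun h' 1
    · exact congrFun h' 2
  let P : (Fin B × Fin B × Fin A → K) →ₗ[K] MvPolynomial (Fin 3) K :=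
    ∑ x, (monomial (e x)).comp (LinearMap.proj x)
  have hP : ∀ c, P c = ∑ x, monomial (e x) (c x) := fun c => by simp [P]
  have hdeg : ∀ (c) (i : Fin 3), (P c).degreeOf i ≤ ![B - 1, B - 1, A - 1] i := by
    intro c i
    rw [hP]
    refine (degreeOf_sum_le _ _ _).trans (Finset.sup_le fun x _ => ?_)
    rw [degreeOf_le_iff]
    intro m hm
    have := Finset.mem_singleton.mp (support_monomial_subset hm)
    subst this
    have h1 := x.1.2
    have h2 := x.2.1.2
    have h3 := x.2.2.2
    fin_cases i <;> simp [e] <;> omega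
  let Φ : (Fin B × Fin B × Fin A → K) →ₗ[K] (L × Fin (2 * B) → K) :=
    LinearMap.pi fun z => (Polynomial.lcoeff K z.2).comp
      ((onLine (v z.1) (g z.1) (σ z.1)).toLinearMap.comp P)
  have hker : LinearMap.ker Φ ≠ ⊥ := by
    apply LinearMap.ker_ne_bot_of_finrank_lt
    simp only [Module.finrank_pi, Fintype.card_prod, Fintype.card_fin, Fintype.card_coe]
    nlinarith
  obtain ⟨c, hc, hc0⟩ := (Submodule.ne_bot_iff _).mp hker
  refine ⟨P c, fun h => hc0 ?_, ?_, ?_, ?_, fun i hi => ?_⟩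
  · funext x
    have := congrArg (coeff (e x)) h
    rw [hP, coeff_sum, Finset.sum_eq_single x] at this
    · simpa using this
    · intro x' _ hne
      rw [coeff_monomial, if_neg fun h' => hne (he h')]
    · simp
  · have : _ ≤ B - 1 := hdeg c 0
    omega
  · have : _ ≤ B - 1 := hdeg c 1
    omega
  · have : _ ≤ A - 1 := hdeg c 2
    omega
  · have hd : (onLine (v i) (g i) (σ i) (P c)).natDegree < 2 * B := by
      refine (natDegree_aeval_le_sum_degreeOf _ ![1, 1, 0] (fun j => ?_) _).trans_lt ?_
      · fin_cases j
        · change (Polynomial.C (g i) + Polynomial.C (σ i) * Polynomial.X).natDegree ≤ 1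
          compute_degree
        · exact Polynomial.natDegree_X_le
        · exact (Polynomial.natDegree_C _).le
      · have h0 : _ ≤ B - 1 := hdeg c 0
        have h1 : _ ≤ B - 1 := hdeg c 1
        simp [Fin.sum_univ_three]
        omega
    ext n
    by_cases hn : n < 2 * B
    · exact congrFun (LinearMap.mem_ker.mp hc) (⟨i, hi⟩, ⟨n, hn⟩)
    · rw [Polynomial.coeff_eq_zero_of_natDegree_lt (by omega), Polynomial.coeff_zero]

/-- A nonzero element of a factorial ring has a finite set of prime factors that accounts for
its vanishing in domains. -/
theorem exists_prime_finset {S : Type*} [CommRing S] [IsDomain S] [UniqueFactorizationMonoid S]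
    {F : S} (hF : F ≠ 0) :
    ∃ s : Finset S, (∀ G ∈ s, Prime G) ∧ ∏ G ∈ s, G ∣ F ∧
      ∀ {B : Type*} [CommRing B] [IsDomain B] (ℓ : S →+* B), ℓ F = 0 → ∃ G ∈ s, ℓ G = 0 := by
  classical
  obtain ⟨f, hf, hassoc⟩ := UniqueFactorizationMonoid.exists_prime_factors F hF
  refine ⟨f.toFinset, fun G hG => hf G (Multiset.mem_toFinset.mp hG), ?_, ?_⟩
  · exact (Multiset.toFinset_prod_dvd_prod f).trans hassoc.dvd
  · intro B _ _ ℓ hℓ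
    have h : ℓ f.prod = 0 := by
      obtain ⟨u, hu⟩ := hassoc.symm.dvd
      rw [hu, map_mul, hℓ, zero_mul]
    rw [map_multiset_prod, Multiset.prod_eq_zero_iff, Multiset.mem_map] at h
    obtain ⟨G, hG, hG0⟩ := h
    exact ⟨G, Multiset.mem_toFinset.mpr hG, hG0⟩

/-- A bound for the number of points that lie on many lines. The points are pairs of polynomials
`Y j`, `W j` of degree at most one, and the point `j` lies on the line `i` if
`Y j = g i + σ i * W j` at `v i`. -/
theorem card_rich_points_le {K ι κ : Type*} [Field K] [DecidableEq K] (p : ℕ) [CharP K p]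
    (L : Finset κ) (v g σ : κ → K) (J : Finset ι) (Y W : ι → Polynomial K)
    (hYd : ∀ j, (Y j).natDegree ≤ 1) (hWd : ∀ j, (W j).natDegree ≤ 1) (hW : Set.InjOn W J)
    (A B k : ℕ) (hAB : L.card * (2 * B) < A * B * B) (hp : 2 * B ≤ p)
    (hk : ∀ T ⊆ J, (∀ i ∈ T, ∀ j ∈ T, ∀ l ∈ T, Collinear3 Y W i j l) → T.card ≤ k)
    (hrich : ∀ j ∈ J, 3 * (A + 2 * B) <
      ((L.filter fun i => (Y j).eval (v i) = g i + σ i * (W j).eval (v i)).image v).card) :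
    J.card ≤ 6 * B ^ 2 + k * B + B := by
  classical
  obtain ⟨F, hF, hF0, hF1, hF2, hFL⟩ := exists_interpolation L v g σ A B hAB
  obtain ⟨s, hs, hsF, hvanish⟩ := exists_prime_finset hF
  obtain ⟨U, hU⟩ := hsF
  have hprod : ∏ G ∈ s, G ≠ 0 := Finset.prod_ne_zero_iff.mpr fun G hG => (hs G hG).ne_zero
  have hU0 : U ≠ 0 := by
    rintro rfl
    exact hF (by rw [hU, mul_zero])
  have hdeg : ∀ i, ∑ G ∈ s, G.degreeOf i ≤ F.degreeOf i := by
    intro i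
    rw [hU, degreeOf_mul_eq hprod hU0, degreeOf_prod_eq s (fun G => G) fun G hG => (hs G hG).ne_zero]
    exact Nat.le_add_right _ _
  let Z : MvPolynomial (Fin 3) K → Finset ι := fun G => J.filter fun j =>
    aeval ![Y j, W j, Polynomial.X] G = 0 ∧ aeval ![Y j, W j, Polynomial.X] (flex G) = 0
  have hcover : J ⊆ s.biUnion Z := by
    intro j hj
    let M : MvPolynomial (Fin 3) K → Finset K := fun G => ((L.filter fun i =>
      (Y j).eval (v i) = g i + σ i * (W j).eval (v i)).filter fun i =>
        onLine (v i) (g i) (σ i) G = 0).image v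
    have hM : ∃ G ∈ s, 3 * ∑ i, G.degreeOf i < (M G).card := by
      by_contra! hcon
      have h1 : ((L.filter fun i => (Y j).eval (v i) = g i + σ i * (W j).eval (v i)).image v) ⊆
          s.biUnion M := by
        intro x hx
        obtain ⟨i, hi, rfl⟩ := Finset.mem_image.mp hx
        obtain ⟨G, hG, hG0⟩ := hvanish (onLine (v i) (g i) (σ i)).toRingHom
          (hFL i (Finset.mem_filter.mp hi).1)
        exact Finset.mem_biUnion.mpr ⟨G, hG, Finset.mem_image_of_mem v
          (Finset.mem_filter.mpr ⟨hi, hG0⟩)⟩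
      have h2 := (Finset.card_le_card h1).trans
        (Finset.card_biUnion_le.trans (Finset.sum_le_sum hcon))
      rw [← Finset.mul_sum, Finset.sum_comm, Fin.sum_univ_three] at h2
      have := hrich j hj
      have h3 := hdeg 0
      have h4 := hdeg 1
      have h5 := hdeg 2
      omega
    obtain ⟨G, hG, hGM⟩ := hM
    have hzero : ∀ q : MvPolynomial (Fin 3) K, ∑ i, q.degreeOf i ≤ 3 * ∑ i, G.degreeOf i →
        (∀ i, onLine (v i) (g i) (σ i) G = 0 → onLine (v i) (g i) (σ i) q = 0) →
        aeval ![Y j, W j, Polynomial.X] q = 0 := by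
      intro q hq hqG
      refine Polynomial.eq_zero_of_natDegree_lt_card_of_eval_eq_zero' _ (M G) (fun x hx => ?_) ?_
      · obtain ⟨i, hi, rfl⟩ := Finset.mem_image.mp hx
        rw [Finset.mem_filter, Finset.mem_filter] at hi
        rw [eval_aeval_eq_eval_onLine hi.1.2, hqG i hi.2, Polynomial.eval_zero]
      · refine (natDegree_aeval_le_sum_degreeOf _ (fun _ => 1) (fun i => ?_) q).trans_lt ?_
        · fin_cases i
          · exact hYd j
          · exact hWd j
          · exact Polynomial.natDegree_X_le
        · simp only [mul_one]
          omega
    refine Finset.mem_biUnion.mpr ⟨G, hG, Finset.mem_filter.mpr ⟨hj, ?_, ?_⟩⟩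
    · exact hzero G (by omega) fun i h => h
    · refine hzero (flex G) ?_ fun i h => onLine_flex_eq_zero h
      rw [Finset.mul_sum]
      exact Finset.sum_le_sum fun i _ => degreeOf_flex_le G i
  have hle : ∀ G ∈ s, ∀ i, G.degreeOf i ≤ F.degreeOf i := fun G hG i =>
    (Finset.single_le_sum (f := fun G : MvPolynomial (Fin 3) K => G.degreeOf i)
      (fun _ _ => Nat.zero_le _) hG).trans (hdeg i)
  calc J.card ≤ ∑ G ∈ s, (Z G).card := (Finset.card_le_card hcover).trans Finset.card_biUnion_le
    _ ≤ ∑ G ∈ s, ((6 * B + k) * G.degreeOf 0 + G.degreeOf 1) := by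
        refine Finset.sum_le_sum fun G hG => ?_
        have h0 := hle G hG 0
        have h1 := hle G hG 1
        have hZ : Z G ⊆ J := Finset.filter_subset _ _
        refine (card_flex_zeros_le p (hs G hG) (by omega) (Z G) Y W (hW.mono hZ) k
          (fun T hT => hk T (hT.trans hZ)) (fun j hj => (Finset.mem_filter.mp hj).2.1)
          fun j hj => (Finset.mem_filter.mp hj).2.2).trans ?_
        have : G.degreeOf 1 * G.degreeOf 0 ≤ B * G.degreeOf 0 :=
          Nat.mul_le_mul_right _ (by omega)
        nlinarith
    _ ≤ (6 * B + k) * B + B := by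
        rw [Finset.sum_add_distrib, ← Finset.mul_sum]
        have h0 := hdeg 0
        have h1 := hdeg 1
        exact Nat.add_le_add (Nat.mul_le_mul_left _ (by omega)) (by omega)
    _ = 6 * B ^ 2 + k * B + B := by ring

end RichPoints

section Incidences

open Polynomial

/-- The relation `x - (a - b)² = x' - (a' - b')²` between `(a, b', x)` and `(b, a', x')`. -/
def Incident {F : Type*} [CommRing F] (i j : F × F × F) : Prop :=
  i.2.2 - (i.1 - j.1) ^ 2 = j.2.2 - (j.2.1 - i.2.1) ^ 2

instance {F : Type*} [CommRing F] [DecidableEq F] (i j : F × F × F) : Decidable (Incident i j) :=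
  inferInstanceAs (Decidable (_ = _))

theorem eq_and_eq_of_add_mul_eq {F K : Type*} [Field F] [Field K] [Algebra F K] {ε : K}
    (hε : ε ∉ Set.range (algebraMap F K)) {s t s' t' : F}
    (h : algebraMap F K s + ε * algebraMap F K t = algebraMap F K s' + ε * algebraMap F K t') :
    s = s' ∧ t = t' := by
  have ht : t = t' := by
    by_contra hne
    apply hε
    refine ⟨(s' - s) / (t - t'), ?_⟩
    have hne' : algebraMap F K t - algebraMap F K t' ≠ 0 := by
      rw [← map_sub, Ne, map_eq_zero]
      exact sub_ne_zero.mpr hne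
    rw [map_div₀, map_sub, map_sub, div_eq_iff hne']
    linear_combination -h
  subst ht
  exact ⟨(algebraMap F K).injective (by linear_combination h), rfl⟩

variable {F K : Type*} [Field F] [Field K] [Algebra F K]

/-- The value of the pencil parameter of the line `(a, b', x)`. -/
def lineParam (ε : K) (i : F × F × F) : K := algebraMap F K i.1 + ε * algebraMap F K i.2.1

/-- The first coordinate, over `K[v]`, of the point `(b, a', x')`. -/
noncomputable def pointY (K : Type*) [Field K] [Algebra F K] (j : F × F × F) : K[X] :=
  C (algebraMap F K (j.2.2 - j.2.1 ^ 2 + j.1 ^ 2)) - C (algebraMap F K (2 * j.1)) * X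

/-- The second coordinate, over `K[v]`, of the point `(b, a', x')`, before shearing. -/
noncomputable def pointW₀ (ε : K) (j : F × F × F) : K :=
  -(algebraMap F K (2 * j.2.1) + ε * algebraMap F K (2 * j.1))

/-- The second coordinate, over `K[v]`, of the point `(b, a', x')`. -/
noncomputable def pointW (ε : K) (j : F × F × F) : K[X] := C (pointW₀ ε j) + C ε * pointY K j

theorem pointY_coeff_zero (j : F × F × F) :
    (pointY K j).coeff 0 = algebraMap F K (j.2.2 - j.2.1 ^ 2 + j.1 ^ 2) := by
  simp only [pointY, coeff_sub, coeff_C_zero, coeff_C_mul, coeff_X_zero, mul_zero, sub_zero]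

theorem pointY_coeff_one (j : F × F × F) :
    (pointY K j).coeff 1 = -algebraMap F K (2 * j.1) := by
  simp only [pointY, coeff_sub, coeff_C_succ, coeff_C_mul, coeff_X_one]
  ring

theorem natDegree_pointY_le (j : F × F × F) : (pointY K j).natDegree ≤ 1 := by
  rw [pointY]
  compute_degree

theorem natDegree_pointW_le (ε : K) (j : F × F × F) : (pointW ε j).natDegree ≤ 1 := by
  rw [pointW]
  have h : (C ε * pointY K j).natDegree ≤ 1 :=
    (natDegree_C_mul_le _ _).trans (natDegree_pointY_le j)
  exact natDegree_add_le_of_degree_le ((natDegree_C _).le.trans zero_le_one) h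

theorem pointW_injective {ε : K} (hε : ε ∉ Set.range (algebraMap F K)) (h2 : (2 : F) ≠ 0) :
    Function.Injective (pointW (F := F) ε) := by
  rintro ⟨b, a, x⟩ ⟨b', a', x'⟩ h
  have hε0 : ε ≠ 0 := by
    rintro rfl
    exact hε ⟨0, map_zero _⟩
  have h1 := congrArg (fun q => q.coeff 1) h
  have h0 := congrArg (fun q => q.coeff 0) h
  simp only [pointW, coeff_add, coeff_C_mul, pointY_coeff_zero, pointY_coeff_one, coeff_C_succ,
    coeff_C_zero, pointW₀] at h0 h1
  have hb : b = b' := by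
    have h3 : ε * (algebraMap F K (2 * b) - algebraMap F K (2 * b')) = 0 := by
      linear_combination -h1
    have h4 := (algebraMap F K).injective (sub_eq_zero.mp ((mul_eq_zero.mp h3).resolve_left hε0))
    exact mul_left_cancel₀ h2 h4
  subst hb
  obtain ⟨ha, hx⟩ := eq_and_eq_of_add_mul_eq hε
    (s := 2 * a) (s' := 2 * a') (t := -(x - a ^ 2 + b ^ 2)) (t' := -(x' - a' ^ 2 + b ^ 2))
    (by rw [map_neg, map_neg]; linear_combination -h0)
  have ha' := mul_left_cancel₀ h2 ha
  subst ha'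
  have : x = x' := by linear_combination -hx
  rw [this]

theorem one_add_mul_ne_zero {ε : K} (hε : ε ∉ Set.range (algebraMap F K)) (b : F) :
    1 + ε * algebraMap F K b ≠ 0 := by
  intro h
  obtain ⟨h1, -⟩ := eq_and_eq_of_add_mul_eq hε (s := 1) (t := b) (s' := 0) (t' := 0)
    (by simpa using h)
  exact one_ne_zero h1

theorem pointY_eval_of_incident {ε : K} (hε : ε ∉ Set.range (algebraMap F K)) {i j : F × F × F}
    (h : Incident i j) :
    (pointY K j).eval (lineParam ε i) =
      algebraMap F K (i.2.2 - i.1 ^ 2 + i.2.1 ^ 2) / (1 + ε * algebraMap F K i.2.1) +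
        algebraMap F K i.2.1 / (1 + ε * algebraMap F K i.2.1) *
          (pointW ε j).eval (lineParam ε i) := by
  have hne := one_add_mul_ne_zero hε i.2.1
  have h' := congrArg (algebraMap F K) h
  simp only [map_sub, map_pow] at h'
  field_simp
  simp only [pointW, pointW₀, pointY, lineParam, eval_add, eval_sub, eval_mul, eval_C, eval_X]
  simp only [map_sub, map_add, map_mul, map_pow, map_ofNat]
  linear_combination -h'

theorem lineParam_injOn_incident {ε : K} (hε : ε ∉ Set.range (algebraMap F K)) (j : F × F × F) :
    Set.InjOn (lineParam ε) {i : F × F × F | Incident i j} := by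
  rintro ⟨a, b, x⟩ hi ⟨a', b', x'⟩ hi' h
  obtain ⟨ha, hb⟩ := eq_and_eq_of_add_mul_eq hε h
  simp only [Set.mem_ofPred_eq, Incident] at hi hi' ha hb
  subst ha hb
  have : x = x' := by linear_combination hi - hi'
  rw [this]

/-- Collinear subsets of the point set are small. -/
theorem card_le_of_collinear3 {ε : K} (hε : ε ∉ Set.range (algebraMap F K)) (h2 : (2 : F) ≠ 0)
    {A X : Finset F} (hAX : A.card ≤ X.card) {T : Finset (F × F × F)}
    (hT : T ⊆ A ×ˢ A ×ˢ X)
    (hcol : ∀ i ∈ T, ∀ j ∈ T, ∀ l ∈ T, Collinear3 (pointY K) (pointW ε) i j l) :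
    T.card ≤ X.card := by
  classical
  have hmem : ∀ i ∈ T, i.1 ∈ A ∧ i.2.1 ∈ A ∧ i.2.2 ∈ X := fun i hi => by
    simpa only [Finset.mem_product] using hT hi
  rcases T.eq_empty_or_nonempty with rfl | ⟨i, hi⟩
  · simp
  by_cases hall : ∀ j ∈ T, j.1 = i.1 ∧ j.2.1 = i.2.1
  · refine Finset.card_le_card_of_injOn (fun j => j.2.2) (fun j hj => (hmem j hj).2.2) ?_
    intro j hj l hl h
    obtain ⟨h1, h3⟩ := hall j hj
    obtain ⟨h4, h5⟩ := hall l hl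
    exact Prod.ext (h1.trans h4.symm) (Prod.ext (h3.trans h5.symm) h)
  push Not at hall
  obtain ⟨j, hj, hne⟩ := hall
  have hshear : ∀ l ∈ T, (pointY K l - pointY K i) * C (pointW₀ ε j - pointW₀ ε i) =
      (pointY K j - pointY K i) * C (pointW₀ ε l - pointW₀ ε i) := by
    intro l hl
    have := hcol i hi j hj l hl
    simp only [Collinear3, pointW] at this
    rw [C_sub, C_sub]
    linear_combination this
  have hδ : pointW₀ ε j - pointW₀ ε i ≠ 0 := by
    intro h
    rw [pointW₀, pointW₀] at h
    obtain ⟨h1, h3⟩ := eq_and_eq_of_add_mul_eq hε (s := 2 * j.2.1) (t := 2 * j.1)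
      (s' := 2 * i.2.1) (t' := 2 * i.1) (by linear_combination -h)
    exact hne (mul_left_cancel₀ h2 h3) (mul_left_cancel₀ h2 h1)
  have hinj : ∀ l ∈ T, ∀ m ∈ T, l.1 = m.1 → l.2.1 = m.2.1 → l = m := by
    intro l hl m hm h1 h3
    have hw : pointW₀ ε l = pointW₀ ε m := by rw [pointW₀, pointW₀, h1, h3]
    have h4 : (pointY K l - pointY K m) * C (pointW₀ ε j - pointW₀ ε i) = 0 := by
      have h5 := hshear l hl
      have h6 := hshear m hm
      rw [hw] at h5
      linear_combination h5 - h6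
    have h5 := (mul_eq_zero.mp h4).resolve_right (C_ne_zero.mpr hδ)
    have h6 := congrArg (fun q => q.coeff 0) (sub_eq_zero.mp h5)
    simp only [pointY_coeff_zero] at h6
    have h7 := (algebraMap F K).injective h6
    rw [h1, h3] at h7
    exact Prod.ext h1 (Prod.ext h3 (by linear_combination h7))
  have hslope : ∀ l ∈ T, (l.1 - i.1) * (j.2.1 - i.2.1) = (j.1 - i.1) * (l.2.1 - i.2.1) := by
    intro l hl
    have h1 := congrArg (fun q => q.coeff 1) (hshear l hl)
    simp only [coeff_mul_C, coeff_sub, pointY_coeff_one, pointW₀, map_mul, map_ofNat] at h1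
    have h2' : (2 : K) ≠ 0 := by
      rw [← map_ofNat (algebraMap F K), Ne, map_eq_zero]
      exact h2
    apply (algebraMap F K).injective
    simp only [map_mul, map_sub]
    apply mul_left_cancel₀ (mul_ne_zero h2' h2')
    linear_combination h1
  refine le_trans ?_ hAX
  by_cases hb : j.1 = i.1
  · have ha : j.2.1 - i.2.1 ≠ 0 := sub_ne_zero.mpr (hne hb)
    have hb' : ∀ l ∈ T, l.1 = i.1 := by
      intro l hl
      have := hslope l hl
      rw [hb, sub_self, zero_mul] at this
      exact sub_eq_zero.mp ((mul_eq_zero.mp this).resolve_right ha)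
    refine Finset.card_le_card_of_injOn (fun l => l.2.1) (fun l hl => (hmem l hl).2.1) ?_
    intro l hl m hm h
    exact hinj l hl m hm ((hb' l hl).trans (hb' m hm).symm) h
  · refine Finset.card_le_card_of_injOn (fun l => l.1) (fun l hl => (hmem l hl).1) ?_
    intro l hl m hm h
    refine hinj l hl m hm h ?_
    have h1 := hslope l hl
    have h3 := hslope m hm
    simp only at h
    rw [h] at h1
    exact mul_left_cancel₀ (sub_ne_zero.mpr hb) (by linear_combination h3 - h1)

/-- A bound for the number of triples that have many incidences. -/
theorem card_rich_triples_le [DecidableEq F] (p : ℕ) [CharP F p] (h2 : (2 : F) ≠ 0)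
    {ε : K} (hε : ε ∉ Set.range (algebraMap F K)) {A X : Finset F} (hAX : A.card ≤ X.card)
    {a b r : ℕ} (hab : (A ×ˢ A ×ˢ X).card * (2 * b) < a * b * b) (hp : 2 * b ≤ p)
    (hr : 3 * (a + 2 * b) < r) :
    ((A ×ˢ A ×ˢ X).filter fun j =>
        r ≤ ((A ×ˢ A ×ˢ X).filter fun i => Incident i j).card).card ≤
      6 * b ^ 2 + X.card * b + b := by
  classical
  have : CharP K p := charP_of_injective_algebraMap (algebraMap F K).injective p
  refine card_rich_points_le p (A ×ˢ A ×ˢ X) (lineParam ε)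
    (fun i => algebraMap F K (i.2.2 - i.1 ^ 2 + i.2.1 ^ 2) / (1 + ε * algebraMap F K i.2.1))
    (fun i => algebraMap F K i.2.1 / (1 + ε * algebraMap F K i.2.1)) _ (pointY K) (pointW ε)
    natDegree_pointY_le (natDegree_pointW_le ε) (pointW_injective hε h2).injOn a b X.card hab hp
    (fun T hT => card_le_of_collinear3 hε h2 hAX (hT.trans (Finset.filter_subset _ _)))
    fun j hj => ?_
  refine hr.trans_le ((Finset.mem_filter.mp hj).2.trans ?_)
  have hinj : Set.InjOn (lineParam ε)
      ((A ×ˢ A ×ˢ X).filter fun i => Incident i j : Finset (F × F × F)) :=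
    (lineParam_injOn_incident hε j).mono fun i hi =>
      (Finset.mem_filter.mp (Finset.mem_coe.mp hi)).2
  rw [← Finset.card_image_of_injOn hinj]
  refine Finset.card_le_card (Finset.image_subset_image fun i hi => ?_)
  rw [Finset.mem_filter] at hi ⊢
  exact ⟨hi.1, pointY_eval_of_incident hε hi.2⟩

end Incidences

section Energy

theorem sum_le_of_card_superlevel_le {ι : Type*} (s : Finset ι) (d : ι → ℕ) {M k : ℕ} {B : ℝ}
    (hB : 0 ≤ B) (hd : ∀ j ∈ s, d j ≤ M)
    (h : ∀ r, k < r → r ≤ M → ((s.filter fun j => r ≤ d j).card : ℝ) ≤ B * ((r : ℝ) ^ 2)⁻¹) :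
    ((∑ j ∈ s, d j : ℕ) : ℝ) ≤ s.card * k + B * (2 / (k + 1)) := by
  have h1 : ∀ j ∈ s, d j ≤ k + ∑ r ∈ Ioo k (M + 1), if r ≤ d j then 1 else 0 := by
    intro j hj
    rw [← Finset.card_filter]
    have h2 : Ioc k (d j) ⊆ (Ioo k (M + 1)).filter fun r => r ≤ d j := by
      intro r hr
      have := hd j hj
      simp only [mem_filter, mem_Ioo, mem_Ioc] at hr ⊢
      omega
    have h3 := Finset.card_le_card h2
    rw [Nat.card_Ioc] at h3
    omega
  have h4 : ∑ j ∈ s, d j ≤ s.card * k + ∑ r ∈ Ioo k (M + 1), (s.filter fun j => r ≤ d j).card := by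
    refine (Finset.sum_le_sum h1).trans_eq ?_
    rw [Finset.sum_add_distrib, Finset.sum_const, smul_eq_mul, Finset.sum_comm]
    simp only [Finset.card_filter]
  calc ((∑ j ∈ s, d j : ℕ) : ℝ)
      ≤ s.card * k + ∑ r ∈ Ioo k (M + 1), ((s.filter fun j => r ≤ d j).card : ℝ) := by
        exact_mod_cast h4
    _ ≤ s.card * k + ∑ r ∈ Ioo k (M + 1), B * ((r : ℝ) ^ 2)⁻¹ := by
        gcongr with r hr
        rw [mem_Ioo] at hr
        exact h r hr.1 (by omega)
    _ ≤ s.card * k + B * (2 / (k + 1)) := by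
        rw [← Finset.mul_sum]
        gcongr
        exact sum_Ioo_inv_sq_le k (M + 1)

theorem card_sq_le_card_mul_sum_card_filter {ι α : Type*} [DecidableEq α] (s : Finset ι)
    (D : Finset α) (f : ι → α) (hf : ∀ i ∈ s, f i ∈ D) :
    s.card ^ 2 ≤ D.card * ((s ×ˢ s).filter fun q => f q.1 = f q.2).card := by
  have h1 : ((s ×ˢ s).filter fun q => f q.1 = f q.2).card =
      ∑ y ∈ D, (s.filter fun i => f i = y).card ^ 2 := by
    rw [Finset.card_eq_sum_card_fiberwise (f := fun q => f q.1) (t := D) fun q hq => by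
      simp only [coe_filter, mem_product, Set.mem_ofPred_eq] at hq
      exact hf _ hq.1.1]
    refine Finset.sum_congr rfl fun y _ => ?_
    rw [sq, ← Finset.card_product]
    congr 1
    ext q
    simp only [mem_filter, mem_product]
    constructor
    · rintro ⟨⟨⟨h1, h2⟩, h3⟩, h4⟩
      exact ⟨⟨h1, h4⟩, h2, h3 ▸ h4⟩
    · rintro ⟨⟨h1, h4⟩, h2, h3⟩
      exact ⟨⟨⟨h1, h2⟩, h4.trans h3.symm⟩, h4⟩
  rw [h1, Finset.card_eq_sum_card_fiberwise hf]
  exact sq_sum_le_card_mul_sum_sq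

theorem card_sq_le_card_mul_sum_card_incident {F : Type*} [Field F] [DecidableEq F]
    (A X : Finset F) :
    (A ×ˢ A ×ˢ X).card ^ 2 ≤ (X - (A - A).image fun x => x ^ 2).card *
      ∑ j ∈ A ×ˢ A ×ˢ X, ((A ×ˢ A ×ˢ X).filter fun i => Incident i j).card := by
  refine (card_sq_le_card_mul_sum_card_filter (A ×ˢ A ×ˢ X)
    (X - (A - A).image fun x => x ^ 2) (fun t => t.2.2 - (t.1 - t.2.1) ^ 2) ?_).trans ?_
  · intro t ht
    simp only [mem_product] at ht
    exact sub_mem_sub ht.2.2 (mem_image_of_mem _ (sub_mem_sub ht.1 ht.2.1))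
  · refine Nat.mul_le_mul_left _ ?_
    rw [← Finset.card_sigma]
    refine Finset.card_le_card_of_injOn
      (fun q => ⟨(q.1.2.1, q.2.1, q.2.2.2), (q.1.1, q.2.2.1, q.1.2.2)⟩) ?_ ?_
    · intro q hq
      simp only [coe_filter, mem_product, Set.mem_ofPred_eq] at hq
      obtain ⟨⟨⟨h1, h2, h3⟩, h4, h5, h6⟩, h⟩ := hq
      exact mem_coe.mpr (mem_sigma.mpr ⟨by simp only [mem_product]; exact ⟨h2, h4, h6⟩,
        mem_filter.mpr ⟨by simp only [mem_product]; exact ⟨h1, h5, h3⟩, h⟩⟩)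
    · rintro ⟨⟨a, b, x⟩, a', b', x'⟩ - ⟨⟨c, d, y⟩, c', d', y'⟩ - h
      simp only [Sigma.mk.injEq, Prod.mk.injEq, heq_eq_eq] at h ⊢
      tauto

/-- The number of triples incident to a given one is at most `|A|²`. -/
theorem card_incident_le {F : Type*} [Field F] [DecidableEq F] (A X : Finset F) (j : F × F × F) :
    ((A ×ˢ A ×ˢ X).filter fun i => Incident i j).card ≤ A.card ^ 2 := by
  rw [sq, ← Finset.card_product]
  refine Finset.card_le_card_of_injOn (fun i => (i.1, i.2.1)) ?_ ?_
  · intro i hi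
    simp only [coe_filter, mem_product, Set.mem_ofPred_eq, coe_product, Set.mem_prod,
      mem_coe] at hi ⊢
    tauto
  · rintro ⟨a, b, x⟩ hi ⟨a', b', x'⟩ hi' h
    have h1 := (mem_filter.mp (mem_coe.mp hi)).2
    have h2 := (mem_filter.mp (mem_coe.mp hi')).2
    simp only [Incident, Prod.mk.injEq] at h1 h2 h ⊢
    obtain ⟨rfl, rfl⟩ := h
    exact ⟨rfl, rfl, by linear_combination h1 - h2⟩

end Energy

section Conclusion

/-- The choice of parameters used to bound the number of triples with at least `r` incidences. -/
theorem exists_flex_parameters {N r p : ℕ} (hp : 6 ≤ p) (hN : 0 < N) (hNp : 9 * N ≤ p ^ 2)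
    (hr : 24 * (N.sqrt + 1) < r) :
    ∃ a b : ℕ, N * (2 * b) < a * b * b ∧ 2 * b ≤ p ∧ 3 * (a + 2 * b) < r ∧
      (b : ℝ) ≤ 24 * (N / r) + 1 := by
  have hr0 : 0 < r := by omega
  have hs : N < (N.sqrt + 1) ^ 2 := Nat.lt_succ_sqrt' N
  have hNr : 576 * N < r ^ 2 := by nlinarith
  have hq : r * (24 * N / r) ≤ 24 * N := Nat.mul_div_le _ _
  have hq' : 24 * N < r * (24 * N / r + 1) := Nat.lt_mul_div_succ _ hr0
  have hqr : ((24 * N / r : ℕ) : ℝ) ≤ 24 * (N / r) := by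
    refine Nat.cast_div_le.trans_eq ?_
    push_cast
    ring
  have ha : r < 6 * (r / 6) + 6 := by omega
  have ha' : 6 * (r / 6) ≤ r := by omega
  generalize 24 * N / r = q at *
  generalize r / 6 = a at *
  have h24 : 24 * q < r := by
    by_contra! h
    nlinarith
  refine ⟨a, q + 1, ?_, ?_, by omega, by push_cast; linarith⟩
  · have h1 : r * (q + 1) ≤ 12 * a * (q + 1) := Nat.mul_le_mul_right _ (by omega)
    have h2 : 2 * N < a * (q + 1) := by linarith
    nlinarith
  · have h1 : 24 * (q * q) ≤ 24 * N := by nlinarith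
    have h2 : 3 * q ≤ p := by
      by_contra! h
      nlinarith
    omega

theorem sum_card_incident_le {p : ℕ} [Fact p.Prime] (hp : 11 ≤ p) {A X : Finset (ZMod p)}
    (hA : 0 < A.card) (hAX : A.card ≤ X.card) (h9 : 9 * (A ×ˢ A ×ˢ X).card ≤ p ^ 2) :
    ((∑ j ∈ A ×ˢ A ×ˢ X, ((A ×ˢ A ×ˢ X).filter fun i => Incident i j).card : ℕ) : ℝ) ≤
      341 * (A ×ˢ A ×ˢ X).card * (((A ×ˢ A ×ˢ X).card.sqrt : ℝ) + 1) := by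
  have hX : 0 < X.card := hA.trans_le hAX
  have hcard : (A ×ˢ A ×ˢ X).card = A.card ^ 2 * X.card := by
    rw [card_product, card_product]
    ring
  have hN : 0 < (A ×ˢ A ×ˢ X).card := by
    rw [hcard]
    positivity
  have h2 : (2 : ZMod p) ≠ 0 := by
    intro h
    have h3 : ((2 : ℕ) : ZMod p) = 0 := by exact_mod_cast h
    have h4 := Nat.le_of_dvd two_pos ((ZMod.natCast_eq_zero_iff 2 p).mp h3)
    omega
  obtain ⟨ε, hε⟩ := (Set.finite_range
    (algebraMap (ZMod p) (AlgebraicClosure (ZMod p)))).infinite_compl.nonempty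
  set N := (A ×ˢ A ×ˢ X).card with hNdef
  have key := sum_le_of_card_superlevel_le (A ×ˢ A ×ˢ X)
    (fun j => ((A ×ˢ A ×ˢ X).filter fun i => Incident i j).card) (M := A.card ^ 2)
    (k := 24 * (N.sqrt + 1)) (B := 3800 * (N : ℝ) ^ 2) (by positivity)
    (fun j _ => card_incident_le A X j) ?_
  · refine key.trans ?_
    rw [← hNdef]
    have hs : (N : ℝ) ≤ ((N.sqrt : ℝ) + 1) ^ 2 := by exact_mod_cast (Nat.lt_succ_sqrt' N).le
    push_cast
    have hs0 : (0 : ℝ) < (N.sqrt : ℝ) + 1 := by positivity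
    generalize (N.sqrt : ℝ) + 1 = s at *
    have h3 : 3800 * (N : ℝ) ^ 2 * (2 / (24 * s + 1)) ≤ 317 * N * s := by
      rw [mul_div_assoc', div_le_iff₀ (by positivity)]
      have h4 : (N : ℝ) * N ≤ N * s ^ 2 := by gcongr
      nlinarith [mul_nonneg (Nat.cast_nonneg (α := ℝ) N) hs0.le]
    linarith
  · intro r hr hrM
    obtain ⟨a, b, hab, hbp, habr, hb⟩ := exists_flex_parameters (by omega) hN h9 hr
    have h3 := card_rich_triples_le p h2 hε hAX hab hbp habr
    have hr0 : (0 : ℝ) < r := by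
      have : 0 < r := by omega
      exact_mod_cast this
    have hXn : (X.card : ℝ) ≤ N / r := by
      rw [le_div_iff₀ hr0, hcard]
      push_cast
      rw [mul_comm]
      gcongr
      exact_mod_cast hrM
    have hX1 : (1 : ℝ) ≤ X.card := by exact_mod_cast hX
    have h4 : (3800 * (N : ℝ) ^ 2) * ((r : ℝ) ^ 2)⁻¹ = 3800 * (N / r : ℝ) ^ 2 := by
      rw [div_pow]
      ring
    rw [h4]
    generalize (N / r : ℝ) = n at *
    have hbn : (b : ℝ) ≤ 25 * n := by linarith
    calc _ ≤ (((6 * b ^ 2 + X.card * b + b : ℕ)) : ℝ) := by exact_mod_cast h3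
      _ = 6 * (b : ℝ) ^ 2 + X.card * b + 1 * b := by push_cast; ring
      _ ≤ 6 * (25 * n) ^ 2 + n * (25 * n) + n * (25 * n) := by
        gcongr <;> linarith
      _ = 3800 * n ^ 2 := by ring

theorem sqrt_le_card_sub_sq {p : ℕ} [Fact p.Prime] (hp : 11 ≤ p) {A X : Finset (ZMod p)}
    (hA : 0 < A.card) (hAX : A.card ≤ X.card) (h9 : 9 * (A.card ^ 2 * X.card) ≤ p ^ 2) :
    √((A.card : ℝ) ^ 2 * X.card) ≤ 1364 * (X - (A - A).image fun x => x ^ 2).card := by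
  have hX : 0 < X.card := hA.trans_le hAX
  have hcard : (A ×ˢ A ×ˢ X).card = A.card ^ 2 * X.card := by
    rw [card_product, card_product]
    ring
  have hE := sum_card_incident_le hp hA hAX (hcard ▸ h9)
  have hCS := card_sq_le_card_mul_sum_card_incident A X
  rw [hcard] at hE hCS
  have hN : 0 < A.card ^ 2 * X.card := by positivity
  rw [show (A.card : ℝ) ^ 2 * X.card = ((A.card ^ 2 * X.card : ℕ) : ℝ) by push_cast; ring]
  generalize A.card ^ 2 * X.card = N at *
  generalize (X - (A - A).image fun x => x ^ 2).card = D at *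
  have hs : 1 ≤ N.sqrt := Nat.sqrt_pos.mpr hN
  have hs2 : N.sqrt * N.sqrt ≤ N := Nat.sqrt_le N
  have hs3 : (N : ℝ) ≤ (N.sqrt + 1 : ℝ) ^ 2 := by exact_mod_cast (Nat.lt_succ_sqrt' N).le
  have hCS' : (N : ℝ) ^ 2 ≤ D * (341 * N * ((N.sqrt : ℝ) + 1)) :=
    le_trans (by exact_mod_cast hCS) (mul_le_mul_of_nonneg_left hE (Nat.cast_nonneg D))
  have hN' : (0 : ℝ) < N := by exact_mod_cast hN
  have h1 : (N : ℝ) ≤ D * (341 * ((N.sqrt : ℝ) + 1)) := by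
    refine le_of_mul_le_mul_left ?_ hN'
    linarith
  have hs' : (1 : ℝ) ≤ N.sqrt := by exact_mod_cast hs
  have hs2' : (N.sqrt : ℝ) * N.sqrt ≤ N := by exact_mod_cast hs2
  have h2 : (N.sqrt : ℝ) ≤ 682 * D := by
    refine le_of_mul_le_mul_left ?_ (zero_lt_one.trans_le hs')
    have h3 : (D : ℝ) * (341 * ((N.sqrt : ℝ) + 1)) ≤ D * (341 * (2 * N.sqrt)) := by
      gcongr
      linarith
    linarith
  have h4 : √(N : ℝ) ≤ N.sqrt + 1 := Real.sqrt_le_iff.mpr ⟨by positivity, hs3⟩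
  linarith

theorem exists_truncation {a x P : ℕ} (ha : 0 < a) (hax : a ≤ x) (hP : 9 ≤ P) :
    ∃ m n, 0 < m ∧ m ≤ n ∧ m ≤ a ∧ n ≤ x ∧ 9 * (m ^ 2 * n) ≤ P ∧
      (P < 36 * (m ^ 2 * n) ∨ (m = a ∧ n = x)) := by
  obtain ⟨⟨m, n⟩, hmn, hmax⟩ := exists_max_image
    ((Icc 1 a ×ˢ Icc 1 x).filter fun q => q.1 ≤ q.2 ∧ 9 * (q.1 ^ 2 * q.2) ≤ P)
    (fun q => q.1 + q.2)
    ⟨(1, 1), by simp only [mem_filter, mem_product, mem_Icc]; omega⟩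
  simp only [mem_filter, mem_product, mem_Icc] at hmn hmax
  obtain ⟨⟨⟨hm, hma⟩, hn, hnx⟩, hle, hP'⟩ := hmn
  refine ⟨m, n, hm, hle, hma, hnx, hP', ?_⟩
  by_contra! h
  obtain ⟨h36, hne⟩ := h
  rcases hnx.lt_or_eq with hnx | rfl
  · have h1 : m ^ 2 * (n + 1) ≤ 4 * (m ^ 2 * n) := by nlinarith [sq_nonneg m]
    have := hmax (m, n + 1) ⟨⟨⟨hm, hma⟩, by omega, hnx⟩, by dsimp only; omega, by dsimp only; omega⟩
    dsimp only at this
    omega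
  · have hma' : m < a := lt_of_le_of_ne hma fun h => hne h rfl
    have h1 : (m + 1) ^ 2 * n ≤ 4 * (m ^ 2 * n) := by
      rw [← mul_assoc]
      exact Nat.mul_le_mul_right _ (by nlinarith)
    have := hmax (m + 1, n) ⟨⟨⟨by omega, hma'⟩, hn, le_rfl⟩, by dsimp only; omega, by dsimp only; omega⟩
    dsimp only at this
    omega

theorem min_le_card_sub_sq {p : ℕ} [Fact p.Prime] {A X : Finset (ZMod p)}
    (hA : 0 < A.card) (hAX : A.card ≤ X.card) :
    min (p : ℝ) √((A.card : ℝ) ^ 2 * X.card) ≤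
      8184 * (X - (A - A).image fun x => x ^ 2).card := by
  by_cases hp : 11 ≤ p
  · obtain ⟨m, n, hm, hmn, hma, hnx, h9, h⟩ := exists_truncation hA hAX (P := p ^ 2) (by nlinarith)
    obtain ⟨A', hA', rfl⟩ := exists_subset_card_eq hma
    obtain ⟨X', hX', rfl⟩ := exists_subset_card_eq hnx
    have h1 := sqrt_le_card_sub_sq hp hm hmn h9
    have h2 : ((X' - (A' - A').image fun x => x ^ 2).card : ℝ) ≤
        (X - (A - A).image fun x => x ^ 2).card := by
      exact_mod_cast card_le_card (sub_subset_sub hX' (image_subset_image (sub_subset_sub hA' hA')))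
    rcases h with h | ⟨ha, hx⟩
    · refine (min_le_left _ _).trans ?_
      have h3 : (p : ℝ) ≤ 6 * √((A'.card : ℝ) ^ 2 * X'.card) := by
        have h4 : (p : ℝ) ^ 2 ≤ 36 * ((A'.card : ℝ) ^ 2 * X'.card) := by exact_mod_cast h.le
        refine abs_le_of_sq_le_sq' ?_ (by positivity) |>.2
        rw [mul_pow, Real.sq_sqrt (by positivity)]
        linarith
      linarith
    · refine (min_le_right _ _).trans ?_
      rw [← ha, ← hx]
      linarith [Nat.cast_nonneg (α := ℝ) (X - (A - A).image fun x => x ^ 2).card]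
  · refine (min_le_left _ _).trans ?_
    have hne : (X - (A - A).image fun x => x ^ 2).Nonempty :=
      (card_pos.mp (hA.trans_le hAX)).sub
        (((card_pos.mp hA).sub (card_pos.mp hA)).image _)
    have h1 : (1 : ℝ) ≤ (X - (A - A).image fun x => x ^ 2).card := by
      exact_mod_cast hne.card_pos
    have h2 : (p : ℝ) ≤ 11 := by exact_mod_cast (not_le.mp hp).le
    linarith

end Conclusion

/-- (Pham–Vinh–De Zeeuw) There exist absolute constants `C, c > 0` such that for every
prime `p` and finite `A, X ⊆ 𝔽_p` with `|X| ≥ C·|A|`, one has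
`|X - (A-A)²| ≥ c·min{p, |X|^{1/2}·|A|}`. -/
theorem shift_diff_sq_lower :
    ∃ C c : ℝ, 0 < C ∧ 0 < c ∧
      ∀ (p : ℕ), p.Prime →
        ∀ A X : Finset (ZMod p), (X.card : ℝ) ≥ C * (A.card : ℝ) →
          ((X - (A - A).image fun x => x ^ 2).card : ℝ) ≥
            c * min (p : ℝ) ((X.card : ℝ) ^ ((1 : ℝ) / 2) * (A.card : ℝ)) := by
  refine ⟨1, 1 / 8184, one_pos, by norm_num, fun p hp A X hAX => ?_⟩
  rw [one_mul, ge_iff_le, Nat.cast_le] at hAX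
  have : Fact p.Prime := ⟨hp⟩
  rw [← Real.sqrt_eq_rpow]
  rcases Nat.eq_zero_or_pos A.card with hA | hA
  · rw [hA, Nat.cast_zero, mul_zero, min_eq_right (Nat.cast_nonneg p), mul_zero]
    exact Nat.cast_nonneg _
  · have h := min_le_card_sub_sq hA hAX
    rw [Real.sqrt_mul (by positivity), Real.sqrt_sq (Nat.cast_nonneg _),
      mul_comm (A.card : ℝ)] at h
    linarith

end FpSumProd
end

section
/- (Rudnev's point–plane incidence bound) There exists an absolute constant C > 0 such that the following holds. Let p be a prime, let R be a finite set of points in F_p³ and S a finite set of (affine) planes in F_p³ with |R| ≤ |S|. Let k ≥ 1 and suppose there is no line ℓ in F_p³ such that ℓ contains at least k points of R and ℓ is contained in at least k planes of S. Then the number of incidences I(R,S) := #{(r,s) ∈ R×S : r ∈ s} satisfies I(R,S) ≤ C·( |R|·|S|/p + |R|^{1/2}·|S| + k·|S| ). -/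
open Finset

namespace FpDist

section Counting

open scoped Classical in
/-- The number of pairs of `A × B` related by `r`. -/
noncomputable def incCount {α β : Type*} (r : α → β → Prop) (A : Finset α) (B : Finset β) : ℕ :=
  ∑ a ∈ A, #{b ∈ B | r a b}

open scoped Classical

variable {α β : Type*} (r : α → β → Prop)

theorem incCount_eq_sum_right (A : Finset α) (B : Finset β) :
    incCount r A B = ∑ b ∈ B, #{a ∈ A | r a b} :=
  Finset.sum_card_bipartiteAbove_eq_sum_card_bipartiteBelow r

variable {r}

theorem incCount_le_mul_of_left {A : Finset α} {B : Finset β} {N : ℕ}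
    (h : ∀ a ∈ A, #{b ∈ B | r a b} ≤ N) : incCount r A B ≤ #A * N := by
  simpa [incCount] using Finset.sum_le_card_nsmul A _ N h

theorem incCount_le_mul_of_right {A : Finset α} {B : Finset β} {N : ℕ}
    (h : ∀ b ∈ B, #{a ∈ A | r a b} ≤ N) : incCount r A B ≤ #B * N := by
  rw [incCount_eq_sum_right]
  simpa using Finset.sum_le_card_nsmul B _ N h

theorem incCount_le_mul (A : Finset α) (B : Finset β) : incCount r A B ≤ #A * #B :=
  incCount_le_mul_of_left fun _ _ => card_filter_le _ _

theorem incCount_mono {A A' : Finset α} {B B' : Finset β} (hA : A ⊆ A') (hB : B ⊆ B') :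
    incCount r A B ≤ incCount r A' B' :=
  (Finset.sum_le_sum_of_subset hA).trans
    (Finset.sum_le_sum fun _ _ => card_le_card (filter_subset_filter _ hB))

theorem incCount_union_left {A A' : Finset α} (h : Disjoint A A') (B : Finset β) :
    incCount r (A ∪ A') B = incCount r A B + incCount r A' B :=
  Finset.sum_union h

theorem incCount_filter_left (P : α → Prop) [DecidablePred P] (A : Finset α) (B : Finset β) :
    incCount r A B = incCount r {a ∈ A | P a} B + incCount r {a ∈ A | ¬ P a} B :=
  (Finset.sum_filter_add_sum_filter_not A P _).symm

theorem incCount_filter_right (P : β → Prop) [DecidablePred P] (A : Finset α) (B : Finset β) :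
    incCount r A B = incCount r A {b ∈ B | P b} + incCount r A {b ∈ B | ¬ P b} := by
  simp only [incCount_eq_sum_right]
  exact (Finset.sum_filter_add_sum_filter_not B P _).symm

/-- Greedy selection: a small subset of `A` that saturates the elements of `B` carrying most of
the incidences. -/
theorem exists_saturating_subset (A : Finset α) (B : Finset β) {d M Y : ℕ}
    (h : (d + 1) * #B < M * (Y + 1)) :
    ∃ A' ⊆ A, #A' ≤ M ∧ incCount r A {b ∈ B | #{a ∈ A' | r a b} ≤ d} ≤ d * #B + Y * #A := by
  by_contra! hcon
  have key : ∀ j ≤ M, ∃ A' ⊆ A, #A' ≤ j ∧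
      j * (Y + 1) ≤ ∑ b ∈ B, min (d + 1) #{a ∈ A' | r a b} := by
    intro j
    induction j with
    | zero => exact fun _ => ⟨∅, by simp⟩
    | succ j ih =>
      intro hj
      obtain ⟨A', hA', hc, hs⟩ := ih (by omega)
      have hlt := hcon A' hA' (by omega)
      set U := {b ∈ B | #{a ∈ A' | r a b} ≤ d} with hU
      have h1 : incCount r A U = incCount r A' U + incCount r (A \ A') U := by
        rw [← incCount_union_left disjoint_sdiff, union_sdiff_of_subset hA']
      have h2 : incCount r A' U ≤ d * #B := by
        refine (incCount_le_mul_of_right (N := d) fun b hb => (mem_filter.1 hb).2).trans ?_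
        rw [mul_comm]
        exact Nat.mul_le_mul_left _ (card_filter_le _ _)
      have h3 : ∃ a ∈ A \ A', Y < #{b ∈ U | r a b} := by
        by_contra! h4
        have h5 := incCount_le_mul_of_left h4
        have h6 : #(A \ A') * Y ≤ Y * #A := by
          rw [mul_comm]
          exact Nat.mul_le_mul_left _ (card_le_card sdiff_subset)
        omega
      obtain ⟨a, ha, hY⟩ := h3
      rw [mem_sdiff] at ha
      refine ⟨insert a A', insert_subset ha.1 hA', (card_insert_le _ _).trans (by omega), ?_⟩
      have h7 : ∀ b ∈ B, min (d + 1) #{a ∈ A' | r a b} + (if b ∈ {b ∈ U | r a b} then 1 else 0) ≤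
          min (d + 1) #{a ∈ insert a A' | r a b} := by
        intro b hb
        by_cases hab : r a b
        · have : #{a ∈ insert a A' | r a b} = #{a ∈ A' | r a b} + 1 := by
            rw [filter_insert, if_pos hab, card_insert_of_notMem]
            simp [ha.2]
          rw [this]
          simp only [hU, mem_filter, hb, hab, true_and, and_true]
          split_ifs <;> omega
        · have : #{a ∈ insert a A' | r a b} = #{a ∈ A' | r a b} := by
            rw [filter_insert, if_neg hab]
          simp [this, hab]
      have h8 := Finset.sum_le_sum h7
      rw [Finset.sum_add_distrib, Finset.sum_ite_mem, sum_const, smul_eq_mul, mul_one,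
        inter_eq_right.2 ((filter_subset _ _).trans (filter_subset _ _))] at h8
      rw [← hU] at h8
      rw [Nat.succ_mul]
      omega
  obtain ⟨A', -, -, hs⟩ := key M le_rfl
  have : ∑ b ∈ B, min (d + 1) #{a ∈ A' | r a b} ≤ #B * (d + 1) := by
    simpa using Finset.sum_le_card_nsmul B _ (d + 1) fun b _ =>
      min_le_left (d + 1) #{a ∈ A' | r a b}
  rw [mul_comm] at this
  omega

end Counting

section Rays

variable {K : Type*} [Field K]

/-- The triple `(t, b, e)` encodes the line through `(0, b, e + b t)` with direction
`(1, t, t ^ 2)` in three-dimensional space. -/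
@[ext]
structure Ray (K : Type*) where
  t : K
  b : K
  e : K

/-- Two rays of different slopes meet exactly when this relation holds. -/
def Ray.Meets (r s : Ray K) : Prop := r.e - s.e = r.b * s.t - r.t * s.b

theorem Ray.Meets.symm {r s : Ray K} (h : r.Meets s) : s.Meets r := by
  unfold Ray.Meets at *
  linear_combination -h

open MvPolynomial

/-- Restriction of polynomials in `z, y, x` (the variables `0, 1, 2`) to a ray. -/
noncomputable def restr (a : Ray K) : MvPolynomial (Fin 3) K →ₐ[K] Polynomial K :=
  aeval ![Polynomial.C (a.e + a.b * a.t) + Polynomial.C (a.t ^ 2) * Polynomial.X,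
    Polynomial.C a.b + Polynomial.C a.t * Polynomial.X, Polynomial.X]

/-- The parameter on `a` of the common point of two meeting rays. -/
noncomputable def meetPoint (a b : Ray K) : K := -(a.b - b.b) / (a.t - b.t)

theorem eval_restr (a : Ray K) (x : K) (g : MvPolynomial (Fin 3) K) :
    (restr a g).eval x = MvPolynomial.eval ![a.e + a.b * a.t + a.t ^ 2 * x, a.b + a.t * x, x] g := by
  have : (Polynomial.evalRingHom x).comp (restr a).toRingHom =
      (MvPolynomial.eval ![a.e + a.b * a.t + a.t ^ 2 * x, a.b + a.t * x, x]) := by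
    apply MvPolynomial.ringHom_ext
    · intro r
      simp [restr]
    · intro i
      fin_cases i <;> simp [restr]
  exact congrArg (fun φ => φ g) this

theorem eval_restr_meetPoint {a b : Ray K} (h : a.Meets b) (ht : a.t ≠ b.t)
    (g : MvPolynomial (Fin 3) K) :
    (restr a g).eval (meetPoint a b) = (restr b g).eval (meetPoint a b) := by
  have ht' : a.t - b.t ≠ 0 := sub_ne_zero.2 ht
  have h1 : a.b + a.t * meetPoint a b = b.b + b.t * meetPoint a b := by
    unfold meetPoint
    field_simp
    ring
  have h2 : a.e + a.b * a.t + a.t ^ 2 * meetPoint a b =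
      b.e + b.b * b.t + b.t ^ 2 * meetPoint a b := by
    unfold Ray.Meets at h
    linear_combination h + (a.t + b.t) * h1
  rw [eval_restr, eval_restr, h1, h2]

/-- Distinct slopes and no two members meeting. -/
def SkewFamily (A : Finset (Ray K)) : Prop :=
  ∀ a ∈ A, ∀ a' ∈ A, a ≠ a' → a.t ≠ a'.t ∧ ¬ a.Meets a'

theorem SkewFamily.mono {A A' : Finset (Ray K)} (h : SkewFamily A) (hA : A' ⊆ A) :
    SkewFamily A' :=
  fun a ha a' ha' => h a (hA ha) a' (hA ha')

theorem SkewFamily.meetPoint_injOn {A : Finset (Ray K)} (hA : SkewFamily A) {b : Ray K}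
    {a a' : Ray K} (ha : a ∈ A) (ha' : a' ∈ A) (hab : a.Meets b) (hab' : a'.Meets b)
    (ht : a.t ≠ b.t) (ht' : a'.t ≠ b.t) (h : meetPoint a b = meetPoint a' b) : a = a' := by
  by_contra hne
  apply (hA a ha a' ha' hne).2
  have h1 : a.t - b.t ≠ 0 := sub_ne_zero.2 ht
  have h2 : a'.t - b.t ≠ 0 := sub_ne_zero.2 ht'
  set x := meetPoint a b with hx
  have e1 : a.b + a.t * x = b.b + b.t * x := by
    rw [hx]; unfold meetPoint; field_simp; ring
  have e2 : a'.b + a'.t * x = b.b + b.t * x := by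
    rw [h]; unfold meetPoint; field_simp; ring
  unfold Ray.Meets at *
  linear_combination hab - hab' + (b.t - a'.t) * e1 + (a.t - b.t) * e2

open scoped Classical in
/-- A polynomial that does not vanish on `b` kills at most `D` of the meeting points on `b`. -/
theorem card_meets_le {A : Finset (Ray K)} (hA : SkewFamily A) {b : Ray K}
    (ht : ∀ a ∈ A, a.t ≠ b.t) (hm : ∀ a ∈ A, a.Meets b) {g : Polynomial K} (hg : g ≠ 0)
    (h0 : ∀ a ∈ A, g.eval (meetPoint a b) = 0) : #A ≤ g.natDegree := by
  refine le_trans ?_ (Polynomial.card_roots' g)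
  refine le_trans ?_ (Multiset.toFinset_card_le _)
  refine Finset.card_le_card_of_injOn (fun a => meetPoint a b) ?_ ?_
  · intro a ha
    simpa [hg] using h0 a ha
  · intro a ha a' ha' h
    exact hA.meetPoint_injOn ha ha' (hm a ha) (hm a' ha') (ht a ha) (ht a' ha') h

theorem natDegree_restr_le (a : Ray K) (g : MvPolynomial (Fin 3) K) :
    (restr a g).natDegree ≤ g.totalDegree := by
  rw [restr, MvPolynomial.aeval_def, MvPolynomial.eval₂_eq]
  refine Polynomial.natDegree_sum_le_of_forall_le _ _ fun m hm => ?_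
  refine le_trans ?_ (MvPolynomial.le_totalDegree hm)
  refine (Polynomial.natDegree_C_mul_le _ _).trans ?_
  refine (Polynomial.natDegree_prod_le _ _).trans (Finset.sum_le_sum fun i _ => ?_)
  refine (Polynomial.natDegree_pow_le).trans ?_
  refine (Nat.mul_le_mul_left _ (?_ : _ ≤ 1)).trans (by simp)
  fin_cases i
  · exact Polynomial.natDegree_add_le_of_degree_le ((Polynomial.natDegree_C _).le.trans zero_le_one)
      ((Polynomial.natDegree_C_mul_le _ _).trans Polynomial.natDegree_X_le)
  · exact Polynomial.natDegree_add_le_of_degree_le ((Polynomial.natDegree_C _).le.trans zero_le_one)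
      ((Polynomial.natDegree_C_mul_le _ _).trans Polynomial.natDegree_X_le)
  · simp

theorem totalDegree_pderiv_add_one_le {σ : Type*} (i : σ) {g : MvPolynomial σ K}
    (h : pderiv i g ≠ 0) : (pderiv i g).totalDegree + 1 ≤ g.totalDegree := by
  classical
  obtain ⟨m, hm, hd⟩ := Finset.exists_mem_eq_sup _ (MvPolynomial.support_nonempty.2 h)
    (fun s : σ →₀ ℕ => s.sum fun _ e => e)
  rw [MvPolynomial.totalDegree, hd]
  have hc : coeff (m + Finsupp.single i 1) g ≠ 0 := by
    intro h0
    rw [mem_support_iff, coeff_pderiv, h0, zero_mul] at hm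
    exact hm rfl
  have := MvPolynomial.le_totalDegree (mem_support_iff.2 hc)
  rwa [Finsupp.sum_add_index' (by simp) (by simp), Finsupp.sum_single_index rfl] at this

theorem pderiv_comm {σ : Type*} (i j : σ) (g : MvPolynomial σ K) :
    pderiv i (pderiv j g) = pderiv j (pderiv i g) := by
  classical
  have : ⁅pderiv (R := K) i, pderiv (R := K) j⁆ = (0 : Derivation K (MvPolynomial σ K) (MvPolynomial σ K)) := by
    refine MvPolynomial.derivation_ext fun k => ?_
    simp only [Derivation.commutator_apply, pderiv_X, Pi.single_apply]
    split_ifs <;> simp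
  simpa [Derivation.commutator_apply, sub_eq_zero] using congrArg
    (fun D : Derivation K (MvPolynomial σ K) (MvPolynomial σ K) => D g) this

/-- Differentiation in the direction `(1, t, t ^ 2)`. -/
noncomputable def dirDeriv (t : K) (g : MvPolynomial (Fin 3) K) : MvPolynomial (Fin 3) K :=
  pderiv 2 g + C t * pderiv 1 g + C t ^ 2 * pderiv 0 g

theorem derivative_restr (a : Ray K) (g : MvPolynomial (Fin 3) K) :
    Polynomial.derivative (restr a g) = restr a (dirDeriv a.t g) := by
  induction g using MvPolynomial.induction_on with
  | C r => simp [restr, dirDeriv]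
  | add p q hp hq =>
    simp only [map_add, map_mul, hp, hq, dirDeriv]
    ring
  | mul_X p i hp =>
    have hX : Polynomial.derivative (restr a (X i)) = restr a (dirDeriv a.t (X i)) := by
      fin_cases i <;> simp [restr, dirDeriv, pderiv_X, Polynomial.derivative_pow]
    rw [map_mul, Polynomial.derivative_mul, hp, hX]
    simp only [dirDeriv, Derivation.leibniz, map_add, map_mul, smul_eq_mul]
    ring

theorem finSuccEquiv_C {n : ℕ} (r : K) : finSuccEquiv K n (C r) = Polynomial.C (C r) :=
  (finSuccEquiv K n).commutes r

/-- Restriction of polynomials in `y, x` to the plane line `y = b + t x`. -/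
noncomputable def planeRestr (a : Ray K) : MvPolynomial (Fin 2) K →ₐ[K] Polynomial K :=
  aeval ![Polynomial.C a.b + Polynomial.C a.t * Polynomial.X, Polynomial.X]

theorem restr_eq_eval₂ (a : Ray K) (f : MvPolynomial (Fin 3) K) :
    restr a f = (finSuccEquiv K 2 f).eval₂ (planeRestr a : MvPolynomial (Fin 2) K →+* Polynomial K)
      (Polynomial.C (a.e + a.b * a.t) + Polynomial.C (a.t ^ 2) * Polynomial.X) := by
  have : (restr a : MvPolynomial (Fin 3) K →+* Polynomial K) =
      (Polynomial.eval₂RingHom (planeRestr a : MvPolynomial (Fin 2) K →+* Polynomial K)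
        (Polynomial.C (a.e + a.b * a.t) + Polynomial.C (a.t ^ 2) * Polynomial.X)).comp
        (finSuccEquiv K 2 : MvPolynomial (Fin 3) K →+* _) := by
    apply MvPolynomial.ringHom_ext
    · intro r
      simp [restr, planeRestr, finSuccEquiv_C]
    · intro i
      refine Fin.cases ?_ (fun j => ?_) i
      · simp [restr, finSuccEquiv_X_zero]
      · simp only [RingHom.comp_apply, RingHom.coe_coe, finSuccEquiv_X_succ]
        fin_cases j <;> simp [restr, planeRestr]
  exact congrArg (fun φ => φ f) this

/-- A nonzero polynomial in two variables vanishes on at most as many lines as its degree. -/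
theorem card_le_totalDegree_of_planeRestr {r : MvPolynomial (Fin 2) K} (hr : r ≠ 0)
    {A : Finset (Ray K)} (hA : ∀ a ∈ A, ∀ a' ∈ A, a.t = a'.t → a = a')
    (h0 : ∀ a ∈ A, planeRestr a r = 0) : #A ≤ r.totalDegree := by
  classical
  set y : Ray K → MvPolynomial (Fin 1) K := fun a => C a.b + C a.t * X 0 with hy
  have hroot : ∀ a ∈ A, (finSuccEquiv K 1 r).eval (y a) = 0 := by
    intro a ha
    have : (Polynomial.evalRingHom (y a)).comp (finSuccEquiv K 1 : MvPolynomial (Fin 2) K →+* _) =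
        ((Polynomial.aeval (X 0 : MvPolynomial (Fin 1) K) : _ →ₐ[K] _) : _ →+* _).comp
          (planeRestr a : MvPolynomial (Fin 2) K →+* Polynomial K) := by
      apply MvPolynomial.ringHom_ext
      · intro r
        simp [planeRestr, finSuccEquiv_C, MvPolynomial.algebraMap_eq]
      · intro i
        refine Fin.cases ?_ (fun j => ?_) i
        · simp [planeRestr, finSuccEquiv_X_zero, hy, MvPolynomial.algebraMap_eq]
        · simp only [RingHom.comp_apply, RingHom.coe_coe, finSuccEquiv_X_succ]
          fin_cases j
          simp [planeRestr]
    have := congrArg (fun φ => φ r) this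
    simpa [h0 a ha] using this
  have hne : finSuccEquiv K 1 r ≠ 0 := by simpa using hr
  have hinj : Set.InjOn y A := by
    intro a ha a' ha' h
    apply hA a ha a' ha'
    have e0 := congrArg (MvPolynomial.eval fun _ => (0 : K)) h
    have e1 := congrArg (MvPolynomial.eval fun _ => (1 : K)) h
    simp only [hy, map_add, map_mul, eval_C, eval_X, mul_zero, add_zero, mul_one] at e0 e1
    linear_combination e1 - e0
  calc #A ≤ #(finSuccEquiv K 1 r).roots.toFinset :=
        Finset.card_le_card_of_injOn y (fun a ha => by
          simpa [hne] using hroot a ha) hinj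
    _ ≤ _ := Multiset.toFinset_card_le _
    _ ≤ _ := Polynomial.card_roots' _
    _ = degreeOf 0 r := natDegree_finSuccEquiv r
    _ ≤ _ := degreeOf_le_totalDegree r 0

theorem totalDegree_coeff_finSuccEquiv_le {n : ℕ} (f : MvPolynomial (Fin (n + 1)) K) (i : ℕ) :
    ((finSuccEquiv K n f).coeff i).totalDegree ≤ f.totalDegree := by
  by_cases hi : (finSuccEquiv K n f).coeff i = 0
  · simp [hi]
  · have := totalDegree_coeff_finSuccEquiv_add_le f i hi
    omega

theorem totalDegree_resultant_le {n d e k l : ℕ} {f g : Polynomial (MvPolynomial (Fin n) K)}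
    (hf : ∀ i, (f.coeff i).totalDegree ≤ d) (hg : ∀ i, (g.coeff i).totalDegree ≤ e) :
    (Polynomial.resultant f g k l).totalDegree ≤ k * e + l * d := by
  rw [Polynomial.resultant, Matrix.det_apply]
  refine MvPolynomial.totalDegree_finsetSum_le fun σ _ => ?_
  have h1 : ∀ (u : ℤˣ) (q : MvPolynomial (Fin n) K), (u • q).totalDegree ≤ q.totalDegree := by
    intro u q
    rcases Int.units_eq_one_or u with rfl | rfl <;> simp
  refine (h1 _ _).trans ?_
  refine (totalDegree_finsetProd _ _).trans ?_
  rw [Fin.sum_univ_add]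
  refine add_le_add ?_ ?_
  · refine (Finset.sum_le_card_nsmul _ _ e fun i _ => ?_).trans (by simp)
    simp only [Polynomial.sylvester, Matrix.of_apply, Fin.addCases_left]
    split_ifs
    · exact hg _
    · simp
  · refine (Finset.sum_le_card_nsmul _ _ d fun i _ => ?_).trans (by simp)
    simp only [Polynomial.sylvester, Matrix.of_apply, Fin.addCases_right]
    split_ifs
    · exact hf _
    · simp

/-- A cylinder over a plane curve contains at most as many rays as its degree. -/
theorem card_le_totalDegree_of_degreeOf_eq_zero {f : MvPolynomial (Fin 3) K} (hf : f ≠ 0)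
    (hdeg : degreeOf 0 f = 0) {A : Finset (Ray K)} (hA : ∀ a ∈ A, ∀ a' ∈ A, a.t = a'.t → a = a')
    (h0 : ∀ a ∈ A, restr a f = 0) : #A ≤ f.totalDegree := by
  rw [← natDegree_finSuccEquiv, Polynomial.natDegree_eq_zero] at hdeg
  obtain ⟨r, hr⟩ := hdeg
  have hr0 : r ≠ 0 := by
    rintro rfl
    rw [Polynomial.C_0, eq_comm, map_eq_zero_iff _ (finSuccEquiv K 2).injective] at hr
    exact hf hr
  have h1 : #A ≤ r.totalDegree := by
    refine card_le_totalDegree_of_planeRestr hr0 hA fun a ha => ?_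
    have := h0 a ha
    rw [restr_eq_eval₂, ← hr, Polynomial.eval₂_C] at this
    exact this
  have h2 : r.totalDegree ≤ f.totalDegree := by
    have := totalDegree_coeff_finSuccEquiv_le f 0
    rwa [← hr, Polynomial.coeff_C_zero] at this
  exact h1.trans h2

/-- Two surfaces without common component share few of the lines. -/
theorem card_le_of_irreducible_of_not_dvd {f g : MvPolynomial (Fin 3) K} (hf : Irreducible f)
    (hfg : ¬ f ∣ g) {A : Finset (Ray K)} (hA : ∀ a ∈ A, ∀ a' ∈ A, a.t = a'.t → a = a')
    (h0 : ∀ a ∈ A, restr a f = 0) (h0' : ∀ a ∈ A, restr a g = 0) :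
    #A ≤ 2 * f.totalDegree * g.totalDegree := by
  have hg0 : g ≠ 0 := by
    rintro rfl
    exact hfg (dvd_zero f)
  rcases A.eq_empty_or_nonempty with rfl | ⟨a₀, ha₀⟩
  · simp
  have hgdeg : g.totalDegree ≠ 0 := by
    intro h
    rw [totalDegree_eq_zero_iff_eq_C] at h
    have := h0' a₀ ha₀
    rw [h, restr, aeval_C] at this
    simp only [Polynomial.algebraMap_eq, Polynomial.C_eq_zero] at this
    apply hg0
    rw [h, this, C_0]
  set F := finSuccEquiv K 2 f with hF
  set G := finSuccEquiv K 2 g with hG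
  have hFirr : Irreducible F := (MulEquiv.irreducible_iff (finSuccEquiv K 2)).2 hf
  have hFG : ¬ F ∣ G := fun h => hfg ((map_dvd_iff (finSuccEquiv K 2)).1 h)
  have hFd : F.natDegree ≤ f.totalDegree :=
    (natDegree_finSuccEquiv f).le.trans (degreeOf_le_totalDegree f 0)
  have hGd : G.natDegree ≤ g.totalDegree :=
    (natDegree_finSuccEquiv g).le.trans (degreeOf_le_totalDegree g 0)
  by_cases hdeg : F.natDegree = 0
  · have h1 := card_le_totalDegree_of_degreeOf_eq_zero hf.ne_zero
      (by rwa [← natDegree_finSuccEquiv]) hA h0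
    calc #A ≤ f.totalDegree := h1
      _ ≤ f.totalDegree * (2 * g.totalDegree) := Nat.le_mul_of_pos_right _ (by omega)
      _ = _ := by ring
  · let L := FractionRing (MvPolynomial (Fin 2) K)
    let φ := algebraMap (MvPolynomial (Fin 2) K) L
    have hφ : Function.Injective φ := IsFractionRing.injective _ _
    have hprim : F.IsPrimitive := hFirr.isPrimitive hdeg
    have hirr : Irreducible (F.map φ) :=
      (hprim.irreducible_iff_irreducible_map_fraction_map (K := L)).1 hFirr
    have hcop : IsCoprime (F.map φ) (G.map φ) := by
      rw [hirr.coprime_iff_not_dvd]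
      exact fun h => hFG (hprim.dvd_of_fraction_map_dvd_fraction_map h)
    have hres : Polynomial.resultant F G ≠ 0 := by
      intro h
      have h1 : Polynomial.resultant (F.map φ) (G.map φ) ≠ 0 := by
        rw [Ne, Polynomial.resultant_eq_zero_iff]
        exact fun h => h.2 hcop
      apply h1
      rw [Polynomial.natDegree_map_eq_of_injective hφ, Polynomial.natDegree_map_eq_of_injective hφ,
        Polynomial.resultant_map_map, h, map_zero]
    obtain ⟨u, v, -, -, huv⟩ := Polynomial.exists_mul_add_mul_eq_C_resultant F G le_rfl le_rfl
      (Or.inl hdeg)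
    have h1 := card_le_totalDegree_of_planeRestr hres hA fun a ha => by
      have h2 := h0 a ha
      have h3 := h0' a ha
      rw [restr_eq_eval₂] at h2 h3
      have h4 := congrArg (Polynomial.eval₂ (planeRestr a : MvPolynomial (Fin 2) K →+* Polynomial K)
        (Polynomial.C (a.e + a.b * a.t) + Polynomial.C (a.t ^ 2) * Polynomial.X)) huv
      rw [Polynomial.eval₂_add, Polynomial.eval₂_mul, Polynomial.eval₂_mul, h2, h3,
        Polynomial.eval₂_C, zero_mul, zero_mul, zero_add] at h4
      exact h4.symm
    calc #A ≤ _ := h1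
      _ ≤ F.natDegree * g.totalDegree + G.natDegree * f.totalDegree :=
        totalDegree_resultant_le (totalDegree_coeff_finSuccEquiv_le f)
          (totalDegree_coeff_finSuccEquiv_le g)
      _ ≤ f.totalDegree * g.totalDegree + g.totalDegree * f.totalDegree := by gcongr
      _ = _ := by ring

theorem pderiv_dirDeriv (i : Fin 3) (t : K) (g : MvPolynomial (Fin 3) K) :
    pderiv i (dirDeriv t g) = dirDeriv t (pderiv i g) := by
  simp only [dirDeriv, map_add, ← C_pow, pderiv_C_mul, pderiv_comm i]

theorem dirDeriv_dirDeriv (t : K) (f : MvPolynomial (Fin 3) K) :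
    dirDeriv t (dirDeriv t f) = pderiv 2 (pderiv 2 f) + C t * (2 * pderiv 1 (pderiv 2 f)) +
      C t ^ 2 * (pderiv 1 (pderiv 1 f) + 2 * pderiv 0 (pderiv 2 f)) +
      C t ^ 3 * (2 * pderiv 0 (pderiv 1 f)) + C t ^ 4 * pderiv 0 (pderiv 0 f) := by
  rw [dirDeriv, pderiv_dirDeriv, pderiv_dirDeriv, pderiv_dirDeriv]
  simp only [dirDeriv]
  rw [pderiv_comm 2 1 f, pderiv_comm 2 0 f, pderiv_comm 1 0 f]
  ring

/-- The quotient in the pseudo-division of the second directional derivative by the first. -/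
noncomputable def pseudoQuot (f T : MvPolynomial (Fin 3) K) : MvPolynomial (Fin 3) K :=
  pderiv 0 f ^ 2 * pderiv 0 (pderiv 0 f) * T ^ 2 +
  (pderiv 0 f ^ 2 * (2 * pderiv 0 (pderiv 1 f)) -
    pderiv 0 f * pderiv 1 f * pderiv 0 (pderiv 0 f)) * T +
  (pderiv 0 f ^ 2 * (pderiv 1 (pderiv 1 f) + 2 * pderiv 0 (pderiv 2 f)) -
    pderiv 1 f * (pderiv 0 f * (2 * pderiv 0 (pderiv 1 f)) - pderiv 1 f * pderiv 0 (pderiv 0 f)) -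
    pderiv 2 f * pderiv 0 f * pderiv 0 (pderiv 0 f))

/-- The linear coefficient of the remainder in the pseudo-division of the second directional
derivative by the first. -/
noncomputable def pseudoRem₁ (f : MvPolynomial (Fin 3) K) : MvPolynomial (Fin 3) K :=
  pderiv 0 f ^ 3 * (2 * pderiv 1 (pderiv 2 f)) -
  pderiv 1 f * (pderiv 0 f ^ 2 * (pderiv 1 (pderiv 1 f) + 2 * pderiv 0 (pderiv 2 f)) -
    pderiv 1 f * (pderiv 0 f * (2 * pderiv 0 (pderiv 1 f)) - pderiv 1 f * pderiv 0 (pderiv 0 f)) -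
    pderiv 2 f * pderiv 0 f * pderiv 0 (pderiv 0 f)) -
  pderiv 2 f * (pderiv 0 f ^ 2 * (2 * pderiv 0 (pderiv 1 f)) -
    pderiv 0 f * pderiv 1 f * pderiv 0 (pderiv 0 f))

/-- The constant coefficient of the remainder in the pseudo-division of the second directional
derivative by the first. -/
noncomputable def pseudoRem₀ (f : MvPolynomial (Fin 3) K) : MvPolynomial (Fin 3) K :=
  pderiv 0 f ^ 3 * pderiv 2 (pderiv 2 f) -
  pderiv 2 f * (pderiv 0 f ^ 2 * (pderiv 1 (pderiv 1 f) + 2 * pderiv 0 (pderiv 2 f)) -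
    pderiv 1 f * (pderiv 0 f * (2 * pderiv 0 (pderiv 1 f)) - pderiv 1 f * pderiv 0 (pderiv 0 f)) -
    pderiv 2 f * pderiv 0 f * pderiv 0 (pderiv 0 f))

theorem pseudo_division (t : K) (f : MvPolynomial (Fin 3) K) :
    pderiv 0 f ^ 3 * dirDeriv t (dirDeriv t f) =
      dirDeriv t f * pseudoQuot f (C t) + C t * pseudoRem₁ f + pseudoRem₀ f := by
  rw [dirDeriv_dirDeriv, dirDeriv, pseudoQuot, pseudoRem₁, pseudoRem₀]
  ring

theorem totalDegree_pderiv_le {σ : Type*} (i : σ) (g : MvPolynomial σ K) :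
    (pderiv i g).totalDegree ≤ g.totalDegree := by
  by_cases h : pderiv i g = 0
  · simp [h]
  · have := totalDegree_pderiv_add_one_le i h
    omega

section Degrees

variable {σ : Type*} {p q : MvPolynomial σ K} {m n N : ℕ}

theorem totalDegree_mul_le_of_le (hp : p.totalDegree ≤ m) (hq : q.totalDegree ≤ n)
    (h : m + n ≤ N) : (p * q).totalDegree ≤ N :=
  (totalDegree_mul p q).trans ((add_le_add hp hq).trans h)

theorem totalDegree_add_le_of_le (hp : p.totalDegree ≤ N) (hq : q.totalDegree ≤ N) :
    (p + q).totalDegree ≤ N :=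
  (totalDegree_add p q).trans (max_le hp hq)

theorem totalDegree_sub_le_of_le (hp : p.totalDegree ≤ N) (hq : q.totalDegree ≤ N) :
    (p - q).totalDegree ≤ N :=
  (totalDegree_sub p q).trans (max_le hp hq)

theorem totalDegree_pow_le_of_le (k : ℕ) (hp : p.totalDegree ≤ m) (h : k * m ≤ N) :
    (p ^ k).totalDegree ≤ N :=
  (totalDegree_pow p k).trans ((Nat.mul_le_mul_left k hp).trans h)

theorem totalDegree_two_mul_le (hp : p.totalDegree ≤ N) : (2 * p).totalDegree ≤ N := by
  rw [two_mul]
  exact totalDegree_add_le_of_le hp hp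

end Degrees

theorem totalDegree_pseudoRem_le (f : MvPolynomial (Fin 3) K) :
    (pseudoRem₁ f).totalDegree ≤ 4 * f.totalDegree ∧
      (pseudoRem₀ f).totalDegree ≤ 4 * f.totalDegree := by
  set d := f.totalDegree with hd
  have h1 : ∀ i, (pderiv i f).totalDegree ≤ d := fun i => totalDegree_pderiv_le i f
  have h2 : ∀ i j, (pderiv i (pderiv j f)).totalDegree ≤ d := fun i j =>
    (totalDegree_pderiv_le i _).trans (h1 j)
  have e2 : (pderiv 1 (pderiv 1 f) + 2 * pderiv 0 (pderiv 2 f)).totalDegree ≤ d :=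
    totalDegree_add_le_of_le (h2 1 1) (totalDegree_two_mul_le (h2 0 2))
  have hC2 : (pderiv 0 f ^ 2).totalDegree ≤ 2 * d := totalDegree_pow_le_of_le 2 (h1 0) le_rfl
  have hC3 : (pderiv 0 f ^ 3).totalDegree ≤ 3 * d := totalDegree_pow_le_of_le 3 (h1 0) le_rfl
  have q0 : (pderiv 0 f ^ 2 * (pderiv 1 (pderiv 1 f) + 2 * pderiv 0 (pderiv 2 f)) -
      pderiv 1 f * (pderiv 0 f * (2 * pderiv 0 (pderiv 1 f)) -
        pderiv 1 f * pderiv 0 (pderiv 0 f)) -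
      pderiv 2 f * pderiv 0 f * pderiv 0 (pderiv 0 f)).totalDegree ≤ 3 * d := by
    refine totalDegree_sub_le_of_le (totalDegree_sub_le_of_le ?_ ?_) ?_
    · exact totalDegree_mul_le_of_le hC2 e2 (by omega)
    · refine totalDegree_mul_le_of_le (n := 2 * d) (h1 1) (totalDegree_sub_le_of_le ?_ ?_) (by omega)
      · exact totalDegree_mul_le_of_le (h1 0) (totalDegree_two_mul_le (h2 0 1)) (by omega)
      · exact totalDegree_mul_le_of_le (h1 1) (h2 0 0) (by omega)
    · exact totalDegree_mul_le_of_le (totalDegree_mul_le_of_le (h1 2) (h1 0) le_rfl) (h2 0 0)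
        (by omega)
  have q1 : (pderiv 0 f ^ 2 * (2 * pderiv 0 (pderiv 1 f)) -
      pderiv 0 f * pderiv 1 f * pderiv 0 (pderiv 0 f)).totalDegree ≤ 3 * d := by
    refine totalDegree_sub_le_of_le ?_ ?_
    · exact totalDegree_mul_le_of_le hC2 (totalDegree_two_mul_le (h2 0 1)) (by omega)
    · exact totalDegree_mul_le_of_le (totalDegree_mul_le_of_le (h1 0) (h1 1) le_rfl) (h2 0 0)
        (by omega)
  constructor
  · refine totalDegree_sub_le_of_le (totalDegree_sub_le_of_le ?_ ?_) ?_
    · exact totalDegree_mul_le_of_le hC3 (totalDegree_two_mul_le (h2 1 2)) (by omega)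
    · exact totalDegree_mul_le_of_le (h1 1) q0 (by omega)
    · exact totalDegree_mul_le_of_le (h1 2) q1 (by omega)
  · refine totalDegree_sub_le_of_le ?_ ?_
    · exact totalDegree_mul_le_of_le hC3 (h2 2 2) (by omega)
    · exact totalDegree_mul_le_of_le (h1 2) q0 (by omega)

theorem eval_restr_pseudoRem_eq_zero {f : MvPolynomial (Fin 3) K} {a b : Ray K}
    (ha : restr a f = 0) (hb : restr b f = 0) (h : a.Meets b) (ht : a.t ≠ b.t) :
    (restr a (pseudoRem₁ f)).eval (meetPoint a b) = 0 ∧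
      (restr a (pseudoRem₀ f)).eval (meetPoint a b) = 0 := by
  have key : ∀ c : Ray K, restr c f = 0 →
      Polynomial.C c.t * restr c (pseudoRem₁ f) + restr c (pseudoRem₀ f) = 0 := by
    intro c hc
    have h1 : restr c (dirDeriv c.t f) = 0 := by
      rw [← derivative_restr, hc, map_zero]
    have h2 : restr c (dirDeriv c.t (dirDeriv c.t f)) = 0 := by
      rw [← derivative_restr, h1, map_zero]
    have h3 := congrArg (restr c) (pseudo_division c.t f)
    have h4 : restr c (C c.t) = Polynomial.C c.t := by simp [restr]
    simp only [map_add, map_mul, h1, h2, h4, mul_zero, zero_mul, zero_add] at h3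
    exact h3.symm
  have ea := congrArg (Polynomial.eval (meetPoint a b)) (key a ha)
  have eb := congrArg (Polynomial.eval (meetPoint a b)) (key b hb)
  simp only [Polynomial.eval_add, Polynomial.eval_mul, Polynomial.eval_C, Polynomial.eval_zero,
    ← eval_restr_meetPoint h ht] at ea eb
  have h1 : (restr a (pseudoRem₁ f)).eval (meetPoint a b) = 0 := by
    have : (a.t - b.t) * (restr a (pseudoRem₁ f)).eval (meetPoint a b) = 0 := by
      linear_combination ea - eb
    exact (mul_eq_zero.1 this).resolve_left (sub_ne_zero.2 ht)
  exact ⟨h1, by rw [h1] at ea; simpa using ea⟩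

/-- A flecnodal surface satisfies a second order differential equation along each of its rays. -/
theorem differential_relation {f : MvPolynomial (Fin 3) K} {a : Ray K} (ha : restr a f = 0)
    (h₁ : f ∣ pseudoRem₁ f) (h₀ : f ∣ pseudoRem₀ f) {P Q : Polynomial K}
    (hP : P = restr a (pderiv 0 f))
    (hQ : Q = restr a (pderiv 1 f) + 2 * Polynomial.C a.t * restr a (pderiv 0 f))
    (hP0 : P ≠ 0) (hQ0 : Q ≠ 0) :
    Q * (Q * P.derivative.derivative - P * Q.derivative.derivative) =
      2 * Q.derivative * (Q * P.derivative - P * Q.derivative) := by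
  set τ := Polynomial.C a.t with hτ
  have hC : restr a (C a.t) = τ := by simp [restr, hτ]
  have hC' : τ.derivative = 0 := by simp [hτ]
  set W : MvPolynomial (Fin 3) K → Polynomial K := fun g =>
    P ^ 2 * restr a (pderiv 2 g) + (τ * P ^ 2 - P * Q) * restr a (pderiv 1 g) +
      (τ ^ 2 * P ^ 2 - 2 * τ * P * Q + Q ^ 2) * restr a (pderiv 0 g) with hW
  have Wadd : ∀ g h, W (g + h) = W g + W h := by
    intro g h
    simp only [hW, map_add]
    ring
  have Wmul : ∀ g h, W (g * h) = restr a g * W h + restr a h * W g := by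
    intro g h
    simp only [hW, Derivation.leibniz, map_add, map_mul, smul_eq_mul]
    ring
  have hF1 : restr a (dirDeriv a.t f) = 0 := by
    rw [← derivative_restr, ha, map_zero]
  have hF2 : restr a (dirDeriv a.t (dirDeriv a.t f)) = 0 := by
    rw [← derivative_restr, hF1, map_zero]
  have hA : restr a (pderiv 2 f) + τ * restr a (pderiv 1 f) + τ ^ 2 * P = 0 := by
    rw [← hF1, dirDeriv, hP]
    simp only [map_add, map_mul, map_pow, hC]
  have Wf : W f = 0 := by
    simp only [hW, ← hP]
    rw [← hP] at hQ
    linear_combination P ^ 2 * hA - (- P * Q) * hQ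
  have hd : ∀ i, restr a (pderiv i (dirDeriv a.t f)) = (restr a (pderiv i f)).derivative := by
    intro i
    rw [pderiv_dirDeriv, derivative_restr]
  have hdd : ∀ i, restr a (pderiv i (dirDeriv a.t (dirDeriv a.t f))) =
      (restr a (pderiv i f)).derivative.derivative := by
    intro i
    rw [pderiv_dirDeriv, ← derivative_restr, hd]
  have hA' := congrArg Polynomial.derivative hA
  have hA'' := congrArg Polynomial.derivative hA'
  have hQ' := congrArg Polynomial.derivative hQ
  have hQ'' := congrArg Polynomial.derivative hQ'
  simp only [← hP, map_add, Polynomial.derivative_mul, Polynomial.derivative_pow, hC', map_zero,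
    Polynomial.derivative_ofNat, mul_zero, zero_mul, zero_add, add_zero] at hA' hA'' hQ' hQ''
  have WF1 : W (dirDeriv a.t f) = Q * (Q * P.derivative - P * Q.derivative) := by
    simp only [hW, hd, ← hP]
    linear_combination P ^ 2 * hA' + P * Q * hQ'
  have WF2 : W (dirDeriv a.t (dirDeriv a.t f)) =
      Q * (Q * P.derivative.derivative - P * Q.derivative.derivative) := by
    simp only [hW, hdd, ← hP]
    linear_combination P ^ 2 * hA'' + P * Q * hQ''
  obtain ⟨h, hh⟩ : f ∣ C a.t * pseudoRem₁ f + pseudoRem₀ f :=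
    dvd_add (dvd_mul_of_dvd_right h₁ _) h₀
  have hS : P ^ 3 * W (dirDeriv a.t (dirDeriv a.t f)) =
      restr a (pseudoQuot f (C a.t)) * W (dirDeriv a.t f) := by
    have h5 := congrArg W (pseudo_division a.t f)
    rw [add_assoc, hh, Wadd, Wmul, Wmul, Wmul, Wf, ha, hF1, hF2, map_pow, ← hP] at h5
    linear_combination h5
  have hrem : restr a (pseudoRem₁ f) = 0 := by
    obtain ⟨g, hg⟩ := h₁
    rw [hg, map_mul, ha, zero_mul]
  have hPd : P.derivative = restr a (pderiv 0 (pderiv 2 f)) + τ * restr a (pderiv 0 (pderiv 1 f)) +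
      τ ^ 2 * restr a (pderiv 0 (pderiv 0 f)) := by
    rw [hP, ← hd, pderiv_dirDeriv, dirDeriv, pderiv_comm 2 0, pderiv_comm 1 0]
    simp only [map_add, map_mul, map_pow, hC]
  have hBd : (restr a (pderiv 1 f)).derivative = restr a (pderiv 1 (pderiv 2 f)) +
      τ * restr a (pderiv 1 (pderiv 1 f)) + τ ^ 2 * restr a (pderiv 0 (pderiv 1 f)) := by
    rw [← hd, pderiv_dirDeriv, dirDeriv, pderiv_comm 2 1]
    simp only [map_add, map_mul, map_pow, hC]
  have hq : Q * restr a (pseudoQuot f (C a.t)) = P ^ 3 * (2 * Q.derivative) := by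
    rw [pseudoRem₁] at hrem
    rw [pseudoQuot, hQ', hBd, hPd, hQ]
    simp only [map_add, map_sub, map_mul, map_pow, hC, ← hP, map_ofNat] at hrem ⊢
    linear_combination -(2 * (P ^ 2 * restr a (pderiv 0 (pderiv 0 f))) * τ +
      (P ^ 2 * (2 * restr a (pderiv 0 (pderiv 1 f))) -
        P * restr a (pderiv 1 f) * restr a (pderiv 0 (pderiv 0 f)))) * hA - hrem
  have hPQ : P ^ 3 * Q ≠ 0 := mul_ne_zero (pow_ne_zero 3 hP0) hQ0
  apply mul_left_cancel₀ hPQ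
  rw [WF1, WF2] at hS
  linear_combination Q * hS + Q * (Q * P.derivative - P * Q.derivative) * hq

theorem natDegree_eq_of_derivative_mul_eq {p : ℕ} [CharP K p] {N M : Polynomial K} (hN : N ≠ 0)
    (hM : M ≠ 0) (hNp : N.natDegree < p) (hMp : M.natDegree < p)
    (h : N.derivative * M = N * M.derivative) : N.natDegree = M.natDegree := by
  have hc : ∀ (F : Polynomial K) (i : ℕ), (Polynomial.X * F.derivative).coeff i = i * F.coeff i := by
    intro F i
    cases i with
    | zero => simp
    | succ i =>
      rw [Polynomial.coeff_X_mul, Polynomial.coeff_derivative]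
      push_cast
      ring
  have hd : ∀ F : Polynomial K, (Polynomial.X * F.derivative).natDegree ≤ F.natDegree := by
    intro F
    rw [Polynomial.natDegree_le_iff_coeff_eq_zero]
    intro i hi
    rw [hc, Polynomial.coeff_eq_zero_of_natDegree_lt hi, mul_zero]
  have h1 : Polynomial.X * N.derivative * M = N * (Polynomial.X * M.derivative) := by
    linear_combination Polynomial.X * h
  have h2 := congrArg (fun F => F.coeff (N.natDegree + M.natDegree)) h1
  rw [Polynomial.coeff_mul_add_eq_of_natDegree_le (hd N) le_rfl,
    Polynomial.coeff_mul_add_eq_of_natDegree_le le_rfl (hd M), hc, hc] at h2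
  have h3 : ((N.natDegree : K) - M.natDegree) * (N.leadingCoeff * M.leadingCoeff) = 0 := by
    simp only [Polynomial.leadingCoeff]
    linear_combination h2
  have h4 : (N.natDegree : K) = M.natDegree := by
    rw [← sub_eq_zero]
    refine (mul_eq_zero.1 h3).resolve_right (mul_ne_zero ?_ ?_) <;> simpa
  rw [CharP.natCast_eq_natCast K p] at h4
  exact h4.eq_of_lt_of_lt hNp hMp

theorem exists_eq_C_mul_of_derivative_mul_eq {p : ℕ} [CharP K p] {N M : Polynomial K} (hM : M ≠ 0)
    (hNp : N.natDegree < p) (hMp : M.natDegree < p)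
    (h : N.derivative * M = N * M.derivative) : ∃ c, N = Polynomial.C c * M := by
  by_cases hN : N = 0
  · exact ⟨0, by simp [hN]⟩
  have hdeg := natDegree_eq_of_derivative_mul_eq hN hM hNp hMp h
  set c := N.leadingCoeff / M.leadingCoeff with hc
  have hlc : M.leadingCoeff ≠ 0 := by simpa
  have hco : (N - Polynomial.C c * M).coeff M.natDegree = 0 := by
    rw [Polynomial.coeff_sub, Polynomial.coeff_C_mul, Polynomial.coeff_natDegree, ← hdeg,
      Polynomial.coeff_natDegree, hc, div_mul_cancel₀ _ hlc, sub_self]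
  refine ⟨c, ?_⟩
  by_contra hne
  have hne' : N - Polynomial.C c * M ≠ 0 := sub_ne_zero.2 hne
  have hle : (N - Polynomial.C c * M).natDegree ≤ M.natDegree :=
    (Polynomial.natDegree_sub_le _ _).trans
      (max_le hdeg.le (Polynomial.natDegree_C_mul_le _ _))
  have := natDegree_eq_of_derivative_mul_eq (N := N - Polynomial.C c * M) hne' hM
    (hle.trans_lt hMp) hMp (by
      simp only [Polynomial.derivative_sub, Polynomial.derivative_C_mul]
      linear_combination h)
  rw [← this, Polynomial.coeff_natDegree, Polynomial.leadingCoeff_eq_zero] at hco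
  exact hne' hco

theorem exists_eq_linear_mul {p D : ℕ} [CharP K p] {P Q : Polynomial K} (hQ : Q ≠ 0)
    (hPD : P.natDegree ≤ D) (hQD : Q.natDegree ≤ D) (hD : 2 * D < p) (hD' : D + 1 < p)
    (h : Q * (Q * P.derivative.derivative - P * Q.derivative.derivative) =
      2 * Q.derivative * (Q * P.derivative - P * Q.derivative)) :
    ∃ c β, P = (Polynomial.C c * Polynomial.X + Polynomial.C β) * Q := by
  have hPd : P.derivative.natDegree ≤ D :=
    (Polynomial.natDegree_derivative_le P).trans (by omega)
  have hQd : Q.derivative.natDegree ≤ D :=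
    (Polynomial.natDegree_derivative_le Q).trans (by omega)
  obtain ⟨c, hc⟩ := exists_eq_C_mul_of_derivative_mul_eq (p := p)
    (N := Q * P.derivative - P * Q.derivative) (M := Q ^ 2) (pow_ne_zero 2 hQ)
    (((Polynomial.natDegree_sub_le _ _).trans (max_le
      (Polynomial.natDegree_mul_le_of_le hQD hPd) (Polynomial.natDegree_mul_le_of_le hPD hQd))).trans_lt
      (by omega))
    ((Polynomial.natDegree_pow_le_of_le 2 hQD).trans_lt (by omega)) (by
      simp only [Polynomial.derivative_sub, Polynomial.derivative_mul, Polynomial.derivative_pow,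
        Nat.cast_ofNat, map_ofNat, Nat.add_one_sub_one, pow_one]
      linear_combination Q * h)
  obtain ⟨β, hβ⟩ := exists_eq_C_mul_of_derivative_mul_eq (p := p)
    (N := P - Polynomial.C c * (Polynomial.X * Q)) (M := Q) hQ
    (((Polynomial.natDegree_sub_le _ _).trans (max_le (hPD.trans (Nat.le_add_left D 1))
      ((Polynomial.natDegree_C_mul_le _ _).trans
        (Polynomial.natDegree_mul_le_of_le Polynomial.natDegree_X_le hQD)))).trans_lt
      (by omega)) (by omega) (by
      simp only [Polynomial.derivative_sub, Polynomial.derivative_mul, Polynomial.derivative_C,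
        Polynomial.derivative_X]
      linear_combination hc)
  exact ⟨c, β, by linear_combination hβ⟩

/-- Two transversal skew families without a large complete configuration. -/
structure SkewPair (k : ℕ) (A B : Finset (Ray K)) : Prop where
  left : SkewFamily A
  right : SkewFamily B
  transversal : ∀ a ∈ A, ∀ b ∈ B, a.t ≠ b.t
  complete : ∀ A₀ ⊆ A, ∀ B₀ ⊆ B, (∀ a ∈ A₀, ∀ b ∈ B₀, a.Meets b) → 2 ≤ #A₀ → 2 ≤ #B₀ →
    #A₀ < k ∨ #B₀ < k

theorem SkewPair.mono {k : ℕ} {A B A' B' : Finset (Ray K)} (h : SkewPair k A B) (hA : A' ⊆ A)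
    (hB : B' ⊆ B) : SkewPair k A' B' where
  left := h.left.mono hA
  right := h.right.mono hB
  transversal a ha b hb := h.transversal a (hA ha) b (hB hb)
  complete A₀ hA₀ B₀ hB₀ := h.complete A₀ (hA₀.trans hA) B₀ (hB₀.trans hB)

theorem SkewFamily.eq_of_t_eq {A : Finset (Ray K)} (h : SkewFamily A) :
    ∀ a ∈ A, ∀ a' ∈ A, a.t = a'.t → a = a' := by
  intro a ha a' ha' ht
  by_contra hne
  exact (h a ha a' ha' hne).1 ht

theorem meetPoint_comm (a b : Ray K) : meetPoint a b = meetPoint b a := by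
  rw [meetPoint, meetPoint, ← neg_sub b.b, ← neg_sub b.t, div_neg, neg_neg, neg_div]

open scoped Classical in
theorem SkewFamily.card_filter_meets_le {A : Finset (Ray K)} (hA : SkewFamily A) {b : Ray K}
    (ht : ∀ a ∈ A, a.t ≠ b.t) {g : MvPolynomial (Fin 3) K} (hg : restr b g ≠ 0)
    (h0 : ∀ a ∈ A, a.Meets b → (restr b g).eval (meetPoint a b) = 0) :
    #{a ∈ A | a.Meets b} ≤ g.totalDegree := by
  refine (card_meets_le (hA.mono (filter_subset _ _)) (b := b) ?_ ?_ hg ?_).trans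
    (natDegree_restr_le b g)
  · exact fun a ha => ht a (mem_filter.1 ha).1
  · exact fun a ha => (mem_filter.1 ha).2
  · exact fun a ha => h0 a (mem_filter.1 ha).1 (mem_filter.1 ha).2

open scoped Classical in
theorem SkewPair.card_filter_meets_left_le {k : ℕ} {A B : Finset (Ray K)} (h : SkewPair k A B)
    {b : Ray K} (hb : b ∈ B) {g : MvPolynomial (Fin 3) K} (hg : restr b g ≠ 0)
    (h0 : ∀ a ∈ A, a.Meets b → (restr b g).eval (meetPoint a b) = 0) :
    #{a ∈ A | a.Meets b} ≤ g.totalDegree :=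
  h.left.card_filter_meets_le (fun a ha => h.transversal a ha b hb) hg h0

open scoped Classical in
theorem SkewPair.card_filter_meets_right_le {k : ℕ} {A B : Finset (Ray K)} (h : SkewPair k A B)
    {a : Ray K} (ha : a ∈ A) {g : MvPolynomial (Fin 3) K} (hg : restr a g ≠ 0)
    (h0 : ∀ b ∈ B, a.Meets b → (restr a g).eval (meetPoint a b) = 0) :
    #{b ∈ B | a.Meets b} ≤ g.totalDegree := by
  have := h.right.card_filter_meets_le (fun b hb => (h.transversal a ha b hb).symm) hg
    (fun b hb hm => by rw [meetPoint_comm]; exact h0 b hb hm.symm)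
  rwa [filter_congr fun b _ => (⟨Ray.Meets.symm, Ray.Meets.symm⟩ : a.Meets b ↔ b.Meets a)]

open scoped Classical in
/-- A ray off the surface `g = 0` meets few of the rays on that surface. -/
theorem SkewPair.card_filter_meets_left_le_of_restr {k : ℕ} {A B : Finset (Ray K)}
    (h : SkewPair k A B) {g : MvPolynomial (Fin 3) K} (hA : ∀ a ∈ A, restr a g = 0)
    {b : Ray K} (hb : b ∈ B) (hg : restr b g ≠ 0) : #{a ∈ A | a.Meets b} ≤ g.totalDegree :=
  h.card_filter_meets_left_le hb hg fun a ha hm => by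
    rw [← eval_restr_meetPoint hm (h.transversal a ha b hb), hA a ha, Polynomial.eval_zero]

open scoped Classical in
theorem SkewPair.card_filter_meets_right_le_of_restr {k : ℕ} {A B : Finset (Ray K)}
    (h : SkewPair k A B) {g : MvPolynomial (Fin 3) K} (hB : ∀ b ∈ B, restr b g = 0)
    {a : Ray K} (ha : a ∈ A) (hg : restr a g ≠ 0) : #{b ∈ B | a.Meets b} ≤ g.totalDegree :=
  h.card_filter_meets_right_le ha hg fun b hb hm => by
    rw [eval_restr_meetPoint hm (h.transversal a ha b hb), hB b hb, Polynomial.eval_zero]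

/-- The quadric swept out by the rays that meet `a` and satisfy a linear condition. -/
noncomputable def rayQuadric (a : Ray K) (c β : K) : MvPolynomial (Fin 3) K :=
  (C c * (X 1 - C a.b - C a.t * X 2) - 1) * (X 1 - C a.b - C a.t * X 2) +
    (C (2 * a.t) * (X 1 - C a.b - C a.t * X 2) -
      (X 0 - C (a.e + a.b * a.t) - C (a.t ^ 2) * X 2)) * (C c * X 2 + C β)

theorem totalDegree_rayQuadric_le (a : Ray K) (c β : K) : (rayQuadric a c β).totalDegree ≤ 2 := by
  have hX : ∀ i : Fin 3, (X i : MvPolynomial (Fin 3) K).totalDegree ≤ 1 := fun i =>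
    (totalDegree_X i).le
  have hCl : ∀ r : K, (C r : MvPolynomial (Fin 3) K).totalDegree ≤ 1 := fun r => by simp
  have hCX : ∀ (r : K) (i : Fin 3), (C r * X i : MvPolynomial (Fin 3) K).totalDegree ≤ 1 :=
    fun r i => totalDegree_mul_le_of_le (m := 0) (by simp) (hX i) le_rfl
  have hy : (X 1 - C a.b - C a.t * X 2 : MvPolynomial (Fin 3) K).totalDegree ≤ 1 :=
    totalDegree_sub_le_of_le (totalDegree_sub_le_of_le (hX 1) (hCl _)) (hCX _ _)
  have hz : (X 0 - C (a.e + a.b * a.t) - C (a.t ^ 2) * X 2 :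
      MvPolynomial (Fin 3) K).totalDegree ≤ 1 :=
    totalDegree_sub_le_of_le (totalDegree_sub_le_of_le (hX 0) (hCl _)) (hCX _ _)
  have hC : ∀ (r : K) {q : MvPolynomial (Fin 3) K}, q.totalDegree ≤ 1 →
      (C r * q).totalDegree ≤ 1 :=
    fun r q hq => totalDegree_mul_le_of_le (m := 0) (by simp) hq le_rfl
  refine totalDegree_add_le_of_le ?_ ?_
  · exact totalDegree_mul_le_of_le (totalDegree_sub_le_of_le (hC _ hy) (by simp)) hy le_rfl
  · exact totalDegree_mul_le_of_le (totalDegree_sub_le_of_le (hC _ hy) hz)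
      (totalDegree_add_le_of_le (hCX _ _) (hCl _)) le_rfl

theorem restr_rayQuadric (a b : Ray K) (c β : K) :
    restr b (rayQuadric a c β) =
      Polynomial.C ((b.t - a.t) * (2 * c * (b.b - a.b) - 1 - (b.t - a.t) * β) +
        c * (2 * a.t * (b.b - a.b) - (b.e + b.b * b.t - a.e - a.b * a.t))) * Polynomial.X +
      Polynomial.C ((c * (b.b - a.b) - 1) * (b.b - a.b) +
        β * (2 * a.t * (b.b - a.b) - (b.e + b.b * b.t - a.e - a.b * a.t))) := by
  simp only [rayQuadric, restr, map_add, map_sub, map_mul, map_pow, map_one, map_ofNat, aeval_C,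
    aeval_X, Polynomial.algebraMap_eq, Matrix.cons_val]
  ring

theorem restr_rayQuadric_eq_zero {a b : Ray K} {c β : K} (h : a.Meets b)
    (hc : c * (b.b - a.b) + β * (a.t - b.t) = 1) : restr b (rayQuadric a c β) = 0 := by
  unfold Ray.Meets at h
  have hγ : b.e + b.b * b.t - a.e - a.b * a.t = (a.t + b.t) * (b.b - a.b) := by
    linear_combination -h
  rw [restr_rayQuadric, hγ]
  have h1 : (b.t - a.t) * (2 * c * (b.b - a.b) - 1 - (b.t - a.t) * β) +
      c * (2 * a.t * (b.b - a.b) - (a.t + b.t) * (b.b - a.b)) = 0 := by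
    linear_combination (b.t - a.t) * hc
  have h2 : (c * (b.b - a.b) - 1) * (b.b - a.b) +
      β * (2 * a.t * (b.b - a.b) - (a.t + b.t) * (b.b - a.b)) = 0 := by
    linear_combination (b.b - a.b) * hc
  rw [h1, h2]
  simp

/-- Rays of the quadric that do not meet `a` form an affine family. -/
theorem affine_of_restr_rayQuadric_eq_zero {a b : Ray K} {c β : K} (ht : b.t ≠ a.t)
    (hm : ¬ a.Meets b) (h : restr b (rayQuadric a c β) = 0) :
    b.b = a.b + β / c * (b.t - a.t) ∧
      b.e = a.e + (a.t * (β / c) - 1 / c - a.b) * (b.t - a.t) := by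
  rw [restr_rayQuadric] at h
  have h1 := congrArg (fun F => F.coeff 1) h
  have h2 := congrArg (fun F => F.coeff 0) h
  simp only [Polynomial.coeff_add, Polynomial.coeff_C_mul, Polynomial.coeff_X_one, mul_one,
    Polynomial.coeff_C_succ, add_zero, Polynomial.coeff_zero, Polynomial.coeff_C_zero,
    Polynomial.coeff_X_zero, mul_zero, zero_add] at h1 h2
  set s := b.t - a.t with hs
  set β₁ := b.b - a.b with hβ₁
  set g := 2 * a.t * β₁ - (b.e + b.b * b.t - a.e - a.b * a.t) with hg
  have hs0 : s ≠ 0 := sub_ne_zero.2 ht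
  have hXY : (c * β₁ - s * β) * (c * β₁ - s * β - 1) = 0 := by
    linear_combination c * h2 - β * h1
  have hne : c * β₁ - s * β - 1 ≠ 0 := by
    intro h3
    have h4 : c * (s * β₁ + g) = 0 := by linear_combination h1 - s * h3
    have h5 : β * (s * β₁ + g) = 0 := by linear_combination h2 - β₁ * h3
    rcases mul_eq_zero.1 h4 with hc | h6
    · rcases mul_eq_zero.1 h5 with hβ | h6
      · rw [hc, hβ] at h3
        simp at h3
      · apply hm
        unfold Ray.Meets
        linear_combination h6
    · apply hm
      unfold Ray.Meets
      linear_combination h6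
  have hX := (mul_eq_zero.1 hXY).resolve_right hne
  have hc : c ≠ 0 := by
    rintro rfl
    apply hs0
    linear_combination (-1 : K) * h1 + s * hX
  have hb : β₁ = β / c * s := by
    field_simp
    linear_combination hX
  refine ⟨by linear_combination hb, ?_⟩
  have hgc : g = (1 / c - s * β / c) * s := by
    field_simp
    linear_combination h1 - 2 * s * hX
  have : b.e - a.e = 2 * a.t * β₁ - g - (a.b + β₁) * (a.t + s) + a.b * a.t := by
    rw [hg, hβ₁, hs]
    ring
  rw [hgc, hb] at this
  linear_combination this

/-- On a flecnodal surface, a ray with many neighbours spans a quadric containing the surface. -/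
theorem card_meets_le_or_dvd_rayQuadric {p k : ℕ} [CharP K p] {f : MvPolynomial (Fin 3) K}
    (hf : Irreducible f) (hp : 2 * f.totalDegree < p) (hd0 : f.totalDegree ≠ 0)
    (h₁ : f ∣ pseudoRem₁ f) (h₀ : f ∣ pseudoRem₀ f) {A B : Finset (Ray K)} (h : SkewPair k A B)
    {a : Ray K} (ha : a ∈ A) (haf : restr a f = 0) (hBf : ∀ b ∈ B, restr b f = 0)
    (hP0 : restr a (pderiv 0 f) ≠ 0) :
    (open scoped Classical in #{b ∈ B | a.Meets b} ≤ 5 * f.totalDegree) ∨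
      ∃ c β, f ∣ rayQuadric a c β := by
  classical
  set d := f.totalDegree with hd
  have hdeg : ∀ i, (pderiv i f).totalDegree ≤ d - 1 := by
    intro i
    by_cases h0 : pderiv i f = 0
    · simp [h0]
    · have := totalDegree_pderiv_add_one_le i h0
      omega
  set P := restr a (pderiv 0 f) with hP
  set Q := restr a (pderiv 1 f + C (2 * a.t) * pderiv 0 f) with hQ
  have hQ' : Q = restr a (pderiv 1 f) + 2 * Polynomial.C a.t * restr a (pderiv 0 f) := by
    rw [hQ, map_add, map_mul, restr, aeval_C]
    simp only [Polynomial.algebraMap_eq, map_mul, map_ofNat]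
  have hPd : P.natDegree ≤ d - 1 := (natDegree_restr_le a _).trans (hdeg 0)
  have hQd : Q.natDegree ≤ d - 1 := (natDegree_restr_le a _).trans
    (totalDegree_add_le_of_le (hdeg 1) (totalDegree_mul_le_of_le (totalDegree_C _).le (hdeg 0)
      (by omega)))
  have hF1 : ∀ b, restr b f = 0 → restr b (pderiv 2 f) + Polynomial.C b.t * restr b (pderiv 1 f) +
      Polynomial.C b.t ^ 2 * restr b (pderiv 0 f) = 0 := by
    intro b hb
    have : restr b (dirDeriv b.t f) = 0 := by rw [← derivative_restr, hb, map_zero]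
    rw [← this, dirDeriv]
    have hC : restr b (C b.t) = Polynomial.C b.t := by simp [restr]
    simp only [map_add, map_mul, map_pow, hC]
  have hPQ : ∀ b ∈ B, a.Meets b →
      Q.eval (meetPoint a b) = P.eval (meetPoint a b) * (a.t - b.t) := by
    intro b hb hm
    have ht := h.transversal a ha b hb
    have ea := congrArg (Polynomial.eval (meetPoint a b)) (hF1 a haf)
    have eb := congrArg (Polynomial.eval (meetPoint a b)) (hF1 b (hBf b hb))
    simp only [Polynomial.eval_add, Polynomial.eval_mul, Polynomial.eval_C, Polynomial.eval_pow,
      Polynomial.eval_zero, ← eval_restr_meetPoint hm ht] at ea eb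
    rw [hQ', hP]
    simp only [Polynomial.eval_add, Polynomial.eval_mul, Polynomial.eval_C,
      Polynomial.eval_ofNat]
    apply mul_left_cancel₀ (sub_ne_zero.2 ht)
    linear_combination ea - eb
  have hzeros : #{b ∈ {b ∈ B | P.eval (meetPoint a b) = 0} | a.Meets b} ≤ d := by
    refine ((h.mono subset_rfl (filter_subset _ B)).card_filter_meets_right_le ha hP0
      fun b hb _ => (mem_filter.1 hb).2).trans ?_
    have := hdeg 0
    omega
  by_cases hQ0 : Q = 0
  · left
    refine le_trans (card_le_card fun b hb => ?_) (hzeros.trans (by omega))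
    rw [mem_filter] at hb ⊢
    refine ⟨mem_filter.2 ⟨hb.1, ?_⟩, hb.2⟩
    have := hPQ b hb.1 hb.2
    rw [hQ0, Polynomial.eval_zero, eq_comm, mul_eq_zero] at this
    exact this.resolve_right (sub_ne_zero.2 (h.transversal a ha b hb.1))
  obtain ⟨c, β, hcβ⟩ := exists_eq_linear_mul (p := p) (D := d - 1) hQ0 hPd hQd (by omega) (by omega)
    (differential_relation haf h₁ h₀ hP hQ' hP0 hQ0)
  by_cases hdvd : f ∣ rayQuadric a c β
  · exact Or.inr ⟨c, β, hdvd⟩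
  left
  have hsub : {b ∈ B | a.Meets b} ⊆
      {b ∈ {b ∈ B | P.eval (meetPoint a b) = 0} | a.Meets b} ∪
        {b ∈ B | restr b (rayQuadric a c β) = 0} := by
    intro b hb
    rw [mem_filter] at hb
    rw [mem_union, mem_filter, mem_filter, mem_filter]
    by_cases h0 : P.eval (meetPoint a b) = 0
    · exact Or.inl ⟨⟨hb.1, h0⟩, hb.2⟩
    refine Or.inr ⟨hb.1, restr_rayQuadric_eq_zero hb.2 ?_⟩
    have e1 := hPQ b hb.1 hb.2
    have e2 := congrArg (Polynomial.eval (meetPoint a b)) hcβ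
    simp only [Polynomial.eval_mul, Polynomial.eval_add, Polynomial.eval_C,
      Polynomial.eval_X] at e2
    have e3 : meetPoint a b * (a.t - b.t) = b.b - a.b := by
      rw [meetPoint, div_mul_cancel₀ _ (sub_ne_zero.2 (h.transversal a ha b hb.1))]
      ring
    apply mul_left_cancel₀ h0
    linear_combination (-(c * meetPoint a b + β)) * e1 - e2 -
      P.eval (meetPoint a b) * c * e3
  have hbez : #{b ∈ B | restr b (rayQuadric a c β) = 0} ≤ 4 * d := by
    have := card_le_of_irreducible_of_not_dvd hf hdvd
      (h.right.mono (filter_subset (fun b => restr b (rayQuadric a c β) = 0) B)).eq_of_t_eq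
      (fun b hb => hBf b (mem_filter.1 hb).1) (fun b hb => (mem_filter.1 hb).2)
    refine this.trans ?_
    have h2 := totalDegree_rayQuadric_le a c β
    calc 2 * f.totalDegree * (rayQuadric a c β).totalDegree ≤ 2 * d * 2 :=
          Nat.mul_le_mul_left _ h2
      _ = 4 * d := by ring
  calc _ ≤ _ := card_le_card hsub
    _ ≤ _ := card_union_le _ _
    _ ≤ d + 4 * d := add_le_add hzeros hbez
    _ = 5 * d := by ring

/-- An affine family has few incidences with any other family. -/
theorem SkewPair.incCount_le_of_affine {k : ℕ} {A B : Finset (Ray K)} (h : SkewPair k A B)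
    {a : Ray K} {m n : K} (hb : ∀ a' ∈ A, a'.b = a.b + m * (a'.t - a.t))
    (he : ∀ a' ∈ A, a'.e = a.e + n * (a'.t - a.t)) :
    incCount Ray.Meets A B ≤ #B + (k + 1) * (#A + #B) := by
  classical
  have hall : ∀ b ∈ B, 1 < #{a ∈ A | a.Meets b} → ∀ a' ∈ A, a'.Meets b := by
    intro b _ h1 a' ha'
    obtain ⟨a₁, h₁, a₂, h₂, hne⟩ := one_lt_card.1 h1
    rw [mem_filter] at h₁ h₂
    have ht : a₁.t - a₂.t ≠ 0 := sub_ne_zero.2 (h.left a₁ h₁.1 a₂ h₂.1 hne).1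
    have m₁ := h₁.2
    have m₂ := h₂.2
    unfold Ray.Meets at *
    rw [hb _ h₁.1, he _ h₁.1] at m₁
    rw [hb _ h₂.1, he _ h₂.1] at m₂
    rw [hb _ ha', he _ ha']
    have hs : n - m * b.t + b.b = 0 := by
      apply mul_left_cancel₀ ht
      linear_combination m₁ - m₂
    linear_combination m₁ + (a'.t - a₁.t) * hs
  set B₂ := {b ∈ B | 1 < #{a ∈ A | a.Meets b}} with hB₂
  have hB₂B : B₂ ⊆ B := filter_subset _ _
  have h0 := incCount_filter_right (r := Ray.Meets) (fun b => 1 < #{a ∈ A | a.Meets b}) A B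
  rw [← hB₂] at h0
  have h1 : incCount Ray.Meets A {b ∈ B | ¬ 1 < #{a ∈ A | a.Meets b}} ≤ #B := by
    refine (incCount_le_mul_of_right (N := 1) fun b hb => not_lt.1 (mem_filter.1 hb).2).trans ?_
    rw [mul_one]
    exact card_filter_le _ _
  have h2 : incCount Ray.Meets A B₂ ≤ (k + 1) * (#A + #B) := by
    have hle := incCount_le_mul (r := Ray.Meets) A B₂
    have hcard := card_le_card hB₂B
    by_cases h3 : 2 ≤ #B₂
    · have h4 : 2 ≤ #A := by
        obtain ⟨b, hb⟩ : B₂.Nonempty := card_pos.1 (by omega)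
        have := (mem_filter.1 hb).2
        exact Nat.succ_le_of_lt (this.trans_le (card_filter_le _ _))
      rcases h.complete A subset_rfl B₂ hB₂B
        (fun a ha b hb => hall b (hB₂B hb) (mem_filter.1 hb).2 a ha) h4 h3 with h5 | h5
      · calc _ ≤ #A * #B₂ := hle
          _ ≤ (k + 1) * (#A + #B) := Nat.mul_le_mul (by omega) (by omega)
      · calc _ ≤ #A * #B₂ := hle
          _ = #B₂ * #A := mul_comm _ _
          _ ≤ (k + 1) * (#A + #B) := Nat.mul_le_mul (by omega) (by omega)
    · calc _ ≤ #A * #B₂ := hle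
        _ = #B₂ * #A := mul_comm _ _
        _ ≤ (k + 1) * (#A + #B) := Nat.mul_le_mul (by omega) (by omega)
  omega

open scoped Classical in
/-- Two families of rays on an irreducible surface have few incidences, apart from those within
small subfamilies, if a polynomial `ρ` not vanishing on the surface controls the meeting points. -/
theorem SkewPair.incCount_le_of_not_dvd {k : ℕ} {A B : Finset (Ray K)} (h : SkewPair k A B)
    {f ρ : MvPolynomial (Fin 3) K} (hf : Irreducible f) (hfρ : ¬ f ∣ ρ) {D N : ℕ}
    (hD : 2 * f.totalDegree * ρ.totalDegree ≤ D)
    (hA : ∀ a ∈ A, restr a f = 0) (hB : ∀ b ∈ B, restr b f = 0)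
    (hl : ∀ a ∈ A, restr a ρ ≠ 0 → #{b ∈ B | a.Meets b} ≤ N)
    (hr : ∀ b ∈ B, restr b ρ ≠ 0 → #{a ∈ A | a.Meets b ∧ restr a ρ = 0} ≤ N) :
    ∃ A' ⊆ A, ∃ B' ⊆ B, #A' ≤ D ∧ #B' ≤ D ∧
      incCount Ray.Meets A B ≤ N * (#A + #B) + incCount Ray.Meets A' B' := by
  classical
  refine ⟨{a ∈ A | restr a ρ = 0}, filter_subset _ _, {b ∈ B | restr b ρ = 0}, filter_subset _ _,
    (card_le_of_irreducible_of_not_dvd hf hfρ (h.left.mono (filter_subset _ _)).eq_of_t_eq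
      (fun a ha => hA a (mem_filter.1 ha).1) fun a ha => (mem_filter.1 ha).2).trans hD,
    (card_le_of_irreducible_of_not_dvd hf hfρ (h.right.mono (filter_subset _ _)).eq_of_t_eq
      (fun a ha => hB a (mem_filter.1 ha).1) fun a ha => (mem_filter.1 ha).2).trans hD, ?_⟩
  have h1 := incCount_filter_left (r := Ray.Meets) (fun a => restr a ρ = 0) A B
  have h2 := incCount_filter_right (r := Ray.Meets) (fun b => restr b ρ = 0)
    {a ∈ A | restr a ρ = 0} B
  have h3 : incCount Ray.Meets {a ∈ A | ¬ restr a ρ = 0} B ≤ #A * N := by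
    refine (incCount_le_mul_of_left (N := N) fun a ha => ?_).trans
      (Nat.mul_le_mul_right _ (card_filter_le _ _))
    convert hl a (mem_filter.1 ha).1 (mem_filter.1 ha).2
  have h4 : incCount Ray.Meets {a ∈ A | restr a ρ = 0} {b ∈ B | ¬ restr b ρ = 0} ≤ #B * N := by
    refine (incCount_le_mul_of_right (N := N) fun b hb => ?_).trans
      (Nat.mul_le_mul_right _ (card_filter_le _ _))
    refine le_trans (le_of_eq ?_) (hr b (mem_filter.1 hb).1 (mem_filter.1 hb).2)
    rw [filter_filter]
    congr 1
    ext
    simp [and_comm]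
  linarith [mul_add N #A #B, mul_comm N #A, mul_comm N #B]

theorem degreeOf_eq_zero_of_pderiv_eq_zero {σ : Type*} {p : ℕ} [CharP K p] {i : σ}
    {f : MvPolynomial σ K} (hf : f.totalDegree < p) (h : pderiv i f = 0) : degreeOf i f = 0 := by
  classical
  by_contra hne
  obtain ⟨m, hm, hmi⟩ : ∃ m ∈ f.support, m i ≠ 0 := by
    by_contra! hall
    exact hne (Nat.le_zero.1 (degreeOf_le_iff.2 fun m hm => (hall m hm).le))
  have hle : m i ≤ f.totalDegree := (monomial_le_degreeOf i hm).trans (degreeOf_le_totalDegree f i)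
  have hc := MvPolynomial.coeff_pderiv (R := K) (i := i) (p := f) (m := m - Finsupp.single i 1)
  have hms : m - Finsupp.single i 1 + Finsupp.single i 1 = m :=
    tsub_add_cancel_of_le (Finsupp.single_le_iff.2 (Nat.one_le_iff_ne_zero.2 hmi))
  rw [h, hms, coeff_zero, eq_comm, mul_eq_zero] at hc
  rcases hc with hc | hc
  · exact mem_support_iff.1 hm hc
  · have : ((m i : ℕ) : K) = 0 := by
      rw [← hc, ← DFunLike.congr_fun hms i]
      simp
    rw [CharP.cast_eq_zero_iff K p] at this
    exact absurd (Nat.le_of_dvd (Nat.pos_of_ne_zero hmi) this) (by omega)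

/-- Two families of rays on an irreducible surface of degree `d` have few incidences, apart from
those within subfamilies of size `O(d²)`. -/
theorem SkewPair.incCount_le_of_irreducible {p k : ℕ} [CharP K p] {A B : Finset (Ray K)}
    (h : SkewPair k A B) {f : MvPolynomial (Fin 3) K} (hf : Irreducible f)
    (hp : 2 * f.totalDegree < p) (hA : ∀ a ∈ A, restr a f = 0) (hB : ∀ b ∈ B, restr b f = 0) :
    ∃ A' ⊆ A, ∃ B' ⊆ B, #A' ≤ 8 * f.totalDegree ^ 2 ∧ #B' ≤ 8 * f.totalDegree ^ 2 ∧
      incCount Ray.Meets A B ≤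
        (5 * f.totalDegree + k + 2) * (#A + #B) + incCount Ray.Meets A' B' := by
  classical
  set d := f.totalDegree with hd
  have hd0 : d ≠ 0 := by
    intro h0
    rw [hd, totalDegree_eq_zero_iff_eq_C] at h0
    have hne : f.coeff 0 ≠ 0 := fun h00 => hf.ne_zero (by rw [h0, h00, C_0])
    exact hf.not_isUnit (by rw [h0]; exact (IsUnit.mk0 _ hne).map C)
  have hmul : ∀ x N : ℕ, N ≤ 5 * d + k + 2 →
      incCount Ray.Meets A B ≤ N * (#A + #B) + x →
      incCount Ray.Meets A B ≤ (5 * d + k + 2) * (#A + #B) + x := fun x N hN hx =>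
    hx.trans (Nat.add_le_add_right (Nat.mul_le_mul_right _ hN) _)
  have hcase : ∀ ρ : MvPolynomial (Fin 3) K, ¬ f ∣ ρ → ρ.totalDegree ≤ 4 * d →
      (∀ a b : Ray K, restr a f = 0 → restr b f = 0 → a.Meets b → a.t ≠ b.t →
        (restr a ρ).eval (meetPoint a b) = 0) →
      ∃ A' ⊆ A, ∃ B' ⊆ B, #A' ≤ 8 * d ^ 2 ∧ #B' ≤ 8 * d ^ 2 ∧
        incCount Ray.Meets A B ≤
          (5 * d + k + 2) * (#A + #B) + incCount Ray.Meets A' B' := by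
    intro ρ hρ hρd hev
    obtain ⟨A', hA', B', hB', h1, h2, h3⟩ := h.incCount_le_of_not_dvd hf hρ (D := 8 * d ^ 2)
      (N := 4 * d) (by rw [← hd]; nlinarith) hA hB
      (fun a ha hne => (h.card_filter_meets_right_le ha hne fun b hb hm =>
        hev a b (hA a ha) (hB b hb) hm (h.transversal a ha b hb)).trans hρd)
      (fun b hb hne => (card_le_card fun a ha => by
          rw [mem_filter] at ha ⊢; exact ⟨ha.1, ha.2.1⟩).trans
        ((h.card_filter_meets_left_le hb hne fun a ha hm => by
          rw [meetPoint_comm]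
          exact hev b a (hB b hb) (hA a ha) hm.symm (h.transversal a ha b hb).symm).trans hρd))
    exact ⟨A', hA', B', hB', h1, h2, hmul _ _ (by omega) h3⟩
  by_cases h₁ : f ∣ pseudoRem₁ f
  swap
  · exact hcase _ h₁ (totalDegree_pseudoRem_le f).1 fun a b ha hb hm ht =>
      (eval_restr_pseudoRem_eq_zero ha hb hm ht).1
  by_cases h₀ : f ∣ pseudoRem₀ f
  swap
  · exact hcase _ h₀ (totalDegree_pseudoRem_le f).2 fun a b ha hb hm ht =>
      (eval_restr_pseudoRem_eq_zero ha hb hm ht).2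
  by_cases hz : f ∣ pderiv 0 f
  · have hz0 : pderiv 0 f = 0 := by
      by_contra hne
      have := totalDegree_pderiv_add_one_le 0 hne
      obtain ⟨g, hg⟩ := hz
      have hg0 : g ≠ 0 := by rintro rfl; exact hne (by rw [hg, mul_zero])
      rw [hg, totalDegree_mul_of_isDomain hf.ne_zero hg0] at this
      omega
    have hAd : #A ≤ d := card_le_totalDegree_of_degreeOf_eq_zero hf.ne_zero
      (degreeOf_eq_zero_of_pderiv_eq_zero (p := p) (by omega) hz0) h.left.eq_of_t_eq hA
    refine ⟨∅, empty_subset _, ∅, empty_subset _, by simp, by simp, hmul _ d (by omega) ?_⟩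
    calc _ ≤ #A * #B := incCount_le_mul A B
      _ ≤ d * (#A + #B) := Nat.mul_le_mul hAd (by omega)
      _ ≤ _ := by omega
  by_cases hgood : ∀ a ∈ A, restr a (pderiv 0 f) ≠ 0 → #{b ∈ B | a.Meets b} ≤ 5 * d
  · obtain ⟨A', hA', B', hB', h1, h2, h3⟩ := h.incCount_le_of_not_dvd hf hz (D := 8 * d ^ 2)
      (N := 5 * d) (by have := totalDegree_pderiv_le 0 f; rw [← hd] at this ⊢; nlinarith) hA hB
      hgood (fun b hb hne => by
        have h4 := (h.mono (filter_subset (fun a => restr a (pderiv 0 f) = 0) A)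
          subset_rfl).card_filter_meets_left_le_of_restr
          (fun a ha => (mem_filter.1 ha).2) hb hne
        have h5 := totalDegree_pderiv_le 0 f
        rw [filter_filter] at h4
        calc _ = #{a ∈ A | restr a (pderiv 0 f) = 0 ∧ a.Meets b} := by
              congr 1; ext; simp [and_comm]
          _ ≤ _ := by omega)
    exact ⟨A', hA', B', hB', h1, h2, hmul _ _ (by omega) h3⟩
  · push Not at hgood
    obtain ⟨a, ha, hP0, hlt⟩ := hgood
    rcases card_meets_le_or_dvd_rayQuadric hf hp hd0 h₁ h₀ h ha (hA a ha) hB hP0 with h4 | h4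
    · exact absurd hlt (not_lt.2 (by convert h4))
    · obtain ⟨c, β, g, hg⟩ := h4
      have h5 : ∀ a' ∈ A, a'.b = a.b + β / c * (a'.t - a.t) ∧
          a'.e = a.e + (a.t * (β / c) - 1 / c - a.b) * (a'.t - a.t) := by
        intro a' ha'
        by_cases haa : a' = a
        · subst haa; simp
        · obtain ⟨ht, hm⟩ := h.left a ha a' ha' (Ne.symm haa)
          exact affine_of_restr_rayQuadric_eq_zero (Ne.symm ht) hm
            (by rw [hg, map_mul, hA a' ha', zero_mul])
      refine ⟨∅, empty_subset _, ∅, empty_subset _, by simp, by simp, hmul _ (k + 2) (by omega) ?_⟩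
      have h6 := h.incCount_le_of_affine (fun a' ha' => (h5 a' ha').1) fun a' ha' => (h5 a' ha').2
      linarith [add_mul (k + 1) 1 (#A + #B)]

/-- Two families of rays on a surface of degree `d` have few incidences, apart from those within
subfamilies of size `O(d²)`. -/
theorem SkewPair.incCount_le_of_restr_eq_zero {p k : ℕ} [CharP K p] {f : MvPolynomial (Fin 3) K}
    (hf : f ≠ 0) (hp : 2 * f.totalDegree < p) {A B : Finset (Ray K)} (h : SkewPair k A B)
    (hA : ∀ a ∈ A, restr a f = 0) (hB : ∀ b ∈ B, restr b f = 0) :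
    ∃ A' ⊆ A, ∃ B' ⊆ B, #A' ≤ 8 * f.totalDegree ^ 2 ∧ #B' ≤ 8 * f.totalDegree ^ 2 ∧
      incCount Ray.Meets A B ≤
        (5 * f.totalDegree + k + 2) * (#A + #B) + incCount Ray.Meets A' B' := by
  classical
  induction f using WfDvdMonoid.induction_on_irreducible generalizing A B with
  | zero => exact absurd rfl hf
  | unit u hu =>
    have hA0 : A = ∅ := eq_empty_of_forall_notMem fun a ha => (hu.map (restr a)).ne_zero (hA a ha)
    refine ⟨∅, empty_subset _, ∅, empty_subset _, by simp, by simp, ?_⟩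
    simp [hA0, incCount]
  | mul g q hg0 hq ih =>
    rw [totalDegree_mul_of_isDomain hq.ne_zero hg0] at hp ⊢
    set dq := q.totalDegree
    set dg := g.totalDegree
    set A₁ := {a ∈ A | restr a q = 0} with hA₁
    set A₂ := {a ∈ A | ¬ restr a q = 0} with hA₂
    set B₁ := {b ∈ B | restr b q = 0} with hB₁
    set B₂ := {b ∈ B | ¬ restr b q = 0} with hB₂
    have sA₁ : A₁ ⊆ A := filter_subset _ _
    have sA₂ : A₂ ⊆ A := filter_subset _ _
    have sB₁ : B₁ ⊆ B := filter_subset _ _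
    have sB₂ : B₂ ⊆ B := filter_subset _ _
    have cA : #A₁ + #A₂ = #A := card_filter_add_card_filter_not _
    have cB : #B₁ + #B₂ = #B := card_filter_add_card_filter_not _
    obtain ⟨A', hA', B', hB', h1, h2, h3⟩ :=
      (h.mono sA₁ sB₁).incCount_le_of_irreducible hq (p := p) (by omega)
        (fun a ha => (mem_filter.1 ha).2) (fun a ha => (mem_filter.1 ha).2)
    have hsnd : ∀ a, restr a (q * g) = 0 → ¬ restr a q = 0 → restr a g = 0 := fun a h0 hne => by
      rw [map_mul] at h0
      exact (mul_eq_zero.1 h0).resolve_left hne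
    obtain ⟨A'', hA'', B'', hB'', h4, h5, h6⟩ := ih hg0 (by omega) (h.mono sA₂ sB₂)
      (fun a ha => hsnd a (hA a (sA₂ ha)) (mem_filter.1 ha).2)
      (fun b hb => hsnd b (hB b (sB₂ hb)) (mem_filter.1 hb).2)
    have dA : Disjoint A₁ A₂ := disjoint_filter_filter_not _ _ _
    have dB : Disjoint B₁ B₂ := disjoint_filter_filter_not _ _ _
    have h12 : incCount Ray.Meets A₁ B₂ ≤ #B₂ * dq := incCount_le_mul_of_right fun b hb => by
      convert (h.mono sA₁ sB₂).card_filter_meets_left_le_of_restr (fun a ha => (mem_filter.1 ha).2)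
        hb (mem_filter.1 hb).2
    have h21 : incCount Ray.Meets A₂ B₁ ≤ #A₂ * dq := incCount_le_mul_of_left fun a ha => by
      convert (h.mono sA₂ sB₁).card_filter_meets_right_le_of_restr (fun b hb => (mem_filter.1 hb).2)
        ha (mem_filter.1 ha).2
    have hsum : 8 * dq ^ 2 + 8 * dg ^ 2 ≤ 8 * (dq + dg) ^ 2 := by nlinarith [Nat.zero_le (dq * dg)]
    refine ⟨A' ∪ A'', union_subset (hA'.trans sA₁) (hA''.trans sA₂), B' ∪ B'',
      union_subset (hB'.trans sB₁) (hB''.trans sB₂), ?_, ?_, ?_⟩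
    · exact (card_union_le _ _).trans ((Nat.add_le_add h1 h4).trans hsum)
    · exact (card_union_le _ _).trans ((Nat.add_le_add h2 h5).trans hsum)
    have e1 := incCount_filter_left (r := Ray.Meets) (fun a => restr a q = 0) A B
    have e2 := incCount_filter_right (r := Ray.Meets) (fun b => restr b q = 0) A₁ B
    have e3 := incCount_filter_right (r := Ray.Meets) (fun b => restr b q = 0) A₂ B
    rw [← hA₁, ← hA₂] at e1
    rw [← hB₁, ← hB₂] at e2 e3
    have e4 := incCount_union_left (r := Ray.Meets)
      (disjoint_of_subset_left hA' (disjoint_of_subset_right hA'' dA)) (B' ∪ B'')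
    have e5 := incCount_mono (r := Ray.Meets) (subset_refl A')
      (subset_union_left : B' ⊆ B' ∪ B'')
    have e6 := incCount_mono (r := Ray.Meets) (subset_refl A'')
      (subset_union_right : B'' ⊆ B' ∪ B'')
    rw [← cA, ← cB]
    nlinarith [Nat.zero_le (dg * (#A₁ + #B₁)), Nat.zero_le (dq * (#A₂ + #B₂))]

theorem exists_totalDegree_le_forall_restr_eq_zero {A : Finset (Ray K)} {e : ℕ} (h : #A ≤ e ^ 2) :
    ∃ f : MvPolynomial (Fin 3) K, f ≠ 0 ∧ f.totalDegree ≤ 6 * e ∧ ∀ a ∈ A, restr a f = 0 := by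
  classical
  let mon : (Fin 3 → Fin (2 * e + 1)) → Fin 3 →₀ ℕ := fun m =>
    Finsupp.equivFunOnFinite.symm fun i => (m i : ℕ)
  have hmon : Function.Injective mon := fun m m' hm => by
    funext i
    exact Fin.ext (DFunLike.congr_fun hm i)
  let Φ := Fintype.linearCombination K fun m => (monomial (mon m) (1 : K))
  have hΦ : Function.Injective Φ := by
    rw [← linearIndependent_iff_injective_fintypeLinearCombination]
    have := (MvPolynomial.basisMonomials (Fin 3) K).linearIndependent.comp mon hmon
    rwa [coe_basisMonomials] at this
  have hdeg : ∀ c, (Φ c).totalDegree ≤ 6 * e := by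
    intro c
    rw [Fintype.linearCombination_apply]
    refine totalDegree_finsetSum_le fun m _ => ?_
    refine (totalDegree_smul_le _ _).trans ((totalDegree_monomial_le _ _).trans ?_)
    rw [Finsupp.sum_fintype _ _ (fun _ => rfl), Fin.sum_univ_three]
    have h0 := (m 0).is_le
    have h1 := (m 1).is_le
    have h2 := (m 2).is_le
    simp only [mon, Finsupp.equivFunOnFinite_symm_apply_apply, id]
    omega
  let Ψ : ((Fin 3 → Fin (2 * e + 1)) → K) →ₗ[K] A → Fin (6 * e + 1) → K :=
    LinearMap.pi fun a => LinearMap.pi fun i =>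
      Polynomial.lcoeff K i ∘ₗ (restr a.1).toLinearMap ∘ₗ Φ
  have hker : LinearMap.ker Ψ ≠ ⊥ := by
    apply LinearMap.ker_ne_bot_of_finrank_lt
    simp only [Module.finrank_pi, Module.finrank_pi_fintype, sum_const, card_univ, Fintype.card_fin,
      Fintype.card_pi, prod_const, Fintype.card_coe, smul_eq_mul]
    calc #A * (6 * e + 1) ≤ e ^ 2 * (6 * e + 1) := Nat.mul_le_mul_right _ h
      _ < (2 * e + 1) ^ 3 := by ring_nf; omega
  obtain ⟨c, hc, hc0⟩ := (Submodule.ne_bot_iff _).1 hker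
  refine ⟨Φ c, fun h0 => hc0 (hΦ (by rw [h0, map_zero])), hdeg c, fun a ha => ?_⟩
  ext i
  by_cases hi : i < 6 * e + 1
  · exact congr_fun (congr_fun (LinearMap.mem_ker.1 hc) ⟨a, ha⟩) ⟨i, hi⟩
  · rw [Polynomial.coeff_zero]
    exact Polynomial.coeff_eq_zero_of_natDegree_lt
      (((natDegree_restr_le a _).trans (hdeg c)).trans_lt (by omega))

/-- The incidence bound for at most `p²` rays on the left. -/
theorem SkewPair.incCount_le_of_card_le_sq {p k : ℕ} [CharP K p] {A B : Finset (Ray K)}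
    (h : SkewPair k A B) {s n : ℕ} (hs : s ≤ p) (hsn : s ^ 2 ≤ n) (hA : #A ≤ s ^ 2)
    (hB : #B ≤ n) : incCount Ray.Meets A B ≤ (1000 * s + 3 * k) * n := by
  classical
  induction s using Nat.strong_induction_on generalizing A B n with
  | _ s ih =>
  obtain ⟨e, he⟩ : ∃ e, e = s / 40 := ⟨_, rfl⟩
  have he1 : 40 * e ≤ s := by omega
  have he2 : s < 40 * (e + 1) := by omega
  rcases Nat.eq_zero_or_pos e with he0 | hpos
  · calc incCount Ray.Meets A B ≤ #A * #B := incCount_le_mul A B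
      _ ≤ s ^ 2 * n := Nat.mul_le_mul hA hB
      _ ≤ (1000 * s + 3 * k) * n := Nat.mul_le_mul_right _ (by
        rw [sq]; exact (Nat.mul_le_mul_right s (by omega : s ≤ 1000)).trans (Nat.le_add_right _ _))
  set Y := 8 * n / e with hY
  have hY1 : e * Y ≤ 8 * n := Nat.mul_div_le _ _
  have hY2 : 8 * n < e * (Y + 1) := Nat.lt_mul_div_succ _ hpos
  have hAn : #A ≤ n := hA.trans hsn
  obtain ⟨A₀, hA₀, hcard, hsat⟩ := exists_saturating_subset (r := Ray.Meets) A B (d := 6 * e)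
    (M := e ^ 2) (Y := Y) (by
      calc (6 * e + 1) * #B ≤ (6 * e + 1) * n := Nat.mul_le_mul_left _ hB
        _ ≤ 8 * e * n := Nat.mul_le_mul_right _ (by omega)
        _ = e * (8 * n) := by ring
        _ < e * (e * (Y + 1)) := Nat.mul_lt_mul_of_pos_left hY2 hpos
        _ = _ := by ring)
  obtain ⟨f, hf0, hfd, hf⟩ := exists_totalDegree_le_forall_restr_eq_zero hcard
  have h1 := incCount_filter_right (r := Ray.Meets) (fun b => #{a ∈ A₀ | a.Meets b} ≤ 6 * e) A B
  set B₁ := {b ∈ B | ¬ #{a ∈ A₀ | a.Meets b} ≤ 6 * e} with hB₁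
  have sB₁ : B₁ ⊆ B := filter_subset _ _
  have hBf : ∀ b ∈ B₁, restr b f = 0 := by
    intro b hb
    by_contra hne
    refine (mem_filter.1 hb).2 (le_trans ?_ hfd)
    convert (h.mono hA₀ sB₁).card_filter_meets_left_le_of_restr hf hb hne
  have h2 := incCount_filter_left (r := Ray.Meets) (fun a => restr a f = 0) A B₁
  have h3 : incCount Ray.Meets {a ∈ A | ¬ restr a f = 0} B₁ ≤ #A * (6 * e) := by
    refine (incCount_le_mul_of_left (N := 6 * e) fun a ha => le_trans ?_ hfd).trans
      (Nat.mul_le_mul_right _ (card_filter_le _ _))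
    convert (h.mono subset_rfl sB₁).card_filter_meets_right_le_of_restr hBf (mem_filter.1 ha).1
      (mem_filter.1 ha).2
  set A₁ := {a ∈ A | restr a f = 0} with hA₁
  have sA₁ : A₁ ⊆ A := filter_subset _ _
  obtain ⟨A', sA', B', sB', cA', cB', h4⟩ := (h.mono sA₁ sB₁).incCount_le_of_restr_eq_zero hf0
    (p := p) (by omega) (fun a ha => (mem_filter.1 ha).2) hBf
  have hsmall : 8 * f.totalDegree ^ 2 ≤ (17 * e) ^ 2 := by
    have := Nat.pow_le_pow_left hfd 2
    rw [mul_pow] at this ⊢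
    omega
  have h5 := ih (17 * e) (by omega) ((h.mono sA₁ sB₁).mono sA' sB') (by omega) le_rfl
    (cA'.trans hsmall) (cB'.trans hsmall)
  have c1 := card_le_card sA₁
  have c2 := card_le_card sB₁
  have h6 : (5 * f.totalDegree + k + 2) * (#A₁ + #B₁) ≤ (30 * e + k + 2) * (2 * n) :=
    Nat.mul_le_mul (by omega) (by omega)
  have h7 : 6 * e * #B ≤ 6 * e * n := Nat.mul_le_mul_left _ hB
  have h8 : Y * #A ≤ 640 * (s * n) := by
    calc Y * #A ≤ Y * s ^ 2 := Nat.mul_le_mul_left _ hA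
      _ ≤ Y * (s * (80 * e)) := Nat.mul_le_mul_left _ (by rw [sq]; exact Nat.mul_le_mul_left _ (by omega))
      _ = 80 * s * (e * Y) := by ring
      _ ≤ 80 * s * (8 * n) := Nat.mul_le_mul_left _ hY1
      _ = _ := by ring
  have h9 : #A * (6 * e) ≤ n * (6 * e) := Nat.mul_le_mul_right _ hAn
  have h10 : 5 * (17 * e) ^ 2 ≤ n := by
    have := (Nat.pow_le_pow_left he1 2).trans hsn
    rw [mul_pow] at this ⊢
    omega
  have h11 : (1000 * (17 * e) + 3 * k) * (17 * e) ^ 2 * 5 ≤ (425 * s + 3 * k) * n := by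
    calc _ = (1000 * (17 * e) + 3 * k) * (5 * (17 * e) ^ 2) := by ring
      _ ≤ _ := Nat.mul_le_mul (by omega) h10
  have h12 : 40 * (e * n) ≤ s * n := by rw [← mul_assoc]; exact Nat.mul_le_mul_right _ he1
  have h13 : n ≤ e * n := Nat.le_mul_of_pos_left _ hpos
  have h14 : (30 * e + k + 2) * (2 * n) = 60 * (e * n) + 2 * (k * n) + 4 * n := by ring
  have h15 : (425 * s + 3 * k) * n = 425 * (s * n) + 3 * (k * n) := by ring
  have h16 : (1000 * s + 3 * k) * n = 1000 * (s * n) + 3 * (k * n) := by ring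
  have h17 : 6 * e * n = 6 * (e * n) := by ring
  have h18 : n * (6 * e) = 6 * (e * n) := by ring
  rw [h16]
  rw [h15] at h11
  rw [h14] at h6
  rw [h17] at h7
  rw [h18] at h9
  omega

/-- The incidence bound for at least `p²` rays, by cutting the left family into pieces. -/
theorem SkewPair.incCount_le_div_add_one_mul {p k : ℕ} [CharP K p] {A B : Finset (Ray K)}
    (h : SkewPair k A B) (hp : 0 < p) (hB : p ^ 2 ≤ #B) :
    incCount Ray.Meets A B ≤ (#A / p ^ 2 + 1) * ((1000 * p + 3 * k) * #B) := by
  classical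
  have hpp : 0 < p ^ 2 := by positivity
  induction hm : #A using Nat.strong_induction_on generalizing A with
  | _ m ih =>
  subst hm
  rcases le_or_gt #A (p ^ 2) with hA | hA
  · exact (h.incCount_le_of_card_le_sq le_rfl hB hA le_rfl).trans (Nat.le_mul_of_pos_left _ (by simp))
  · obtain ⟨A₀, hA₀, hcard⟩ := exists_subset_card_eq hA.le
    have hc : #(A \ A₀) = #A - p ^ 2 := by rw [card_sdiff_of_subset hA₀, hcard]
    have h1 := (h.mono hA₀ subset_rfl).incCount_le_of_card_le_sq le_rfl hB hcard.le le_rfl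
    have h2 := ih _ (by omega) (h.mono sdiff_subset subset_rfl) rfl (A := A \ A₀)
    have h3 := incCount_union_left (r := Ray.Meets) (disjoint_sdiff (s := A₀) (t := A)) B
    rw [union_sdiff_of_subset hA₀] at h3
    have h4 : #A / p ^ 2 = #(A \ A₀) / p ^ 2 + 1 := by
      rw [hc, ← Nat.add_div_right _ hpp, Nat.sub_add_cancel hA.le]
    rw [h3, h4, add_mul _ 1, one_mul]
    omega

/-- The incidence bound for rays. -/
theorem SkewPair.incCount_le {p k : ℕ} [CharP K p] {A B : Finset (Ray K)}
    (h : SkewPair k A B) (hp : 0 < p) (hAB : #A ≤ #B)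
    (hcard : ∀ A₀ ⊆ A, ∀ B₀ ⊆ B, (∀ a ∈ A₀, ∀ b ∈ B₀, a.Meets b) → 2 ≤ #B₀ → #A₀ ≤ p) :
    (incCount Ray.Meets A B : ℝ) ≤
      8000 * (#A * #B / p + √(#A : ℝ) * #B + k * #B) := by
  have hp' : (0 : ℝ) < p := by exact_mod_cast hp
  rcases le_or_gt #A (p ^ 2) with hA | hA
  · have hex : ∃ s, #A ≤ s ^ 2 := ⟨p, hA⟩
    classical
    obtain ⟨s, hs, hsp, hmin⟩ : ∃ s, #A ≤ s ^ 2 ∧ s ≤ p ∧ ∀ r < s, ¬ #A ≤ r ^ 2 :=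
      ⟨Nat.find hex, Nat.find_spec hex, Nat.find_min' hex hA, fun r hr => Nat.find_min hex hr⟩
    have hs4 : s ^ 2 ≤ 4 * #A := by
      rcases Nat.eq_zero_or_pos s with h0 | h0
      · simp [h0]
      · obtain ⟨r, rfl⟩ : ∃ r, s = r + 1 := ⟨s - 1, by omega⟩
        have := hmin r (by omega)
        nlinarith [sq_nonneg ((r : ℤ) - 1)]
    have h1 := h.incCount_le_of_card_le_sq hsp (n := 4 * #B) (by omega) hs (by omega)
    have h2 : (s : ℝ) ≤ 2 * √(#A : ℝ) := by
      have h3 : (s : ℝ) ^ 2 ≤ 4 * #A := by exact_mod_cast hs4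
      have h4 : (s : ℝ) ≤ √(4 * #A) := Real.le_sqrt_of_sq_le h3
      rwa [show (4 : ℝ) = 2 ^ 2 by norm_num, Real.sqrt_mul (by norm_num),
        Real.sqrt_sq (by norm_num)] at h4
    calc (incCount Ray.Meets A B : ℝ) ≤ (1000 * s + 3 * k) * (4 * #B) := by exact_mod_cast h1
      _ ≤ (1000 * (2 * √(#A : ℝ)) + 3 * k) * (4 * #B) := by gcongr
      _ = 8000 * (√(#A : ℝ) * #B) + 12 * (k * #B) := by ring
      _ ≤ 8000 * (#A * #B / p + √(#A : ℝ) * #B + k * #B) := by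
        have : (0 : ℝ) ≤ #A * #B / p := by positivity
        have : (0 : ℝ) ≤ k * #B := by positivity
        linarith
  · have h' : SkewPair (min k (p + 1)) A B :=
      { left := h.left
        right := h.right
        transversal := h.transversal
        complete := fun A₀ hA₀ B₀ hB₀ hm h2 h3 => by
          have h4 := h.complete A₀ hA₀ B₀ hB₀ hm h2 h3
          have h5 := hcard A₀ hA₀ B₀ hB₀ hm h3
          omega }
    have h1 := h'.incCount_le_div_add_one_mul hp (hA.le.trans hAB)
    have h2 : (#A / p ^ 2 + 1 : ℕ) * p ^ 2 ≤ 2 * #A := by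
      have := Nat.div_mul_le_self #A (p ^ 2)
      rw [add_mul]
      omega
    have h3 : 1000 * p + 3 * min k (p + 1) ≤ 1006 * p := by omega
    have h4 : incCount Ray.Meets A B * p ^ 2 ≤ 2 * #A * (1006 * p * #B) := by
      calc _ ≤ (#A / p ^ 2 + 1) * ((1000 * p + 3 * min k (p + 1)) * #B) * p ^ 2 :=
            Nat.mul_le_mul_right _ h1
        _ = (#A / p ^ 2 + 1) * p ^ 2 * ((1000 * p + 3 * min k (p + 1)) * #B) := by ring
        _ ≤ _ := Nat.mul_le_mul h2 (Nat.mul_le_mul_right _ h3)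
    have h5 : (incCount Ray.Meets A B : ℝ) * p ^ 2 ≤ 2 * #A * (1006 * p * #B) := by
      exact_mod_cast h4
    have h6 : (incCount Ray.Meets A B : ℝ) ≤ 2012 * (#A * #B / p) := by
      rw [← mul_le_mul_iff_left₀ (show (0 : ℝ) < p ^ 2 by positivity)]
      refine h5.trans (le_of_eq ?_)
      field_simp
      ring
    have : (0 : ℝ) ≤ #A * #B / p := by positivity
    have : (0 : ℝ) ≤ √(#A : ℝ) * #B := by positivity
    have : (0 : ℝ) ≤ k * #B := by positivity
    linarith

end Rays

section Affine
variable {F : Type*} [Field F]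

theorem exists_covector {s : AffineSubspace F (Fin 3 → F)} (h : Module.finrank F s.direction = 2) :
    ∃ (w : F) (n : Fin 3 → F), n ≠ 0 ∧
      ∀ r, r ∈ s ↔ w + n 0 * r 0 + n 1 * r 1 + n 2 * r 2 = 0 := by
  have hlt : s.direction < ⊤ := by
    refine lt_top_iff_ne_top.2 fun h0 => ?_
    rw [h0, finrank_top, Module.finrank_fin_fun] at h
    omega
  obtain ⟨f, hf, hle⟩ := s.direction.exists_le_ker_of_lt_top hlt
  have hker : s.direction = LinearMap.ker f := by
    refine Submodule.eq_of_le_of_finrank_eq hle ?_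
    have := Module.Dual.finrank_ker_add_one_of_ne_zero hf
    rw [Module.finrank_fin_fun] at this
    omega
  obtain ⟨r₀, hr₀⟩ : (s : Set (Fin 3 → F)).Nonempty := by
    rw [Set.nonempty_iff_ne_empty]
    intro h0
    rw [AffineSubspace.coe_eq_bot_iff] at h0
    rw [h0, AffineSubspace.direction_bot, finrank_bot] at h
    omega
  have hfr : ∀ r, f r = f (Pi.single 0 1) * r 0 + f (Pi.single 1 1) * r 1 +
      f (Pi.single 2 1) * r 2 := fun r => by
    rw [LinearMap.pi_apply_eq_sum_univ f r, Fin.sum_univ_three]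
    have hsingle : ∀ i : Fin 3, (fun j => if i = j then (1 : F) else 0) = Pi.single i 1 := fun i => by
      ext j
      simp [Pi.single_apply, eq_comm]
    simp only [hsingle, smul_eq_mul, mul_comm]
  refine ⟨-f r₀, fun i => f (Pi.single i 1), fun h0 => hf ?_, fun r => ?_⟩
  · ext i
    exact congr_fun h0 i
  · rw [← AffineSubspace.vsub_right_mem_direction_iff_mem hr₀, hker, LinearMap.mem_ker, vsub_eq_sub,
      map_sub, hfr r]
    constructor <;> intro h1 <;> linear_combination h1

theorem finrank_direction_inf_eq_one {s₁ s₂ : AffineSubspace F (Fin 3 → F)}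
    (h₁ : Module.finrank F s₁.direction = 2) (h₂ : Module.finrank F s₂.direction = 2)
    (hne : s₁ ≠ s₂) {r r' : Fin 3 → F} (hr : r ∈ s₁ ⊓ s₂) (hr' : r' ∈ s₁ ⊓ s₂) (hrr : r ≠ r') :
    Module.finrank F (s₁ ⊓ s₂).direction = 1 := by
  have hpos : 0 < Module.finrank F (s₁ ⊓ s₂).direction := by
    rw [Module.finrank_pos_iff_exists_ne_zero]
    exact ⟨⟨r -ᵥ r', AffineSubspace.vsub_mem_direction hr hr'⟩, fun h0 =>
      hrr (vsub_eq_zero_iff_eq.1 (congrArg Subtype.val h0))⟩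
  have hle₁ : (s₁ ⊓ s₂).direction ≤ s₁.direction := AffineSubspace.direction_le inf_le_left
  have hle₂ : (s₁ ⊓ s₂).direction ≤ s₂.direction := AffineSubspace.direction_le inf_le_right
  have hlt : Module.finrank F (s₁ ⊓ s₂).direction ≠ 2 := by
    intro h0
    have e₁ := Submodule.eq_of_le_of_finrank_eq hle₁ (h0.trans h₁.symm)
    have e₂ := Submodule.eq_of_le_of_finrank_eq hle₂ (h0.trans h₂.symm)
    exact hne (AffineSubspace.ext_of_direction_eq (e₁.symm.trans e₂) ⟨r, hr.1, hr.2⟩)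
  have := Submodule.finrank_mono hle₁
  omega

theorem le_of_finrank_direction_eq_one {ℓ s : AffineSubspace F (Fin 3 → F)}
    (h : Module.finrank F ℓ.direction = 1) {r r' : Fin 3 → F} (hr : r ∈ ℓ) (hr' : r' ∈ ℓ)
    (hrr : r ≠ r') (hrs : r ∈ s) (hrs' : r' ∈ s) : ℓ ≤ s := by
  have hline : line[F, r, r'] ≤ ℓ := affineSpan_pair_le_of_mem_of_mem hr hr'
  have hd : (line[F, r, r']).direction = ℓ.direction := by
    refine Submodule.eq_of_le_of_finrank_eq (AffineSubspace.direction_le hline) ?_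
    rw [h, direction_affineSpan, vectorSpan_pair]
    exact finrank_span_singleton (sub_ne_zero.2 hrr)
  rw [← AffineSubspace.ext_of_direction_eq hd ⟨r, left_mem_affineSpan_pair F r r', hr⟩]
  exact affineSpan_pair_le_of_mem_of_mem hrs hrs'

theorem card_le_of_finrank_direction_eq_one [Finite F] {ℓ : AffineSubspace F (Fin 3 → F)}
    (h : Module.finrank F ℓ.direction = 1) {R : Finset (Fin 3 → F)} (hR : ∀ r ∈ R, r ∈ ℓ) :
    #R ≤ Nat.card F := by
  rcases R.eq_empty_or_nonempty with rfl | ⟨r₀, hr₀⟩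
  · simp
  · have h1 : Nat.card ℓ.direction = Nat.card F := by
      rw [Module.natCard_eq_pow_finrank (K := F), h, pow_one]
    let φ : R → ℓ.direction := fun r =>
      ⟨r.1 -ᵥ r₀, AffineSubspace.vsub_mem_direction (hR _ r.2) (hR _ hr₀)⟩
    have hφ : Function.Injective φ := fun r r' hrr =>
      Subtype.ext (vsub_left_cancel (congrArg Subtype.val hrr))
    rw [← h1, ← Fintype.card_coe, ← Nat.card_eq_fintype_card]
    exact Nat.card_le_card_of_injective φ hφ

end Affine

section Generic
variable {F : Type*} [Field F]
open Polynomial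

/-- The ray over `F(θ)` with homogeneous polynomial coordinates. -/
noncomputable def homRay (P : Fin 4 → F[X]) : Ray (RatFunc F) where
  b := algebraMap F[X] (RatFunc F) (P 0) / algebraMap F[X] (RatFunc F) (P 3)
  t := algebraMap F[X] (RatFunc F) (P 1) / algebraMap F[X] (RatFunc F) (P 3)
  e := algebraMap F[X] (RatFunc F) (P 2) / algebraMap F[X] (RatFunc F) (P 3)

theorem homRay_meets_iff {P Q : Fin 4 → F[X]} (hP : P 3 ≠ 0) (hQ : Q 3 ≠ 0) :
    (homRay P).Meets (homRay Q) ↔ P 2 * Q 3 - P 3 * Q 2 - P 0 * Q 1 + P 1 * Q 0 = 0 := by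
  have hP' := (map_ne_zero_iff _ (RatFunc.algebraMap_injective F)).2 hP
  have hQ' := (map_ne_zero_iff _ (RatFunc.algebraMap_injective F)).2 hQ
  rw [← map_eq_zero_iff _ (RatFunc.algebraMap_injective F)]
  simp only [Ray.Meets, homRay, map_add, map_sub, map_mul]
  field_simp
  constructor <;> intro h <;> linear_combination h

theorem homRay_t_eq_iff {P Q : Fin 4 → F[X]} (hP : P 3 ≠ 0) (hQ : Q 3 ≠ 0) :
    (homRay P).t = (homRay Q).t ↔ P 1 * Q 3 - P 3 * Q 1 = 0 := by
  have hP' := (map_ne_zero_iff _ (RatFunc.algebraMap_injective F)).2 hP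
  have hQ' := (map_ne_zero_iff _ (RatFunc.algebraMap_injective F)).2 hQ
  rw [← map_eq_zero_iff _ (RatFunc.algebraMap_injective F)]
  simp only [homRay, map_sub, map_mul]
  field_simp
  constructor <;> intro h <;> linear_combination h

/-- Coordinates of the ray attached to a point. -/
noncomputable def pointCoords (r : Fin 3 → F) : Fin 4 → F[X] :=
  ![1, C (r 1) - X ^ 3 - C (r 0) * X, C (r 0) - X ^ 20 * (C (r 1) - X ^ 3 - C (r 0) * X),
    C (r 2) - X ^ 5 - C (r 0) * X ^ 2]

/-- Coordinates of the ray attached to the plane `w + n ⬝ r = 0`. -/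
noncomputable def planeCoords (w : F) (n : Fin 3 → F) : Fin 4 → F[X] :=
  ![C (n 1) + X ^ 20 * (C (n 0) + C (n 1) * X + C (n 2) * X ^ 2),
    -(C w + C (n 1) * X ^ 3 + C (n 2) * X ^ 5), -C (n 2), C (n 0) + C (n 1) * X + C (n 2) * X ^ 2]

theorem pointCoords_ne_zero (r : Fin 3 → F) : pointCoords r 3 ≠ 0 := by
  intro h
  have := congrArg (coeff · 5) h
  simp [pointCoords, coeff_X_pow] at this

theorem planeCoords_ne_zero (w : F) {n : Fin 3 → F} (hn : n ≠ 0) : planeCoords w n 3 ≠ 0 := by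
  intro h
  apply hn
  have h0 := congrArg (coeff · 0) h
  have h1 := congrArg (coeff · 1) h
  have h2 := congrArg (coeff · 2) h
  simp [planeCoords, coeff_X, coeff_C, coeff_X_pow] at h0 h1 h2
  ext i
  fin_cases i <;> simp [h0, h1, h2]

theorem homRay_pointCoords_meets_iff (r : Fin 3 → F) (w : F) {n : Fin 3 → F} (hn : n ≠ 0) :
    (homRay (pointCoords r)).Meets (homRay (planeCoords w n)) ↔
      w + n 0 * r 0 + n 1 * r 1 + n 2 * r 2 = 0 := by
  have key : pointCoords r 2 * planeCoords w n 3 - pointCoords r 3 * planeCoords w n 2 -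
      pointCoords r 0 * planeCoords w n 1 + pointCoords r 1 * planeCoords w n 0 =
      C (w + n 0 * r 0 + n 1 * r 1 + n 2 * r 2) := by
    simp only [pointCoords, planeCoords, Matrix.cons_val, map_add, map_mul]
    ring
  rw [homRay_meets_iff (pointCoords_ne_zero r) (planeCoords_ne_zero w hn), key, C_eq_zero]

theorem homRay_pointCoords_t_ne (r : Fin 3 → F) (w : F) {n : Fin 3 → F} (hn : n ≠ 0) :
    (homRay (pointCoords r)).t ≠ (homRay (planeCoords w n)).t := by
  rw [Ne, homRay_t_eq_iff (pointCoords_ne_zero r) (planeCoords_ne_zero w hn)]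
  intro h
  apply hn
  have key : C (r 1 * n 0 + w * r 2) + C (r 1 * n 1 - r 0 * n 0) * X +
      C (r 1 * n 2 - r 0 * n 1 - w * r 0) * X ^ 2 + C (-n 0 - r 0 * n 2 + n 1 * r 2) * X ^ 3 +
      C (-n 1) * X ^ 4 + C (-n 2 + n 2 * r 2 - w - n 1 * r 0) * X ^ 5 + C (-n 2 * r 0) * X ^ 7 +
      C (-n 1) * X ^ 8 + C (-n 2) * X ^ 10 = 0 := by
    simp only [pointCoords, planeCoords, Matrix.cons_val] at h
    simp only [map_add, map_mul, map_sub, map_neg]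
    linear_combination h
  have h2 := congrArg (coeff · 10) key
  have h1 := congrArg (coeff · 8) key
  have h0 := congrArg (coeff · 3) key
  simp only [coeff_add, coeff_C_mul, coeff_X_pow, coeff_X, coeff_C, coeff_zero] at h0 h1 h2
  norm_num at h0 h1 h2
  rw [h1, h2] at h0
  ext i
  fin_cases i <;> simp_all

theorem homRay_pointCoords_generic {r r' : Fin 3 → F} (h : r ≠ r') :
    (homRay (pointCoords r)).t ≠ (homRay (pointCoords r')).t ∧
      ¬ (homRay (pointCoords r)).Meets (homRay (pointCoords r')) := by
  constructor
  · rw [Ne, homRay_t_eq_iff (pointCoords_ne_zero r) (pointCoords_ne_zero r')]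
    intro h0
    apply h
    have key : C (r 1 * r' 2 - r' 1 * r 2) + C (r' 0 * r 2 - r 0 * r' 2) * X +
        C (r' 1 * r 0 - r 1 * r' 0) * X ^ 2 + C (r 2 - r' 2) * X ^ 3 +
        C (r' 1 - r 1 + (r' 0 - r 0)) * X ^ 5 + C (r 0 - r' 0) * X ^ 6 = 0 := by
      simp only [pointCoords, Matrix.cons_val] at h0
      simp only [map_add, map_mul, map_sub]
      linear_combination h0
    have h2 := congrArg (coeff · 3) key
    have h1 := congrArg (coeff · 5) key
    have h0 := congrArg (coeff · 6) key
    simp only [coeff_add, coeff_C_mul, coeff_X_pow, coeff_X, coeff_C, coeff_zero] at h0 h1 h2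
    norm_num at h0 h1 h2
    ext i
    fin_cases i
    · exact sub_eq_zero.1 h0
    · simp only [Fin.mk_one]
      linear_combination -h1 - h0
    · exact sub_eq_zero.1 h2
  · rw [homRay_meets_iff (pointCoords_ne_zero r) (pointCoords_ne_zero r')]
    intro h0
    apply h
    have key : C (r 0 * r' 2 - r' 0 * r 2 + r 1 - r' 1) + C (r' 0 - r 0) * X +
        C (r' 0 - r 0) * X ^ 5 - (C (r 1 * r' 2 - r' 1 * r 2) * X ^ 20 +
        C (r' 0 * r 2 - r 0 * r' 2) * X ^ 21 +
        C (r' 1 * r 0 - r 1 * r' 0) * X ^ 22 + C (r 2 - r' 2) * X ^ 23 +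
        C (r' 1 - r 1 + (r' 0 - r 0)) * X ^ 25 + C (r 0 - r' 0) * X ^ 26) = 0 := by
      simp only [pointCoords, Matrix.cons_val] at h0
      simp only [map_add, map_mul, map_sub]
      linear_combination h0
    have h2 := congrArg (coeff · 23) key
    have h1 := congrArg (coeff · 25) key
    have h0 := congrArg (coeff · 26) key
    simp only [coeff_add, coeff_sub, coeff_C_mul, coeff_X_pow, coeff_X, coeff_C, coeff_zero]
      at h0 h1 h2
    norm_num at h0 h1 h2
    ext i
    fin_cases i
    · simp only [Fin.zero_eta]
      linear_combination -h0
    · simp only [Fin.mk_one]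
      linear_combination h1 + h0
    · simp only [Fin.reduceFinMk]
      linear_combination -h2

theorem covector_eq_zero_of_minors_eq_zero {w w' : F} {n n' : Fin 3 → F} (hn : n ≠ 0)
    (hw : ∀ i, w * n' i - n i * w' = 0) (hm : ∀ i j, n i * n' j - n' i * n j = 0) {r : Fin 3 → F}
    (h : w + n 0 * r 0 + n 1 * r 1 + n 2 * r 2 = 0) :
    w' + n' 0 * r 0 + n' 1 * r 1 + n' 2 * r 2 = 0 := by
  obtain ⟨i, hi⟩ := Function.ne_iff.1 hn
  refine (mul_eq_zero.1 ?_).resolve_left hi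
  linear_combination n' i * h - hw i + r 0 * hm i 0 + r 1 * hm i 1 + r 2 * hm i 2

theorem homRay_planeCoords_generic {w w' : F} {n n' : Fin 3 → F} (hn : n ≠ 0) (hn' : n' ≠ 0)
    (h : ¬ ((∀ i, w * n' i - n i * w' = 0) ∧ ∀ i j, n i * n' j - n' i * n j = 0)) :
    (homRay (planeCoords w n)).t ≠ (homRay (planeCoords w' n')).t ∧
      ¬ (homRay (planeCoords w n)).Meets (homRay (planeCoords w' n')) := by
  have hfin : ∀ {x₀ x₁ x₂ x₃ x₅ x₆ : F}, x₀ = w * n' 0 - n 0 * w' → x₁ = w * n' 1 - n 1 * w' →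
      x₂ = w * n' 2 - n 2 * w' → x₃ = n 1 * n' 0 - n' 1 * n 0 →
      x₅ = n 1 * n' 2 - n' 1 * n 2 + (n 2 * n' 0 - n' 2 * n 0) → x₆ = n 2 * n' 1 - n' 2 * n 1 →
      ¬ (x₀ = 0 ∧ x₁ = 0 ∧ x₂ = 0 ∧ x₃ = 0 ∧ x₅ = 0 ∧ x₆ = 0) := by
    rintro _ _ _ _ _ _ rfl rfl rfl rfl rfl rfl ⟨h0, h1, h2, h3, h5, h6⟩
    refine h ⟨fun i => ?_, fun i j => ?_⟩
    · fin_cases i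
      exacts [h0, h1, h2]
    · fin_cases i <;> fin_cases j <;> simp only [Fin.zero_eta, Fin.mk_one, Fin.reduceFinMk]
      · ring
      · linear_combination -h3
      · linear_combination -h5 - h6
      · linear_combination h3
      · ring
      · linear_combination -h6
      · linear_combination h5 + h6
      · linear_combination h6
      · ring
  set x₀ := w * n' 0 - n 0 * w' with h₀
  set x₁ := w * n' 1 - n 1 * w' with h₁
  set x₂ := w * n' 2 - n 2 * w' with h₂
  set x₃ := n 1 * n' 0 - n' 1 * n 0 with h₃
  set x₅ := n 1 * n' 2 - n' 1 * n 2 + (n 2 * n' 0 - n' 2 * n 0) with h₅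
  set x₆ := n 2 * n' 1 - n' 2 * n 1 with h₆
  specialize hfin h₀ h₁ h₂ h₃ h₅ h₆
  constructor
  · rw [Ne, homRay_t_eq_iff (planeCoords_ne_zero w hn) (planeCoords_ne_zero w' hn')]
    intro e
    apply hfin
    have key : C x₀ + C x₁ * X + C x₂ * X ^ 2 + C x₃ * X ^ 3 + C x₅ * X ^ 5 + C x₆ * X ^ 6 = 0 := by
      simp only [planeCoords, Matrix.cons_val] at e
      simp only [h₀, h₁, h₂, h₃, h₅, h₆, map_add, map_mul, map_sub]
      linear_combination -e
    have k (i : ℕ) := congrArg (coeff · i) key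
    simp only [coeff_add, coeff_C_mul, coeff_X_pow, coeff_X, coeff_C, coeff_zero] at k
    exact ⟨by simpa using k 0, by simpa using k 1, by simpa using k 2, by simpa using k 3,
      by simpa using k 5, by simpa using k 6⟩
  · rw [homRay_meets_iff (planeCoords_ne_zero w hn) (planeCoords_ne_zero w' hn')]
    intro e
    apply hfin
    have key : C (n 2 * n' 0 - n' 2 * n 0 + w * n' 1 - n 1 * w') +
        C (n 2 * n' 1 - n' 2 * n 1) * X + C (n' 1 * n 2 - n 1 * n' 2) * X ^ 5 +
        C x₀ * X ^ 20 + C x₁ * X ^ 21 + C x₂ * X ^ 22 + C x₃ * X ^ 23 + C x₅ * X ^ 25 +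
        C x₆ * X ^ 26 = 0 := by
      simp only [planeCoords, Matrix.cons_val] at e
      simp only [h₀, h₁, h₂, h₃, h₅, h₆, map_add, map_mul, map_sub]
      linear_combination -e
    have k (i : ℕ) := congrArg (coeff · i) key
    simp only [coeff_add, coeff_C_mul, coeff_X_pow, coeff_X, coeff_C, coeff_zero] at k
    exact ⟨by simpa using k 20, by simpa using k 21, by simpa using k 22, by simpa using k 23,
      by simpa using k 25, by simpa using k 26⟩

end Generic

theorem eq_of_minors_eq_zero {F : Type*} [Field F] {s s' : AffineSubspace F (Fin 3 → F)}
    {w w' : F} {n n' : Fin 3 → F} (hn : n ≠ 0) (hn' : n' ≠ 0)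
    (hs : ∀ r, r ∈ s ↔ w + n 0 * r 0 + n 1 * r 1 + n 2 * r 2 = 0)
    (hs' : ∀ r, r ∈ s' ↔ w' + n' 0 * r 0 + n' 1 * r 1 + n' 2 * r 2 = 0)
    (hw : ∀ i, w * n' i - n i * w' = 0) (hm : ∀ i j, n i * n' j - n' i * n j = 0) : s = s' := by
  ext r
  rw [hs, hs']
  refine ⟨covector_eq_zero_of_minors_eq_zero hn hw hm,
    covector_eq_zero_of_minors_eq_zero hn' (fun i => ?_) fun i j => ?_⟩
  · linear_combination -hw i
  · linear_combination -hm i j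

/-- Points and planes of `F³` can be encoded as rays over `F(θ)` in general position. -/
theorem exists_ray_encoding (F : Type*) [Field F] :
    ∃ (α : (Fin 3 → F) → Ray (RatFunc F)) (β : AffineSubspace F (Fin 3 → F) → Ray (RatFunc F)),
      (∀ r r', r ≠ r' → (α r).t ≠ (α r').t ∧ ¬ (α r).Meets (α r')) ∧
      (∀ s s', Module.finrank F s.direction = 2 → Module.finrank F s'.direction = 2 → s ≠ s' →
        (β s).t ≠ (β s').t ∧ ¬ (β s).Meets (β s')) ∧
      ∀ r s, Module.finrank F s.direction = 2 →
        (α r).t ≠ (β s).t ∧ ((α r).Meets (β s) ↔ r ∈ s) := by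
  choose! w n hn hs using fun (s : AffineSubspace F (Fin 3 → F))
    (h : Module.finrank F s.direction = 2) => exists_covector h
  refine ⟨fun r => homRay (pointCoords r), fun s => homRay (planeCoords (w s) (n s)),
    fun r r' => homRay_pointCoords_generic, fun s s' h h' hne => ?_, fun r s h => ?_⟩
  · exact homRay_planeCoords_generic (hn s h) (hn s' h') fun hm =>
      hne (eq_of_minors_eq_zero (hn s h) (hn s' h') (hs s h) (hs s' h') hm.1 hm.2)
  · exact ⟨homRay_pointCoords_t_ne r _ (hn s h),
      (homRay_pointCoords_meets_iff r _ (hn s h)).trans (hs s h r).symm⟩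

/-- (Rudnev's point–plane incidence bound) There is an absolute constant `C > 0` such that
for every prime `p`, every finite set `R` of points of `𝔽_p³` and every finite set `S` of
affine planes of `𝔽_p³` (2-dimensional affine subspaces) with `|R| ≤ |S|`, and every
`k ≥ 1` such that no line (1-dimensional affine subspace) contains at least `k` points of
`R` and is contained in at least `k` planes of `S`, the number of incidences satisfies
`I(R,S) ≤ C·(|R|·|S|/p + |R|^{1/2}·|S| + k·|S|)`. -/
theorem rudnev_point_plane :
    ∃ C : ℝ, 0 < C ∧
      ∀ (p : ℕ) [Fact p.Prime],
        ∀ (R : Finset (Fin 3 → ZMod p))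
          (S : Finset (AffineSubspace (ZMod p) (Fin 3 → ZMod p))) (k : ℕ),
          1 ≤ k →
          R.card ≤ S.card →
          (∀ s ∈ S, Module.finrank (ZMod p) s.direction = 2) →
          (¬ ∃ ℓ : AffineSubspace (ZMod p) (Fin 3 → ZMod p),
              Module.finrank (ZMod p) ℓ.direction = 1 ∧
              k ≤ Set.ncard {r : Fin 3 → ZMod p | r ∈ R ∧ r ∈ ℓ} ∧
              k ≤ Set.ncard {s : AffineSubspace (ZMod p) (Fin 3 → ZMod p) | s ∈ S ∧ ℓ ≤ s}) →
          (Set.ncard {q : (Fin 3 → ZMod p) × AffineSubspace (ZMod p) (Fin 3 → ZMod p) |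
              q.1 ∈ R ∧ q.2 ∈ S ∧ q.1 ∈ q.2} : ℝ) ≤
            C * ((R.card : ℝ) * (S.card : ℝ) / (p : ℝ)
              + (R.card : ℝ) ^ ((1 : ℝ) / 2) * (S.card : ℝ)
              + (k : ℝ) * (S.card : ℝ)) := by

  classical
  refine ⟨8000, by norm_num, fun p hp R S k _ hRS hS hline => ?_⟩
  obtain ⟨α, β, hα, hβ, hαβ⟩ := exists_ray_encoding (ZMod p)
  have : CharP (RatFunc (ZMod p)) p :=
    charP_of_injective_algebraMap (algebraMap (ZMod p) (RatFunc (ZMod p))).injective p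
  have hαi : Function.Injective α := fun r r' h => by
    by_contra hne
    exact (hα r r' hne).1 (congrArg Ray.t h)
  have hβi : Set.InjOn β S := fun s hs s' hs' h => by
    by_contra hne
    exact (hβ s s' (hS s hs) (hS s' hs') hne).1 (congrArg Ray.t h)
  have hpull : ∀ A₀ ⊆ R.image α, ∀ B₀ ⊆ S.image β, (∀ a ∈ A₀, ∀ b ∈ B₀, a.Meets b) →
      ∃ R₀ ⊆ R, ∃ S₀ ⊆ S, #R₀ = #A₀ ∧ #S₀ = #B₀ ∧ ∀ r ∈ R₀, ∀ s ∈ S₀, r ∈ s := by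
    intro A₀ hA₀ B₀ hB₀ hm
    obtain ⟨R₀, hR₀, rfl⟩ := subset_image_iff.1 hA₀
    obtain ⟨S₀, hS₀, rfl⟩ := subset_image_iff.1 hB₀
    refine ⟨R₀, by exact_mod_cast hR₀, S₀, by exact_mod_cast hS₀, (card_image_of_injective _ hαi).symm,
      (card_image_of_injOn (hβi.mono hS₀)).symm, fun r hr s hs => ?_⟩
    exact (hαβ r s (hS s (hS₀ hs))).2.1 (hm _ (mem_image_of_mem α hr) _ (mem_image_of_mem β hs))
  have hpair : SkewPair k (R.image α) (S.image β) :=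
    { left := by
        intro a ha a' ha' hne
        obtain ⟨r, _, rfl⟩ := mem_image.1 ha
        obtain ⟨r', _, rfl⟩ := mem_image.1 ha'
        exact hα r r' fun h => hne (by rw [h])
      right := by
        intro b hb b' hb' hne
        obtain ⟨s, hs, rfl⟩ := mem_image.1 hb
        obtain ⟨s', hs', rfl⟩ := mem_image.1 hb'
        exact hβ s s' (hS s hs) (hS s' hs') fun h => hne (by rw [h])
      transversal := by
        intro a ha b hb
        obtain ⟨r, _, rfl⟩ := mem_image.1 ha
        obtain ⟨s, hs, rfl⟩ := mem_image.1 hb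
        exact (hαβ r s (hS s hs)).1
      complete := by
        intro A₀ hA₀ B₀ hB₀ hm h2 h3
        obtain ⟨R₀, hR₀, S₀, hS₀, cR, cS, hmem⟩ := hpull A₀ hA₀ B₀ hB₀ hm
        by_contra! hk
        rw [← cR] at h2 hk
        rw [← cS] at h3 hk
        obtain ⟨r, hr, r', hr', hrr⟩ := one_lt_card.1 h2
        obtain ⟨s, hs, s', hs', hss⟩ := one_lt_card.1 h3
        have m₁ : r ∈ s ⊓ s' := ⟨hmem r hr s hs, hmem r hr s' hs'⟩
        have m₂ : r' ∈ s ⊓ s' := ⟨hmem r' hr' s hs, hmem r' hr' s' hs'⟩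
        have h1 := finrank_direction_inf_eq_one (hS s (hS₀ hs)) (hS s' (hS₀ hs')) hss m₁ m₂ hrr
        refine hline ⟨s ⊓ s', h1, hk.1.trans ?_, hk.2.trans ?_⟩
        · rw [← Set.ncard_coe_finset]
          exact Set.ncard_le_ncard
            (fun x hx => ⟨hR₀ hx, hmem x hx s hs, hmem x hx s' hs'⟩)
            (R.finite_toSet.subset fun x hx => hx.1)
        · rw [← Set.ncard_coe_finset]
          exact Set.ncard_le_ncard
            (fun x hx => ⟨hS₀ hx, le_of_finrank_direction_eq_one h1 m₁ m₂ hrr (hmem r hr x hx)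
              (hmem r' hr' x hx)⟩)
            (S.finite_toSet.subset fun x hx => hx.1) }
  have hcard : ∀ A₀ ⊆ R.image α, ∀ B₀ ⊆ S.image β, (∀ a ∈ A₀, ∀ b ∈ B₀, a.Meets b) →
      2 ≤ #B₀ → #A₀ ≤ p := by
    intro A₀ hA₀ B₀ hB₀ hm h3
    obtain ⟨R₀, hR₀, S₀, hS₀, cR, cS, hmem⟩ := hpull A₀ hA₀ B₀ hB₀ hm
    rw [← cS] at h3
    rw [← cR]
    by_contra! hlt
    obtain ⟨r, hr, r', hr', hrr⟩ := one_lt_card.1 (hp.out.one_lt.trans hlt)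
    obtain ⟨s, hs, s', hs', hss⟩ := one_lt_card.1 h3
    have h1 := finrank_direction_inf_eq_one (hS s (hS₀ hs)) (hS s' (hS₀ hs')) hss
      ⟨hmem r hr s hs, hmem r hr s' hs'⟩ ⟨hmem r' hr' s hs, hmem r' hr' s' hs'⟩ hrr
    have h2 := card_le_of_finrank_direction_eq_one h1 (R := R₀)
      fun x hx => ⟨hmem x hx s hs, hmem x hx s' hs'⟩
    rw [Nat.card_zmod] at h2
    omega
  have hinc : Set.ncard {q : (Fin 3 → ZMod p) × AffineSubspace (ZMod p) (Fin 3 → ZMod p) |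
      q.1 ∈ R ∧ q.2 ∈ S ∧ q.1 ∈ q.2} = incCount Ray.Meets (R.image α) (S.image β) := by
    have hset : {q : (Fin 3 → ZMod p) × AffineSubspace (ZMod p) (Fin 3 → ZMod p) |
        q.1 ∈ R ∧ q.2 ∈ S ∧ q.1 ∈ q.2} = ({q ∈ R ×ˢ S | q.1 ∈ q.2} : Finset _) := by
      ext q
      simp [and_assoc]
    rw [hset, Set.ncard_coe_finset, card_filter, sum_product, incCount,
      sum_image hαi.injOn]
    refine sum_congr rfl fun r _ => ?_
    rw [← card_filter, filter_image, card_image_of_injOn (hβi.mono (filter_subset _ _))]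
    congr 1
    exact filter_congr fun s hs => (hαβ r s (hS s hs)).2.symm
  have hcR : #(R.image α) = #R := card_image_of_injective _ hαi
  have hcS : #(S.image β) = #S := card_image_of_injOn hβi
  have hmain := hpair.incCount_le hp.out.pos (by rw [hcR, hcS]; exact hRS) hcard
  rwa [← hinc, hcR, hcS, Real.sqrt_eq_rpow] at hmain

end FpDist
end
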